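/- Let G be an even-hole-free graph, and let a ∈ V(G) be splendid. Suppose there is no extended near-prism contained in G such that a is an end of its cross-edge. Let 𝒮=(a,S1,…,Sk) be an indecomposable pyramid strip system with apex a, with strips Si=(Ai,Bi,Ci) for 1≤i≤k, chosen with V(𝒮) maximal. Then N[a]\V(𝒮) is a clique. -/

import Mathlib

open SimpleGraph

namespace EHF

variable {V : Type*} {W : Type*} {U : Type*}

/-- The closed neighbourhood `N[a]` of a vertex `a`. -/
def closedNbhd (G : SimpleGraph V) (a : V) : Set V := insert a (G.neighborSet a)

/-- A hole: an induced cycle of length at least four. -/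
def IsHole (G : SimpleGraph V) {v : V} (c : G.Walk v v) : Prop :=
  c.IsCycle ∧ 4 ≤ c.length ∧
    ∀ x y : V, x ∈ c.support → y ∈ c.support → G.Adj x y → s(x, y) ∈ c.edges

/-- A graph is even-hole-free if it has no hole with an even number of vertices. -/
def EvenHoleFree (G : SimpleGraph V) : Prop :=
  ∀ (v : V) (c : G.Walk v v), IsHole G c → ¬ Even c.length

/-- A vertex is bisimplicial if its neighbourhood is the union of two cliques. -/
def Bisimplicial (G : SimpleGraph V) (v : V) : Prop :=
  ∃ K₁ K₂ : Set V, G.IsClique K₁ ∧ G.IsClique K₂ ∧ G.neighborSet v = K₁ ∪ K₂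

/-- `F` induces a connected subgraph of `G`. -/
def ConnectedSubset (G : SimpleGraph V) (F : Set V) : Prop :=
  F.Nonempty ∧ ∀ x ∈ F, ∀ y ∈ F, ∃ p : G.Walk x y, ∀ z ∈ p.support, z ∈ F

/-- `F` is the vertex set of a connected component of `G` minus the vertex set `S`. -/
def IsComponentOf (G : SimpleGraph V) (S F : Set V) : Prop :=
  ConnectedSubset G F ∧ Disjoint F S ∧
    ∀ x ∈ F, ∀ y : V, y ∉ S → G.Adj x y → y ∈ F

/-- The set of vertices of `S` having a neighbour in `F`. -/
def Att (G : SimpleGraph V) (S F : Set V) : Set V :=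
  {v ∈ S | ∃ x ∈ F, G.Adj v x}

/-- A cutset: the rest of the graph is the union of two nonempty sets that are
anticomplete to each other. -/
def IsCutset (G : SimpleGraph V) (C : Set V) : Prop :=
  ∃ X Y : Set V, X.Nonempty ∧ Y.Nonempty ∧ Disjoint X Y ∧ X ∪ Y = Cᶜ ∧
    ∀ x ∈ X, ∀ y ∈ Y, ¬ G.Adj x y

/-- `G` has a full star cutset with centre `v`. -/
def FullStarCutset (G : SimpleGraph V) (v : V) : Prop :=
  IsCutset G (closedNbhd G v)

/-- A walk is induced if every edge of `G` between vertices of the walk is an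
edge of the walk. -/
def InducedWalk (G : SimpleGraph V) {x y : V} (P : G.Walk x y) : Prop :=
  ∀ u v : V, u ∈ P.support → v ∈ P.support → G.Adj u v → s(u, v) ∈ P.edges

/-- A theta with ends `u,w` and constituent paths `P₁,P₂,P₃`, as an induced
subgraph of `G`. -/
def IsThetaIn (G : SimpleGraph V) (u w : V) (P₁ P₂ P₃ : G.Walk u w) : Prop :=
  u ≠ w ∧ P₁.IsPath ∧ P₂.IsPath ∧ P₃.IsPath ∧
  2 ≤ P₁.length ∧ 2 ≤ P₂.length ∧ 2 ≤ P₃.length ∧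
  (∀ v : V, v ∈ P₁.support → v ∈ P₂.support → v = u ∨ v = w) ∧
  (∀ v : V, v ∈ P₁.support → v ∈ P₃.support → v = u ∨ v = w) ∧
  (∀ v : V, v ∈ P₂.support → v ∈ P₃.support → v = u ∨ v = w) ∧
  (∀ x y : V, (x ∈ P₁.support ∨ x ∈ P₂.support ∨ x ∈ P₃.support) →
    (y ∈ P₁.support ∨ y ∈ P₂.support ∨ y ∈ P₃.support) → G.Adj x y →
    s(x, y) ∈ P₁.edges ∨ s(x, y) ∈ P₂.edges ∨ s(x, y) ∈ P₃.edges)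

/-- A near-prism with bases `{a₁,a₂,a₃}`, `{b₁,b₂,b₃}` and constituent paths
`R₁,R₂,R₃`, as an induced subgraph of `G`. -/
def IsNearPrismIn (G : SimpleGraph V) (a₁ a₂ a₃ b₁ b₂ b₃ : V)
    (R₁ : G.Walk a₁ b₁) (R₂ : G.Walk a₂ b₂) (R₃ : G.Walk a₃ b₃) : Prop :=
  G.Adj a₁ a₂ ∧ G.Adj a₁ a₃ ∧ G.Adj a₂ a₃ ∧
  G.Adj b₁ b₂ ∧ G.Adj b₁ b₃ ∧ G.Adj b₂ b₃ ∧
  (({a₁, a₂, a₃} : Set V) ∩ ({b₁, b₂, b₃} : Set V) = ({a₃} : Set V) ∩ ({b₃} : Set V)) ∧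
  R₁.IsPath ∧ R₂.IsPath ∧ R₃.IsPath ∧
  (∀ v : V, v ∈ R₁.support → v ∉ R₂.support) ∧
  (∀ v : V, v ∈ R₁.support → v ∉ R₃.support) ∧
  (∀ v : V, v ∈ R₂.support → v ∉ R₃.support) ∧
  (∀ p q : V, (p ∈ R₁.support ∨ p ∈ R₂.support ∨ p ∈ R₃.support) →
    (q ∈ R₁.support ∨ q ∈ R₂.support ∨ q ∈ R₃.support) → G.Adj p q →
    s(p, q) ∈ R₁.edges ∨ s(p, q) ∈ R₂.edges ∨ s(p, q) ∈ R₃.edges ∨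
    s(p, q) = s(a₁, a₂) ∨ s(p, q) = s(a₁, a₃) ∨ s(p, q) = s(a₂, a₃) ∨
    s(p, q) = s(b₁, b₂) ∨ s(p, q) = s(b₁, b₃) ∨ s(p, q) = s(b₂, b₃))

/-- An extended near-prism contained in `G`, with cross-edge `xy` where
`x` lies in the interior of `R₁` and `y` in the interior of `R₂`. -/
def IsExtNearPrismIn (G : SimpleGraph V) (a₁ a₂ a₃ b₁ b₂ b₃ : V)
    (R₁ : G.Walk a₁ b₁) (R₂ : G.Walk a₂ b₂) (R₃ : G.Walk a₃ b₃) (x y : V) : Prop :=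
  G.Adj a₁ a₂ ∧ G.Adj a₁ a₃ ∧ G.Adj a₂ a₃ ∧
  G.Adj b₁ b₂ ∧ G.Adj b₁ b₃ ∧ G.Adj b₂ b₃ ∧
  (({a₁, a₂, a₃} : Set V) ∩ ({b₁, b₂, b₃} : Set V) = ({a₃} : Set V) ∩ ({b₃} : Set V)) ∧
  R₁.IsPath ∧ R₂.IsPath ∧ R₃.IsPath ∧
  (∀ v : V, v ∈ R₁.support → v ∉ R₂.support) ∧
  (∀ v : V, v ∈ R₁.support → v ∉ R₃.support) ∧
  (∀ v : V, v ∈ R₂.support → v ∉ R₃.support) ∧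
  x ∈ R₁.support ∧ x ≠ a₁ ∧ x ≠ b₁ ∧
  y ∈ R₂.support ∧ y ≠ a₂ ∧ y ≠ b₂ ∧
  G.Adj x y ∧
  (∀ p q : V, (p ∈ R₁.support ∨ p ∈ R₂.support ∨ p ∈ R₃.support) →
    (q ∈ R₁.support ∨ q ∈ R₂.support ∨ q ∈ R₃.support) → G.Adj p q →
    s(p, q) ∈ R₁.edges ∨ s(p, q) ∈ R₂.edges ∨ s(p, q) ∈ R₃.edges ∨
    s(p, q) = s(a₁, a₂) ∨ s(p, q) = s(a₁, a₃) ∨ s(p, q) = s(a₂, a₃) ∨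
    s(p, q) = s(b₁, b₂) ∨ s(p, q) = s(b₁, b₃) ∨ s(p, q) = s(b₂, b₃) ∨
    s(p, q) = s(x, y))

/-- There is an extended near-prism contained in `G` such that `a` is an end of
its cross-edge. -/
def ExtNearPrismCrossEnd (G : SimpleGraph V) (a : V) : Prop :=
  ∃ (a₁ a₂ a₃ b₁ b₂ b₃ : V) (R₁ : G.Walk a₁ b₁) (R₂ : G.Walk a₂ b₂)
    (R₃ : G.Walk a₃ b₃) (y : V),
    IsExtNearPrismIn G a₁ a₂ a₃ b₁ b₂ b₃ R₁ R₂ R₃ a y ∨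
    IsExtNearPrismIn G a₁ a₂ a₃ b₁ b₂ b₃ R₁ R₂ R₃ y a

/-- `G` contains an even wheel (as an induced subgraph). -/
def HasEvenWheel (G : SimpleGraph V) : Prop :=
  ∃ (u : V) (c : G.Walk u u) (v : V), IsHole G c ∧ v ∉ c.support ∧
    3 ≤ {x : V | x ∈ c.support ∧ G.Adj v x}.ncard ∧
    ({x : V | x ∈ c.support ∧ G.Adj v x}.ncard = 3 →
      ∀ x y : V, x ∈ c.support → y ∈ c.support → G.Adj v x → G.Adj v y → ¬ G.Adj x y) ∧
    Even {x : V | x ∈ c.support ∧ G.Adj v x}.ncard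

/-- A pyramid with apex `a`, base `{b₁,b₂,b₃}` and constituent paths
`R₁,R₂,R₃`, as an induced subgraph of `G`. -/
def IsPyramidIn (G : SimpleGraph V) (a b₁ b₂ b₃ : V)
    (R₁ : G.Walk a b₁) (R₂ : G.Walk a b₂) (R₃ : G.Walk a b₃) : Prop :=
  G.Adj b₁ b₂ ∧ G.Adj b₁ b₃ ∧ G.Adj b₂ b₃ ∧
  a ≠ b₁ ∧ a ≠ b₂ ∧ a ≠ b₃ ∧
  R₁.IsPath ∧ R₂.IsPath ∧ R₃.IsPath ∧
  (∀ v : V, v ∈ R₁.support → v ∈ R₂.support → v = a) ∧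
  (∀ v : V, v ∈ R₁.support → v ∈ R₃.support → v = a) ∧
  (∀ v : V, v ∈ R₂.support → v ∈ R₃.support → v = a) ∧
  ((2 ≤ R₁.length ∧ 2 ≤ R₂.length) ∨ (2 ≤ R₁.length ∧ 2 ≤ R₃.length) ∨
    (2 ≤ R₂.length ∧ 2 ≤ R₃.length)) ∧
  (∀ p q : V, (p ∈ R₁.support ∨ p ∈ R₂.support ∨ p ∈ R₃.support) →
    (q ∈ R₁.support ∨ q ∈ R₂.support ∨ q ∈ R₃.support) → G.Adj p q →
    s(p, q) ∈ R₁.edges ∨ s(p, q) ∈ R₂.edges ∨ s(p, q) ∈ R₃.edges ∨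
    s(p, q) = s(b₁, b₂) ∨ s(p, q) = s(b₁, b₃) ∨ s(p, q) = s(b₂, b₃))

/-- A vertex `a` is splendid: `V(G)\N[a]` is connected, every neighbour of `a`
has a neighbour in `V(G)\N[a]`, and there is no short pyramid with apex `a`. -/
def Splendid (G : SimpleGraph V) (a : V) : Prop :=
  ConnectedSubset G ((closedNbhd G a)ᶜ) ∧
  (∀ v : V, G.Adj a v → ∃ w : V, w ∉ closedNbhd G a ∧ G.Adj v w) ∧
  ¬ ∃ (b₁ b₂ b₃ : V) (R₁ : G.Walk a b₁) (R₂ : G.Walk a b₂) (R₃ : G.Walk a b₃),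
      IsPyramidIn G a b₁ b₂ b₃ R₁ R₂ R₃ ∧
      (R₁.length = 1 ∨ R₂.length = 1 ∨ R₃.length = 1)

/-- A rung of the strip `(A,B,C)`. -/
def IsRung (G : SimpleGraph V) (A B C : Set V) {x y : V} (P : G.Walk x y) : Prop :=
  P.IsPath ∧ x ∈ A ∧ y ∈ B ∧
  (∀ v ∈ P.support, v ≠ x → v ≠ y → v ∈ C) ∧
  (x ≠ y → x ∉ B ∧ y ∉ A) ∧
  InducedWalk G P

/-- A strip `(A,B,C)`: `A,B` nonempty and disjoint from `C`, and every vertex of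
`A∪B∪C` lies on a rung. -/
def IsStrip (G : SimpleGraph V) (A B C : Set V) : Prop :=
  A.Nonempty ∧ B.Nonempty ∧ Disjoint A C ∧ Disjoint B C ∧
  ∀ v ∈ A ∪ B ∪ C, ∃ (x y : V) (P : G.Walk x y), IsRung G A B C P ∧ v ∈ P.support

/-- A `J`-strip system in `G`. -/
structure StripSystem (G : SimpleGraph V) (J : SimpleGraph W) where
  ME : W → W → Set V
  MV : W → Set V
  me_symm : ∀ u v : W, ME u v = ME v u
  me_disj : ∀ u v w x : W, J.Adj u v → J.Adj w x → s(u, v) ≠ s(w, x) →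
    Disjoint (ME u v) (ME w x)
  mv_sub : ∀ u : W, MV u ⊆ ⋃ (v : W), ⋃ (_ : J.Adj u v), ME u v
  strip : ∀ u v : W, J.Adj u v →
    IsStrip G (ME u v ∩ MV u) (ME u v ∩ MV v) (ME u v \ (MV u ∪ MV v))
  far : ∀ u v w x : W, J.Adj u v → J.Adj w x → u ≠ w → u ≠ x → v ≠ w → v ≠ x →
    ∀ p ∈ ME u v, ∀ q ∈ ME w x, ¬ G.Adj p q
  near : ∀ u v w : W, J.Adj u v → J.Adj u w → v ≠ w →
    ∀ p ∈ ME u v, ∀ q ∈ ME u w, (G.Adj p q ↔ p ∈ MV u ∧ q ∈ MV u)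

/-- `V(M)`: the union of the sets `M_e` over the edges of `J`. -/
def VM {G : SimpleGraph V} {J : SimpleGraph W} (S : StripSystem G J) : Set V :=
  ⋃ (u : W), ⋃ (v : W), ⋃ (_ : J.Adj u v), S.ME u v

/-- A leaf of a graph: a vertex of degree exactly one. -/
def IsLeaf (J : SimpleGraph W) (u : W) : Prop := (J.neighborSet u).ncard = 1

/-- `ab` is a cross-edge for the strip system `S` with partition `(α,β)` of the
leaves of `J`. -/
def IsCrossEdge {G : SimpleGraph V} {J : SimpleGraph W} (S : StripSystem G J)
    (a b : V) (α β : Set W) : Prop :=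
  G.Adj a b ∧
  α ∪ β = {u : W | IsLeaf J u} ∧ Disjoint α β ∧
  (∀ u : W, (J.neighborSet u).ncard ≠ 2) ∧
  3 ≤ Nat.card W ∧
  (∀ u u₁ u₂ : W, u₁ ∈ α → u₂ ∈ α → J.Adj u u₁ → J.Adj u u₂ → u₁ = u₂) ∧
  (∀ u u₁ u₂ : W, u₁ ∈ β → u₂ ∈ β → J.Adj u u₁ → J.Adj u u₂ → u₁ = u₂) ∧
  (∀ u v : W, J.Adj u v → a ∉ S.ME u v ∧ b ∉ S.ME u v) ∧
  (∀ x ∈ VM S, (G.Adj a x ↔ ∃ u ∈ α, x ∈ S.MV u)) ∧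
  (∀ x ∈ VM S, (G.Adj b x ↔ ∃ u ∈ β, x ∈ S.MV u))

/-- A local subset of `V(M)∪{a,b}`. -/
def IsLocal {G : SimpleGraph V} {J : SimpleGraph W} (S : StripSystem G J)
    (a b : V) (α β : Set W) (X : Set V) : Prop :=
  (∃ u v : W, J.Adj u v ∧ X ⊆ S.ME u v) ∨
  (∃ u : W, X ⊆ S.MV u) ∨
  (a ∈ X ∧ b ∉ X ∧ ∃ u ∈ α, X \ {a} ⊆ S.MV u) ∨
  (b ∈ X ∧ a ∉ X ∧ ∃ u ∈ β, X \ {b} ⊆ S.MV u)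

/-- A branch-vertex of a tree: a vertex of degree different from two. -/
def BranchVertex (T : SimpleGraph U) (u : U) : Prop := (T.neighborSet u).ncard ≠ 2

/-- `u` and `v` are distinct branch-vertices joined by a branch of `T`. -/
def JoinedByBranch (T : SimpleGraph U) (u v : U) : Prop :=
  u ≠ v ∧ BranchVertex T u ∧ BranchVertex T v ∧
    ∃ p : T.Walk u v, p.IsPath ∧
      ∀ w ∈ p.support, w ≠ u → w ≠ v → (T.neighborSet w).ncard = 2

/-- The shape of a tree `T`: the graph on its branch-vertices, two being
adjacent when joined by a branch. -/
def Shape (T : SimpleGraph U) : SimpleGraph {u : U // BranchVertex T u} :=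
  SimpleGraph.fromRel (fun u v => JoinedByBranch T u.1 v.1)

/-- `y` is reachable from `x` in `T` by a walk avoiding `v`. -/
def ReachAvoiding (T : SimpleGraph U) (v x y : U) : Prop :=
  ∃ p : T.Walk x y, v ∉ p.support

/-- The component of `x` in `T` minus `v` contains no vertex of `A`. -/
def MissesSet (T : SimpleGraph U) (v : U) (A : Set U) (x : U) : Prop :=
  ∀ z : U, ReachAvoiding T v x z → z ∉ A

/-- `G` contains an induced extended tree line-graph `H(T)` with cross-edge
`ab`, via the injection `φ` of the edges of `T` into `V(G)`, where `(A',B')`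
is the bipartition of the tree `T`. -/
def ExtTreeLineGraphIn (G : SimpleGraph V) (T : SimpleGraph U)
    (A' B' : Set U) (a b : V) (φ : Sym2 U → V) : Prop :=
  T.IsTree ∧
  A' ∪ B' = Set.univ ∧ Disjoint A' B' ∧
  (∀ u v : U, T.Adj u v → (u ∈ A' ↔ v ∈ B')) ∧
  3 ≤ {u : U | IsLeaf T u}.ncard ∧
  (∀ v x y : U, x ≠ v → y ≠ v → MissesSet T v A' x → MissesSet T v A' y →
    ReachAvoiding T v x y) ∧
  (∀ v x y : U, x ≠ v → y ≠ v → MissesSet T v B' x → MissesSet T v B' y →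
    ReachAvoiding T v x y) ∧
  G.Adj a b ∧
  Set.InjOn φ T.edgeSet ∧
  (∀ e ∈ T.edgeSet, φ e ≠ a ∧ φ e ≠ b) ∧
  (∀ e ∈ T.edgeSet, ∀ f ∈ T.edgeSet, e ≠ f →
    (G.Adj (φ e) (φ f) ↔ ∃ u : U, u ∈ e ∧ u ∈ f)) ∧
  (∀ e ∈ T.edgeSet, (G.Adj a (φ e) ↔ ∃ u : U, u ∈ e ∧ IsLeaf T u ∧ u ∈ A')) ∧
  (∀ e ∈ T.edgeSet, (G.Adj b (φ e) ↔ ∃ u : U, u ∈ e ∧ IsLeaf T u ∧ u ∈ B'))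

/-- `(J, M)` is optimal for the edge `ab`: `G` contains an induced extended tree
line-graph with cross-edge `ab`; among all such, the shape `J` has as many edges
as possible; and the `J`-strip system `S` has cross-edge `ab` with partition
`(α,β)` and `V(M)` maximal. -/
def OptimalFor {G : SimpleGraph V} {J : SimpleGraph W} (S : StripSystem G J)
    (a b : V) (α β : Set W) : Prop :=
  (∃ (n : ℕ) (T : SimpleGraph (Fin n)) (A' B' : Set (Fin n)) (φ : Sym2 (Fin n) → V),
      ExtTreeLineGraphIn G T A' B' a b φ ∧ Nonempty (J ≃g Shape T)) ∧
  (∀ (n : ℕ) (T : SimpleGraph (Fin n)) (A' B' : Set (Fin n)) (φ : Sym2 (Fin n) → V),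
      ExtTreeLineGraphIn G T A' B' a b φ →
      (Shape T).edgeSet.ncard ≤ J.edgeSet.ncard) ∧
  IsCrossEdge S a b α β ∧
  (∀ (S' : StripSystem G J) (α' β' : Set W), IsCrossEdge S' a b α' β' →
      VM S ⊆ VM S' → VM S' = VM S)

/-- There is a path from `y` to `VMset \ N[a]` containing no neighbours of `a`
except `y`. -/
def ExternalFrom (G : SimpleGraph V) (VMset : Set V) (a y : V) : Prop :=
  ∃ (z : V) (P : G.Walk y z), P.IsPath ∧ z ∈ VMset ∧ z ∉ closedNbhd G a ∧
    ∀ v ∈ P.support, G.Adj a v → v = y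

/-- A major vertex: a common neighbour of `a,b` that is both `a`-external and
`b`-external. -/
def MajorVertex {G : SimpleGraph V} {J : SimpleGraph W} (S : StripSystem G J)
    (a b : V) (y : V) : Prop :=
  G.Adj a y ∧ G.Adj b y ∧ ExternalFrom G (VM S) a y ∧ ExternalFrom G (VM S) b y

/-- The vertex set of a pyramid strip system. -/
def PSSVerts (a : V) {k : ℕ} (A B C : Fin k → Set V) : Set V :=
  insert a (⋃ i, A i ∪ B i ∪ C i)

/-- A pyramid strip system with apex `a` and proper strips `(A i, B i, C i)`. -/
def IsPyramidStripSystem (G : SimpleGraph V) (a : V) {k : ℕ}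
    (A B C : Fin k → Set V) : Prop :=
  3 ≤ k ∧
  (∀ i, IsStrip G (A i) (B i) (C i)) ∧
  (∀ i, Disjoint (A i) (B i)) ∧
  (∀ i j, i ≠ j → Disjoint (A i ∪ B i ∪ C i) (A j ∪ B j ∪ C j)) ∧
  (∀ i j, i ≠ j → ∀ p ∈ A i ∪ B i ∪ C i, ∀ q ∈ A j ∪ B j ∪ C j,
      (G.Adj p q ↔ p ∈ B i ∧ q ∈ B j)) ∧
  (∀ i, a ∉ A i ∪ B i ∪ C i) ∧
  (∀ i, ∀ p ∈ A i ∪ B i ∪ C i, (G.Adj a p ↔ p ∈ A i))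

/-- `D i`: the union of the vertex sets of all components `F` of
`G \ (V(𝒮) ∪ N[a])` having a neighbour in `A i ∪ C i`. -/
def PSSD (G : SimpleGraph V) (a : V) {k : ℕ} (A B C : Fin k → Set V)
    (i : Fin k) : Set V :=
  ⋃₀ {F : Set V | IsComponentOf G (PSSVerts a A B C ∪ closedNbhd G a) F ∧
      ∃ v ∈ A i ∪ C i, ∃ x ∈ F, G.Adj v x}

def TypeAlpha (G : SimpleGraph V) {k : ℕ} (A B C : Fin k → Set V) (v : V) : Prop :=
  ∀ i : Fin k, (∃ p ∈ B i ∪ C i, G.Adj v p) ∨ ∀ p ∈ A i, G.Adj v p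

def TypeAlpha' (G : SimpleGraph V) (a : V) {k : ℕ} (A B C : Fin k → Set V)
    (v : V) : Prop :=
  ∃ i : Fin k, (∃ x ∈ PSSD G a A B C i, G.Adj v x) ∧
    (∀ p ∈ B i ∪ C i, ¬ G.Adj v p) ∧
    ∀ j : Fin k, j ≠ i →
      (∀ p ∈ A j, G.Adj v p) ∧ ∀ p ∈ B j ∪ C j ∪ PSSD G a A B C j, ¬ G.Adj v p

def TypeBeta (G : SimpleGraph V) {k : ℕ} (A B C : Fin k → Set V) (v : V) : Prop :=
  ∃ i : Fin k, (∀ p ∈ A i ∪ B i ∪ C i, ¬ G.Adj v p) ∧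
    ∀ j : Fin k, j ≠ i → ∃ p ∈ B j ∪ C j, G.Adj v p

def TypeGamma (G : SimpleGraph V) (a : V) {k : ℕ} (A B C : Fin k → Set V)
    (v : V) : Prop :=
  ∃ (i : Fin k) (q : V) (Q : G.Walk v q), Q.IsPath ∧ InducedWalk G Q ∧
    (∀ w ∈ Q.support, w ≠ v → w ∉ PSSVerts a A B C ∪ closedNbhd G a) ∧
    (∃ p ∈ ⋃ j, B j, G.Adj q p) ∧
    ((∀ p ∈ (⋃ j, B j) \ B i, G.Adj q p) ∨ ∀ p ∈ (⋃ j, B j) \ B i, ¬ G.Adj q p) ∧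
    (∀ j : Fin k, j ≠ i → ∀ p ∈ A j, G.Adj v p) ∧
    (∀ j : Fin k, ∀ p ∈ B j ∪ C j ∪ PSSD G a A B C j, ¬ G.Adj v p) ∧
    ∀ w ∈ Q.support, w ≠ v → ∀ p ∈ PSSVerts a A B C, G.Adj w p →
      w = q ∧ p ∈ ⋃ j, B j

/-- A backdoor for `z`, relative to the strip `(A,B,C)` and the set `D`. -/
def Backdoor (G : SimpleGraph V) (A B C D : Set V) (z : V) : Prop :=
  ∃ (b' : V) (R : G.Walk z b'), R.IsPath ∧ InducedWalk G R ∧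
    (∀ w ∈ R.support, w ≠ z → w ≠ b' → ∀ p ∈ (A ∪ B ∪ C) ∪ D, ¬ G.Adj w p) ∧
    (∀ p ∈ B, G.Adj b' p) ∧ ∀ p ∈ A ∪ C ∪ D, ¬ G.Adj b' p

section Paths

variable {V : Type*} {G : SimpleGraph V}

/-- `IPath G x y n S`: `S` is the vertex set of an induced path of `G` with `n` edges
and ends `x` and `y`. -/
inductive IPath (G : SimpleGraph V) : V → V → ℕ → Set V → Prop
  | single (x : V) : IPath G x x 0 {x}
  | cons {x y z : V} {n : ℕ} {S : Set V} : G.Adj x y → IPath G y z n S → x ∉ S →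
      (∀ w ∈ S, G.Adj x w → w = y) → IPath G x z (n + 1) (insert x S)

namespace IPath

variable {x y z x' y' b : V} {n m : ℕ} {S T X Y : Set V}

theorem left_mem (h : IPath G x y n S) : x ∈ S := by
  cases h <;> simp

theorem right_mem (h : IPath G x y n S) : y ∈ S := by
  induction h with
  | single => simp
  | cons _ _ _ _ ih => exact Set.mem_insert_of_mem _ ih

theorem zero_iff (h : IPath G x y n S) : n = 0 ↔ x = y := by
  cases h with
  | single => simp
  | cons _ h1 h2 _ =>
    refine ⟨by omega, fun e => ?_⟩
    subst e
    exact absurd h1.right_mem h2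

theorem eq_singleton (h : IPath G x y 0 S) : S = {x} ∧ x = y := by
  cases h; exact ⟨rfl, rfl⟩

/-- Inversion of a nontrivial path at its first vertex. -/
theorem uncons (h : IPath G x y (n + 1) S) :
    ∃ x' S', G.Adj x x' ∧ IPath G x' y n S' ∧ x ∉ S' ∧ S = insert x S' ∧
      ∀ w ∈ S', G.Adj x w → w = x' := by
  cases h with
  | cons h0 h1 h2 h3 => exact ⟨_, _, h0, h1, h2, rfl, h3⟩

theorem eq_one (h : IPath G x y n S) (hxy : G.Adj x y) : n = 1 := by
  cases h with
  | single => exact absurd hxy (G.loopless.irrefl _)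
  | cons h0 h1 h2 h3 =>
    have := h3 _ h1.right_mem hxy
    subst this
    simpa using h1.zero_iff.2 rfl

theorem congr_set (h : IPath G x y n S) (e : S = T) : IPath G x y n T := e ▸ h

/-- Two induced paths joined by a single edge between their ends. -/
theorem join (h : IPath G x y n S) (h' : IPath G y' z m T) (hadj : G.Adj y y')
    (hd : Disjoint S T) (hc : ∀ u ∈ S, ∀ w ∈ T, G.Adj u w → u = y ∧ w = y') :
    IPath G x z (n + m + 1) (S ∪ T) := by
  induction h with
  | single x =>
    have := IPath.cons hadj h' (by simpa using hd) (fun w hw ha => (hc x (by simp) w hw ha).2)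
    simpa [Set.singleton_union] using this
  | @cons x u z n S h0 h1 h2 h3 ih =>
    have hd' : Disjoint S T := hd.mono_left (Set.subset_insert _ _)
    have := ih hadj hd' (fun u hu w hw ha => hc u (Set.mem_insert_of_mem _ hu) w hw ha)
    have hx : x ∉ T := fun hx => Set.disjoint_left.1 hd (Set.mem_insert _ _) hx
    have h4 := IPath.cons h0 this (by simp [h2, hx]) (by
      rintro w (hw | hw) ha
      · exact h3 w hw ha
      · exact absurd ((hc x (Set.mem_insert _ _) w hw ha).1 ▸ h1.right_mem) h2)
    rw [Set.insert_union]
    convert h4 using 1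
    omega

theorem snoc (h : IPath G x y n S) (hadj : G.Adj y z) (hz : z ∉ S)
    (hc : ∀ w ∈ S, G.Adj z w → w = y) : IPath G x z (n + 1) (insert z S) := by
  have := h.join (IPath.single z) hadj (by simpa using hz)
    (by rintro u hu w rfl ha; exact ⟨hc u hu ha.symm, rfl⟩)
  simpa [Set.union_comm S, Set.singleton_union] using this

theorem symm (h : IPath G x y n S) : IPath G y x n S := by
  induction h with
  | single x => exact IPath.single x
  | cons h0 h1 h2 h3 ih => exact ih.snoc h0.symm h2 h3

/-- A vertex of an induced path splits it into two induced paths. -/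
theorem split (h : IPath G x y n S) (hz : z ∈ S) :
    ∃ d e S₁ S₂, IPath G x z d S₁ ∧ IPath G z y e S₂ ∧ d + e = n ∧ S₁ ∪ S₂ = S ∧
      S₁ ∩ S₂ = {z} ∧
      (∀ u ∈ S₁, ∀ w ∈ S₂, G.Adj u w → u = z ∨ w = z) := by
  induction h with
  | single x =>
    obtain rfl : z = x := by simpa using hz
    exact ⟨0, 0, {z}, {z}, .single z, .single z, rfl, by simp, by simp, by simp⟩
  | @cons x u y n S h0 h1 h2 h3 ih =>
    by_cases hzx : z = x
    · subst hzx
      refine ⟨0, n + 1, {z}, insert z S, .single z, .cons h0 h1 h2 h3, by omega, ?_, ?_, ?_⟩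
      · simp
      · simp
      · rintro u rfl w _ _; exact Or.inl rfl
    · obtain ⟨d, e, S₁, S₂, g1, g2, g3, g4, g5, g6⟩ := ih (by simpa [hzx] using hz)
      have hs1 : S₁ ⊆ S := g4 ▸ Set.subset_union_left
      have hs2 : S₂ ⊆ S := g4 ▸ Set.subset_union_right
      refine ⟨d + 1, e, insert x S₁, S₂,
        .cons h0 g1 (fun h => h2 (hs1 h)) (fun w hw => h3 w (hs1 hw)), g2, by omega, ?_, ?_, ?_⟩
      · rw [Set.insert_union, g4]
      · rw [Set.insert_inter_of_notMem (fun h => h2 (hs2 h)), g5]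
      · rintro v (rfl | hv) w hw ha
        · have hwu := h3 w (hs2 hw) ha
          subst hwu
          have : w ∈ S₁ ∩ S₂ := ⟨g1.left_mem, hw⟩
          rw [g5] at this
          exact Or.inr this
        · exact g6 v hv w hw ha

/-- The last vertex of a path with a given property. -/
theorem last (h : IPath G x y n S) (P : V → Prop) (hP : ∃ s ∈ S, P s) :
    ∃ z m S', IPath G z y m S' ∧ S' ⊆ S ∧ P z ∧ (∀ w ∈ S', P w → w = z) ∧ m ≤ n ∧
      (x ∈ S' → (∀ w ∈ S, P w → w = x) ∧ z = x ∧ S' = S ∧ m = n) := by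
  induction h with
  | single x =>
    obtain ⟨s, hs, hPs⟩ := hP
    obtain rfl : s = x := by simpa using hs
    exact ⟨s, 0, {s}, .single s, le_rfl, hPs, by simp, le_rfl, by simp⟩
  | @cons x u y n S h0 h1 h2 h3 ih =>
    by_cases hS : ∃ s ∈ S, P s
    · obtain ⟨z, m, S', g1, g2, g3, g4, g5, g6⟩ := ih hS
      exact ⟨z, m, S', g1, g2.trans (Set.subset_insert _ _), g3, g4, by omega,
        fun hx => absurd (g2 hx) h2⟩
    · push Not at hS
      have hx : P x := by
        obtain ⟨s, hs | hs, hPs⟩ := hP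
        · exact hs ▸ hPs
        · exact absurd hPs (hS s hs)
      have : ∀ w ∈ insert x S, P w → w = x := by
        rintro w (hw | hw) hPw
        · exact hw
        · exact absurd hPw (hS w hw)
      exact ⟨x, n + 1, insert x S, .cons h0 h1 h2 h3, le_rfl, hx, this, le_rfl,
        fun _ => ⟨this, rfl, rfl, rfl⟩⟩

/-- The first vertex of a path with a given property. -/
theorem first (h : IPath G x y n S) (P : V → Prop) (hP : ∃ s ∈ S, P s) :
    ∃ z m S', IPath G x z m S' ∧ S' ⊆ S ∧ P z ∧ (∀ w ∈ S', P w → w = z) ∧ m ≤ n ∧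
      (y ∈ S' → (∀ w ∈ S, P w → w = y) ∧ z = y ∧ S' = S ∧ m = n) := by
  obtain ⟨z, m, S', g1, g2⟩ := h.symm.last P hP
  exact ⟨z, m, S', g1.symm, g2⟩

/-- A vertex with a neighbour on a path is joined to its end through the path. -/
theorem attach (h : IPath G y z n S) (hx : x ∉ S) (ha : ∃ s ∈ S, G.Adj x s) :
    ∃ m S', IPath G x z (m + 1) (insert x S') ∧ S' ⊆ S ∧ x ∉ S' := by
  obtain ⟨w, m, S', g1, g2, g3, g4, -⟩ := h.last (G.Adj x) ha
  exact ⟨m, S', .cons g3 g1 (fun h => hx (g2 h)) g4, g2, fun h => hx (g2 h)⟩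

/-- The first and last vertices of a path with a given property. -/
theorem extremes (h : IPath G x y n S) (P : V → Prop) (hP : ∃ s ∈ S, P s) :
    ∃ z z' d e S₁ S₂, IPath G x z d S₁ ∧ IPath G z' y e S₂ ∧ S₁ ⊆ S ∧ S₂ ⊆ S ∧
      P z ∧ P z' ∧ (∀ w ∈ S₁, P w → w = z) ∧ (∀ w ∈ S₂, P w → w = z') ∧
      (x ∈ S₂ → ∀ w ∈ S, P w → w = x) ∧ (y ∈ S₁ → ∀ w ∈ S, P w → w = y) ∧
      ((z = z' ∧ d + e = n) ∨
        (G.Adj z z' ∧ d + e + 1 = n ∧ Disjoint S₁ S₂ ∧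
          ∀ u ∈ S₁, ∀ w ∈ S₂, G.Adj u w → u = z ∧ w = z') ∨
        (Disjoint S₁ S₂ ∧ ∀ u ∈ S₁, ∀ w ∈ S₂, ¬ G.Adj u w)) := by
  induction h with
  | single x =>
    obtain ⟨s, hs, hPs⟩ := hP
    obtain rfl : s = x := by simpa using hs
    exact ⟨s, s, 0, 0, {s}, {s}, .single s, .single s, le_rfl, le_rfl, hPs, hPs, by simp,
      by simp, by simp, by simp, Or.inl ⟨rfl, rfl⟩⟩
  | @cons x u y n S h0 h1 h2 h3 ih =>
    by_cases hx : P x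
    · by_cases hS : ∃ s ∈ S, P s
      · obtain ⟨z, m, S', g1, g2, g3, g4, g5, g6⟩ := h1.last P hS
        have hxS : x ∉ S' := fun h => h2 (g2 h)
        refine ⟨x, z, 0, m, {x}, S', .single x, g1, by simp, g2.trans (Set.subset_insert _ _), hx,
          g3, by simp, g4, fun hx' => absurd hx' hxS,
          fun hy => absurd h1.right_mem (by rw [Set.mem_singleton_iff.1 hy]; exact h2), ?_⟩
        by_cases huS : u ∈ S'
        · obtain ⟨-, e1, -, e2⟩ := g6 huS
          subst e1
          refine Or.inr (Or.inl ⟨h0, by omega, by simpa using hxS, ?_⟩)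
          rintro w rfl w' hw' ha
          exact ⟨rfl, h3 _ (g2 hw') ha⟩
        · refine Or.inr (Or.inr ⟨by simpa using hxS, ?_⟩)
          rintro w rfl w' hw' ha
          exact huS (h3 _ (g2 hw') ha ▸ hw')
      · push Not at hS
        have hall : ∀ w ∈ insert x S, P w → w = x := by
          rintro w (hw | hw) hPw
          · exact hw
          · exact absurd hPw (hS w hw)
        exact ⟨x, x, 0, n + 1, {x}, insert x S, .single x, .cons h0 h1 h2 h3, by simp, le_rfl, hx,
          hx, by simp, hall, fun _ => hall,
          fun hy => absurd h1.right_mem (by rw [Set.mem_singleton_iff.1 hy]; exact h2),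
          Or.inl ⟨rfl, by omega⟩⟩
    · obtain ⟨s, hs, hPs⟩ := hP
      have hs' : s ∈ S := by
        rcases hs with rfl | hs
        · exact absurd hPs hx
        · exact hs
      obtain ⟨z, z', d, e, S₁, S₂, g1, g2, g3, g4, g5, g6, g7, g8, g9, g10, g11⟩ := ih ⟨s, hs', hPs⟩
      refine ⟨z, z', d + 1, e, insert x S₁, S₂,
        .cons h0 g1 (fun h => h2 (g3 h)) (fun w hw => h3 w (g3 hw)), g2,
        Set.insert_subset_insert g3, g4.trans (Set.subset_insert _ _), g5, g6, ?_, g8, ?_, ?_, ?_⟩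
      · rintro w (rfl | hw) hPw
        · exact absurd hPw hx
        · exact g7 w hw hPw
      · exact fun hx' => absurd (g4 hx') h2
      · rintro (rfl | hy)
        · exact absurd h1.right_mem h2
        · rintro w (rfl | hw) hPw
          · exact absurd hPw hx
          · exact g10 hy w hw hPw
      · have hxS : x ∉ S₂ := fun h => h2 (g4 h)
        rcases g11 with ⟨q1, q2⟩ | ⟨q1, q2, q3, q4⟩ | ⟨q1, q2⟩
        · exact Or.inl ⟨q1, by omega⟩
        · refine Or.inr (Or.inl ⟨q1, by omega, by simp [hxS, q3], ?_⟩)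
          rintro w (rfl | hw) w' hw' ha
          · exfalso
            have := h3 w' (g4 hw') ha
            subst this
            exact Set.disjoint_left.1 q3 g1.left_mem hw'
          · exact q4 w hw w' hw' ha
        · refine Or.inr (Or.inr ⟨by simp [hxS, q1], ?_⟩)
          rintro w (rfl | hw) w' hw' ha
          · have := h3 w' (g4 hw') ha
            subst this
            exact Set.disjoint_left.1 q1 g1.left_mem hw'
          · exact q2 w hw w' hw' ha

end IPath
end Paths

section Holes

variable {V : Type*} {G : SimpleGraph V}

/-- `y` can be reached from `x` by a walk whose vertices other than `x` belong to `X`. -/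
def Rch (G : SimpleGraph V) (X : Set V) (x y : V) : Prop :=
  Relation.ReflTransGen (fun u w => G.Adj u w ∧ w ∈ X) x y

/-- Disjoint sets with no edges between them. -/
def Far (G : SimpleGraph V) (X Y : Set V) : Prop :=
  ∀ u ∈ X, ∀ w ∈ Y, u ≠ w ∧ ¬ G.Adj u w

theorem Far.mono {X Y X' Y' : Set V} (h : Far G X Y) (hX : X' ⊆ X) (hY : Y' ⊆ Y) : Far G X' Y' :=
  fun u hu w hw => h u (hX hu) w (hY hw)

variable {x y z x' y' b : V} {n m : ℕ} {S T X Y : Set V}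

namespace Rch

theorem refl : Rch G X x x := Relation.ReflTransGen.refl

theorem step (h : G.Adj x y) (hy : y ∈ X) : Rch G X x y := .single ⟨h, hy⟩

theorem trans (h : Rch G X x y) (h' : Rch G X y z) : Rch G X x z :=
  Relation.ReflTransGen.trans h h'

theorem mono (h : Rch G X x y) (hXY : X ⊆ Y) : Rch G Y x y :=
  Relation.ReflTransGen.mono (p := fun u w => G.Adj u w ∧ w ∈ Y) (fun _ _ h => ⟨h.1, hXY h.2⟩) _ _ h

theorem mem (h : Rch G X x y) (hx : x ∈ X) : y ∈ X := by
  rcases Relation.ReflTransGen.cases_tail h with rfl | ⟨c, -, hc⟩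
  · exact hx
  · exact hc.2

theorem symm (h : Rch G X x y) (hx : x ∈ X) : Rch G X y x := by
  induction h with
  | refl => exact .refl
  | @tail u w h1 h2 ih =>
    exact Relation.ReflTransGen.head ⟨h2.1.symm, Rch.mem h1 hx⟩ ih

/-- A reachable vertex is the end of an induced path. -/
theorem exists_path (h : Rch G X x y) : ∃ n S, IPath G x y n S ∧ S ⊆ insert x X := by
  induction h using Relation.ReflTransGen.head_induction_on with
  | refl => exact ⟨0, {y}, .single y, by simp⟩
  | @head u w h1 _ ih =>
    obtain ⟨n, S, hS, hsub⟩ := ih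
    have hSX : S ⊆ X := hsub.trans (Set.insert_subset h1.2 le_rfl)
    by_cases hu : u ∈ S
    · obtain ⟨d, e, S₁, S₂, -, g2, -, g4, -⟩ := hS.split hu
      exact ⟨e, S₂, g2, (g4 ▸ Set.subset_union_right : S₂ ⊆ S).trans
        (hSX.trans (Set.subset_insert _ _))⟩
    · obtain ⟨m, S', g1, g2, -⟩ := hS.attach hu ⟨w, hS.left_mem, h1.1⟩
      exact ⟨_, _, g1, Set.insert_subset_insert (g2.trans hSX)⟩

end Rch

theorem IPath.rch (h : IPath G x y n S) : ∀ w ∈ S, Rch G S x w := by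
  induction h with
  | single x => rintro w rfl; exact .refl
  | @cons x u y n S h0 h1 h2 h3 ih =>
    rintro w (rfl | hw)
    · exact .refl
    · exact (Rch.step h0 (Set.mem_insert_of_mem _ h1.left_mem)).trans
        ((ih w hw).mono (Set.subset_insert _ _))

theorem rch_of_walk (p : G.Walk x y) (h : ∀ z ∈ p.support, z ∈ X) : Rch G X x y := by
  induction p with
  | nil => exact .refl
  | cons ha p ih =>
    exact (Rch.step ha (h _ (by simp))).trans (ih fun z hz => h z (by simp [hz]))

theorem Rch.walk (h : Rch G X x y) (hx : x ∈ X) : ∃ p : G.Walk x y, ∀ z ∈ p.support, z ∈ X := by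
  induction h using Relation.ReflTransGen.head_induction_on with
  | refl => exact ⟨.nil, by simpa using hx⟩
  | @head u w h1 _ ih =>
    obtain ⟨p, hp⟩ := ih h1.2
    exact ⟨.cons h1.1 p, by simpa [hx] using hp⟩

theorem connectedSubset_iff :
    ConnectedSubset G X ↔ X.Nonempty ∧ ∀ x ∈ X, ∀ y ∈ X, Rch G X x y := by
  refine and_congr_right fun _ => ⟨fun h x hx y hy => ?_, fun h x hx y hy => (h x hx y hy).walk hx⟩
  obtain ⟨p, hp⟩ := h x hx y hy
  exact rch_of_walk p hp

theorem ipath_of_walk (p : G.Walk x y) (hp : p.IsPath) (hi : InducedWalk G p) :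
    IPath G x y p.length {v | v ∈ p.support} := by
  induction p with
  | nil => simpa using IPath.single _
  | @cons u v w ha p ih =>
    rw [Walk.cons_isPath_iff] at hp
    have := IPath.cons ha (ih hp.1 ?_) hp.2 ?_
    · refine this.congr_set ?_
      ext; simp
    · intro s t hs ht hst
      have := hi s t (by simp [hs]) (by simp [ht]) hst
      rw [Walk.edges_cons, List.mem_cons] at this
      rcases this with h | h
      · exfalso
        rcases Sym2.eq_iff.1 h with ⟨rfl, -⟩ | ⟨-, rfl⟩ <;> exact hp.2 (by assumption)
      · exact h
    · intro t ht hut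
      have := hi u t (by simp) (by simp [show t ∈ p.support from ht]) hut
      rw [Walk.edges_cons, List.mem_cons] at this
      rcases this with h | h
      · rcases Sym2.eq_iff.1 h with ⟨-, rfl⟩ | ⟨rfl, rfl⟩ <;> rfl
      · exact absurd (p.fst_mem_support_of_mem_edges h) hp.2

theorem IPath.walk (h : IPath G x y n S) :
    ∃ p : G.Walk x y, p.IsPath ∧ p.length = n ∧ (∀ v, v ∈ p.support ↔ v ∈ S) ∧ InducedWalk G p := by
  induction h with
  | single x => exact ⟨.nil, by simp, rfl, by simp, by
      intro u v hu hv ha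
      simp only [Walk.support_nil, List.mem_singleton] at hu hv
      subst hu hv
      exact absurd ha (G.loopless.irrefl _)⟩
  | @cons x u y n S h0 h1 h2 h3 ih =>
    obtain ⟨p, q1, q2, q3, q4⟩ := ih
    refine ⟨.cons h0 p, by simp [q1, q3, h2], by simp [q2], by simp [q3], ?_⟩
    intro s t hs ht ha
    simp only [Walk.support_cons, List.mem_cons, q3] at hs ht
    rw [Walk.edges_cons, List.mem_cons]
    rcases hs with rfl | hs <;> rcases ht with rfl | ht
    · exact absurd ha (G.loopless.irrefl _)
    · exact Or.inl (by rw [h3 t ht ha])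
    · exact Or.inl (by rw [h3 s hs ha.symm, Sym2.eq_swap])
    · exact Or.inr (q4 s t ((q3 s).2 hs) ((q3 t).2 ht) ha)

/-- An induced path and a vertex joined to both of its ends form a hole. -/
theorem EvenHoleFree.odd_of_vertex (hG : EvenHoleFree G) (h : IPath G x y n S) {v : V}
    (hv : v ∉ S) (hx : G.Adj v x) (hy : G.Adj v y) (hn : 2 ≤ n)
    (hc : ∀ w ∈ S, G.Adj v w → w = x ∨ w = y) : Odd n := by
  obtain ⟨p, q1, q2, q3, q4⟩ := h.walk
  by_contra hodd
  have hvp : v ∉ p.support := by rwa [q3]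
  have hxy : x ≠ y := fun e => by have := h.zero_iff.2 e; omega
  refine hG v (.cons hx (p.concat hy.symm)) ⟨?_, ?_, ?_⟩ ?_
  · rw [Walk.cons_isCycle_iff]
    refine ⟨q1.concat hvp hy.symm, ?_⟩
    rw [Walk.edges_concat]
    simp only [List.concat_eq_append, List.mem_append, List.mem_singleton, not_or]
    refine ⟨fun h => hvp (p.fst_mem_support_of_mem_edges h), fun h => ?_⟩
    rcases Sym2.eq_iff.1 h with ⟨rfl, -⟩ | ⟨-, e⟩
    · exact hvp p.end_mem_support
    · exact hxy e
  · simp; omega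
  · have key : ∀ s t, s = v → t ∈ p.support → G.Adj s t →
        s(s, t) ∈ (Walk.cons hx (p.concat hy.symm)).edges := by
      rintro s t rfl ht ha
      simp only [Walk.edges_cons, Walk.edges_concat, List.concat_eq_append, List.mem_cons,
        List.mem_append, List.not_mem_nil, or_false]
      rcases hc t ((q3 t).1 ht) ha with rfl | rfl
      · exact Or.inl rfl
      · exact Or.inr (Or.inr Sym2.eq_swap)
    intro s t hs ht ha
    simp only [Walk.support_cons, Walk.support_concat, List.mem_cons,
      List.mem_append, List.not_mem_nil, or_false] at hs ht
    have hs' : s = v ∨ s ∈ p.support := by tauto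
    have ht' : t = v ∨ t ∈ p.support := by tauto
    rcases hs' with e1 | hs' <;> rcases ht' with e2 | ht'
    · exact absurd (e1.trans e2.symm) ha.ne
    · exact key s t e1 ht' ha
    · rw [Sym2.eq_swap]
      exact key t s e2 hs' ha.symm
    · have := q4 s t hs' ht' ha
      simp only [Walk.edges_cons, Walk.edges_concat, List.concat_eq_append, List.mem_cons,
        List.mem_append, List.not_mem_nil, or_false]
      exact Or.inr (Or.inl this)
  · simp only [Walk.length_cons, Walk.length_concat, q2]
    rw [Nat.not_odd_iff_even] at hodd
    exact (hodd.add (by decide : Even 2))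

theorem EvenHoleFree.closeup_aux (hG : EvenHoleFree G) (h : IPath G x y (n + 1) S)
    (h' : IPath G x' y' m T) (hx : G.Adj x x') (hy : G.Adj y y') (hd : Disjoint S T)
    (hc : ∀ u ∈ S, ∀ w ∈ T, G.Adj u w → (u = x ∧ w = x') ∨ (u = y ∧ w = y')) :
    Odd (n + 1 + m) := by
  obtain ⟨x₁, S', g1, g2, g3, rfl, g5⟩ := h.uncons
  have hyS : y ∈ S' := g2.right_mem
  by_cases hnm : n + m = 0
  · rw [show n + 1 + m = 1 by omega]; exact odd_one
  have hj := g2.join h'.symm hy (hd.mono_left (Set.subset_insert _ _)) (by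
    intro u hu w hw ha
    rcases hc u (Set.mem_insert_of_mem _ hu) w hw ha with ⟨rfl, -⟩ | h
    · exact absurd hu g3
    · exact h)
  have := hG.odd_of_vertex hj (v := x) ?_ g1 hx (by omega) ?_
  · rwa [show n + 1 + m = n + m + 1 by omega]
  · rintro (h | h)
    · exact g3 h
    · exact Set.disjoint_left.1 hd (Set.mem_insert _ _) h
  · rintro w (hw | hw) ha
    · exact Or.inl (g5 w hw ha)
    · rcases hc x (Set.mem_insert _ _) w hw ha with h | h
      · exact Or.inr h.2
      · exact absurd (h.1 ▸ hyS) g3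

/-- Two induced paths joined at both ends by edges form a hole. -/
theorem EvenHoleFree.closeup (hG : EvenHoleFree G) (h : IPath G x y n S)
    (h' : IPath G x' y' m T) (hx : G.Adj x x') (hy : G.Adj y y') (hd : Disjoint S T)
    (hnm : 0 < n + m)
    (hc : ∀ u ∈ S, ∀ w ∈ T, G.Adj u w → (u = x ∧ w = x') ∨ (u = y ∧ w = y')) :
    Odd (n + m) := by
  cases n with
  | succ n => exact hG.closeup_aux h h' hx hy hd hc
  | zero =>
    cases m with
    | zero => omega
    | succ m =>
      rw [add_comm]
      exact hG.closeup_aux h' h hx.symm hy.symm hd.symm fun u hu w hw ha =>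
        (hc w hw u hu ha.symm).imp And.symm And.symm

/-- Two induced paths sharing one end and joined by an edge at the other end form a cycle. -/
theorem EvenHoleFree.even_of_common_end (hG : EvenHoleFree G) (h : IPath G x b n S)
    (h' : IPath G x' b m T) (hx : G.Adj x x') (hn : 1 ≤ n) (hm : 1 ≤ m)
    (hd : ∀ u ∈ S, u ∈ T → u = b)
    (hc : ∀ u ∈ S, ∀ w ∈ T, u ≠ b → w ≠ b → G.Adj u w → u = x ∧ w = x') :
    Even (n + m) := by
  obtain ⟨n, rfl⟩ := Nat.exists_eq_add_of_le' hn
  obtain ⟨m, rfl⟩ := Nat.exists_eq_add_of_le' hm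
  obtain ⟨s, S', g1, g2, g3, rfl, g5⟩ := h.symm.uncons
  obtain ⟨t, T', k1, k2, k3, rfl, k5⟩ := h'.symm.uncons
  by_cases hnm : n + m = 0
  · exact ⟨1, by omega⟩
  have hj := g2.join k2.symm hx (Set.disjoint_left.2 fun u hu hw =>
      g3 (hd u (Or.inr hu) (Or.inr hw) ▸ hu)) (fun u hu w hw ha =>
      hc u (Or.inr hu) w (Or.inr hw) (fun e => g3 (e ▸ hu)) (fun e => k3 (e ▸ hw)) ha)
  have := hG.odd_of_vertex hj (v := b) (by simp [g3, k3]) g1 k1 (by omega) (by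
    rintro w (hw | hw) ha
    · exact Or.inl (g5 w hw ha)
    · exact Or.inr (k5 w hw ha))
  grind

/-- Two internally disjoint, anticomplete induced paths between nonadjacent vertices. -/
theorem EvenHoleFree.odd_of_common_ends (hG : EvenHoleFree G) (h : IPath G x y n S)
    (h' : IPath G x y m T) (hxy : x ≠ y) (hna : ¬ G.Adj x y)
    (hd : ∀ u ∈ S, u ∈ T → u = x ∨ u = y)
    (hc : ∀ u ∈ S, ∀ w ∈ T, u ≠ x → u ≠ y → w ≠ x → w ≠ y → ¬ G.Adj u w) :
    Odd (n + m) := by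
  have hlen : ∀ {n S}, IPath G x y n S → ∃ n', n = n' + 2 := by
    intro n S h
    match n, h with
    | 0, h => exact absurd h.eq_singleton.2 hxy
    | 1, h =>
      obtain ⟨x₁, S', g1, g2, -⟩ := h.uncons
      exact absurd (g2.eq_singleton.2 ▸ g1) hna
    | n + 2, _ => exact ⟨n, rfl⟩
  obtain ⟨n, rfl⟩ := hlen h
  obtain ⟨m, rfl⟩ := hlen h'
  obtain ⟨s, S', g1, g2, g3, rfl, g5⟩ := h.uncons
  obtain ⟨t, T', k1, k2, k3, rfl, k5⟩ := h'.uncons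
  obtain ⟨r, T'', q1, q2, q3, rfl, q5⟩ := k2.symm.uncons
  have hyS := g2.right_mem
  have hj := g2.join q2 q1 (Set.disjoint_left.2 fun u hu hw => by
      rcases hd u (Or.inr hu) (Or.inr (Or.inr hw)) with rfl | rfl
      · exact g3 hu
      · exact q3 hw) (fun u hu w hw ha => by
      by_cases huy : u = y
      · subst huy
        exact ⟨rfl, q5 w hw ha⟩
      · exact absurd ha (hc u (Or.inr hu) w (Or.inr (Or.inr hw)) (fun e => g3 (e ▸ hu)) huy
          (fun e => k3 (e ▸ Or.inr hw)) (fun e => q3 (e ▸ hw))))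
  have := hG.odd_of_vertex hj (v := x) (by
    rintro (h | h)
    · exact g3 h
    · exact k3 (Or.inr h)) g1 k1 (by omega) (by
    rintro w (hw | hw) ha
    · exact Or.inl (g5 w hw ha)
    · exact Or.inr (k5 w (Or.inr hw) ha))
  grind

/-- Induced paths between nonadjacent vertices through anticomplete regions. -/
theorem EvenHoleFree.odd_of_far (hG : EvenHoleFree G) (h : IPath G x y n S)
    (h' : IPath G x y m T) (hxy : x ≠ y) (hna : ¬ G.Adj x y)
    (hS : S ⊆ {x, y} ∪ X) (hT : T ⊆ {x, y} ∪ Y) (hXY : Far G X Y) : Odd (n + m) := by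
  refine hG.odd_of_common_ends h h' hxy hna ?_ ?_
  · intro u hu hw
    have := hS hu; have := hT hw; have := hXY u
    grind
  · intro u hu w hw
    have := hS hu; have := hT hw; have := hXY u
    grind

end Holes

section Merge

variable {V : Type*} {G : SimpleGraph V}

/-- The vertex set of the `i`th strip. -/
def strV {k : ℕ} (A B C : Fin k → Set V) (i : Fin k) : Set V := A i ∪ B i ∪ C i

/-- Pointwise form of the adjacency axioms of a pyramid strip system. -/
structure Strips (G : SimpleGraph V) (a : V) {k : ℕ} (A B C : Fin k → Set V) : Prop where
  three : 3 ≤ k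
  ab : ∀ i x, x ∈ A i → x ∉ B i
  ac : ∀ i x, x ∈ A i → x ∉ C i
  bc : ∀ i x, x ∈ B i → x ∉ C i
  index : ∀ i j x, x ∈ strV A B C i → x ∈ strV A B C j → i = j
  cross : ∀ i j x y, i ≠ j → x ∈ strV A B C i → y ∈ strV A B C j →
    (G.Adj x y ↔ x ∈ B i ∧ y ∈ B j)
  apex : ∀ i x, x ∈ strV A B C i → x ≠ a
  adj_apex : ∀ i x, x ∈ strV A B C i → (G.Adj a x ↔ x ∈ A i)

namespace Strips

variable {a : V} {k : ℕ} {A B C : Fin k → Set V}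

theorem memA (_ : Strips G a A B C) : ∀ i x, x ∈ A i → x ∈ strV A B C i :=
  fun _ _ h => Or.inl (Or.inl h)

theorem memB (_ : Strips G a A B C) : ∀ i x, x ∈ B i → x ∈ strV A B C i :=
  fun _ _ h => Or.inl (Or.inr h)

theorem memC (_ : Strips G a A B C) : ∀ i x, x ∈ C i → x ∈ strV A B C i :=
  fun _ _ h => Or.inr h

end Strips

theorem IsPyramidStripSystem.strips {a : V} {k : ℕ} {A B C : Fin k → Set V}
    (h : IsPyramidStripSystem G a A B C) : Strips G a A B C where
  three := h.1
  ab i x hx hb := Set.disjoint_left.1 (h.2.2.1 i) hx hb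
  ac i x hx hb := Set.disjoint_left.1 (h.2.1 i).2.2.1 hx hb
  bc i x hx hb := Set.disjoint_left.1 (h.2.1 i).2.2.2.1 hx hb
  index i j x hx hy := by
    by_contra hij
    exact Set.disjoint_left.1 (h.2.2.2.1 i j hij) hx hy
  cross i j x y hij hx hy := h.2.2.2.2.1 i j hij x hx y hy
  apex i x hx e := h.2.2.2.2.2.1 i (e ▸ hx)
  adj_apex i x hx := h.2.2.2.2.2.2 i x hx

/-- The family in which all sets indexed by `J` are replaced by their union with `P`. -/
def mergeFam {k : ℕ} (J : Set (Fin k)) (P : Set V) (F : Fin k → Set V) :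
    Option {j // j ∉ J} → Set V
  | none => {x | x ∈ P ∨ ∃ j ∈ J, x ∈ F j}
  | some j => F j

theorem IsRung.mono {A B C A' B' C' : Set V} {x y : V} {P : G.Walk x y} (h : IsRung G A B C P)
    (hA : A ⊆ A') (hB : B ⊆ B') (hC : C ⊆ C') (hAB : Disjoint A' B') : IsRung G A' B' C' P :=
  ⟨h.1, hA h.2.1, hB h.2.2.1, fun v h1 h2 h3 => hC (h.2.2.2.1 v h1 h2 h3),
    fun _ => ⟨Set.disjoint_left.1 hAB (hA h.2.1), Set.disjoint_right.1 hAB (hB h.2.2.1)⟩,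
    h.2.2.2.2.2⟩

/-- A maximal indecomposable pyramid strip system does not extend by merging some of its strips
with new vertices. -/
theorem merge_false (a : V) {k : ℕ} {A B C : Fin k → Set V}
    (hsys : IsPyramidStripSystem G a A B C)
    (hidc : ∀ i, ConnectedSubset G (A i ∪ C i))
    (hmax : ∀ (k' : ℕ) (A' B' C' : Fin k' → Set V),
      IsPyramidStripSystem G a A' B' C' →
      (∀ i, ConnectedSubset G (A' i ∪ C' i)) →
      PSSVerts a A B C ⊆ PSSVerts a A' B' C' →
      PSSVerts a A' B' C' = PSSVerts a A B C)
    (J : Set (Fin k)) {l₁ l₂ : Fin k} (hl : l₁ ≠ l₂) (hl₁ : l₁ ∉ J) (hl₂ : l₂ ∉ J)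
    (P Q R : Set V) (hne : (P ∪ Q ∪ R).Nonempty)
    (hout : ∀ x ∈ P ∪ Q ∪ R, x ∉ PSSVerts a A B C)
    (hPQ : Disjoint P Q) (hPR : Disjoint P R) (hQR : Disjoint Q R)
    (hP : ∀ x ∈ P, G.Adj a x) (hQ : ∀ x ∈ Q ∪ R, ¬ G.Adj a x)
    (hadj : ∀ x ∈ P ∪ Q ∪ R, ∀ j ∉ J, ∀ p ∈ A j ∪ B j ∪ C j, G.Adj x p ↔ x ∈ Q ∧ p ∈ B j)
    (hrung : ∀ x ∈ P ∪ Q ∪ R, ∃ α β n S, α ∈ mergeFam J P A none ∧ β ∈ mergeFam J Q B none ∧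
      IPath G α β n S ∧ x ∈ S ∧ S ⊆ insert α (insert β (mergeFam J R C none)))
    (hconn : ∀ x ∈ mergeFam J P A none ∪ mergeFam J R C none,
      ∀ y ∈ mergeFam J P A none ∪ mergeFam J R C none,
        Rch G (mergeFam J P A none ∪ mergeFam J R C none) x y) : False := by
  classical
  have hs := hsys.strips
  have hM : ∀ j x, x ∈ A j ∪ B j ∪ C j → x ∈ PSSVerts a A B C := fun j x hx =>
    Set.mem_insert_of_mem _ (Set.mem_iUnion.2 ⟨j, hx⟩)
  have hout' : ∀ x j, x ∈ P ∪ Q ∪ R → x ∉ A j ∪ B j ∪ C j := fun x j hx h => hout x hx (hM j x h)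
  have hab : Disjoint (mergeFam J P A none) (mergeFam J Q B none) := by
    rw [Set.disjoint_left] at hPQ hPR hQR ⊢
    have := hs.ab; have := hs.index; have := hs.memA; have := hs.memB; have := hs.memC
    rintro x (hx | ⟨j, hj, hx⟩) (hx' | ⟨j', hj', hx'⟩) <;> grind
  have hac : Disjoint (mergeFam J P A none) (mergeFam J R C none) := by
    rw [Set.disjoint_left] at hPQ hPR hQR ⊢
    have := hs.ac; have := hs.index; have := hs.memA; have := hs.memB; have := hs.memC
    rintro x (hx | ⟨j, hj, hx⟩) (hx' | ⟨j', hj', hx'⟩) <;> grind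
  have hbc : Disjoint (mergeFam J Q B none) (mergeFam J R C none) := by
    rw [Set.disjoint_left] at hPQ hPR hQR ⊢
    have := hs.bc; have := hs.index; have := hs.memA; have := hs.memB; have := hs.memC
    rintro x (hx | ⟨j, hj, hx⟩) (hx' | ⟨j', hj', hx'⟩) <;> grind
  have hmem : ∀ x, x ∈ mergeFam J P A none ∪ mergeFam J Q B none ∪ mergeFam J R C none ↔
      x ∈ P ∪ Q ∪ R ∨ ∃ j ∈ J, x ∈ A j ∪ B j ∪ C j := by
    intro x
    simp only [mergeFam, Set.mem_union, Set.mem_ofPred_eq]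
    grind
  have hcr : ∀ j ∉ J, ∀ x ∈ mergeFam J P A none ∪ mergeFam J Q B none ∪ mergeFam J R C none,
      ∀ p ∈ A j ∪ B j ∪ C j, G.Adj x p ↔ x ∈ mergeFam J Q B none ∧ p ∈ B j := by
    intro j hj x hx p hp
    rcases (hmem x).1 hx with hx | ⟨i, hi, hx⟩
    · rw [hadj x hx j hj p hp]
      simp only [mergeFam, Set.mem_ofPred_eq]
      grind
    · have hij : i ≠ j := fun e => hj (e ▸ hi)
      rw [hs.cross i j x p hij hx hp]
      simp only [mergeFam, Set.mem_ofPred_eq]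
      have := hs.index; have := hs.memA; have := hs.memB; have := hs.memC
      grind
  let F : Option {j // j ∉ J} → Set V := mergeFam J P A
  let F' : Option {j // j ∉ J} → Set V := mergeFam J Q B
  let F'' : Option {j // j ∉ J} → Set V := mergeFam J R C
  let e := Fintype.equivFin (Option {j // j ∉ J})
  have hcover : ∀ x, x ∈ P ∪ Q ∪ R ∨ (∃ j, x ∈ A j ∪ B j ∪ C j) ↔ ∃ o, x ∈ F o ∪ F' o ∪ F'' o := by
    intro x
    constructor
    · rintro (hx | ⟨j, hx⟩)
      · exact ⟨none, (hmem x).2 (Or.inl hx)⟩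
      · by_cases hj : j ∈ J
        · exact ⟨none, (hmem x).2 (Or.inr ⟨j, hj, hx⟩)⟩
        · exact ⟨some ⟨j, hj⟩, hx⟩
    · rintro ⟨_ | j, hx⟩
      · rcases (hmem x).1 hx with hx | ⟨j, -, hx⟩
        · exact Or.inl hx
        · exact Or.inr ⟨j, hx⟩
      · exact Or.inr ⟨j, hx⟩
  have hsys' : IsPyramidStripSystem G a (fun i => F (e.symm i)) (fun i => F' (e.symm i))
      (fun i => F'' (e.symm i)) := by
    refine ⟨?_, fun i => ?_, fun i => ?_, fun i j hij => ?_, fun i j hij => ?_, fun i => ?_,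
      fun i => ?_⟩
    · have : 2 ≤ Fintype.card {j // j ∉ J} := by
        have : Nontrivial {j // j ∉ J} := ⟨⟨l₁, hl₁⟩, ⟨l₂, hl₂⟩, by simpa using hl⟩
        exact Fintype.one_lt_card
      rw [Fintype.card_option]; omega
    · show IsStrip G (F (e.symm i)) (F' (e.symm i)) (F'' (e.symm i))
      rcases e.symm i with _ | j
      · obtain ⟨x, hx⟩ := hne
        obtain ⟨α, β, n, S, h1, h2, -⟩ := hrung x hx
        refine ⟨⟨α, h1⟩, ⟨β, h2⟩, hac, hbc, fun v hv => ?_⟩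
        rcases (hmem v).1 hv with hx | ⟨j, hj, hx⟩
        · obtain ⟨α, β, n, S, h1, h2, h3, h4, h5⟩ := hrung v hx
          obtain ⟨p, q1, q2, q3, q4⟩ := h3.walk
          refine ⟨α, β, p, ⟨q1, h1, h2, fun w hw h6 h7 => ?_, fun _ =>
            ⟨Set.disjoint_left.1 hab h1, Set.disjoint_right.1 hab h2⟩, q4⟩, (q3 v).2 h4⟩
          rcases h5 ((q3 w).1 hw) with h8 | h8 | h8
          · exact absurd h8 h6
          · exact absurd h8 h7
          · exact h8
        · obtain ⟨x, y, p, hp, hvp⟩ := (hsys.2.1 j).2.2.2.2 v hx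
          exact ⟨x, y, p, hp.mono (fun z hz => Or.inr ⟨j, hj, hz⟩)
            (fun z hz => Or.inr ⟨j, hj, hz⟩) (fun z hz => Or.inr ⟨j, hj, hz⟩) hab, hvp⟩
      · exact hsys.2.1 j
    · show Disjoint (F (e.symm i)) (F' (e.symm i))
      rcases e.symm i with _ | j
      · exact hab
      · exact hsys.2.2.1 j
    · have hij' : e.symm i ≠ e.symm j := fun h => hij (e.symm.injective h)
      show Disjoint (F (e.symm i) ∪ F' (e.symm i) ∪ F'' (e.symm i))
        (F (e.symm j) ∪ F' (e.symm j) ∪ F'' (e.symm j))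
      have key : ∀ o : {j // j ∉ J}, Disjoint (F none ∪ F' none ∪ F'' none)
          (F (some o) ∪ F' (some o) ∪ F'' (some o)) := by
        intro o
        rw [Set.disjoint_left]
        intro x hx hx'
        rcases (hmem x).1 hx with h | ⟨j, hj, h⟩
        · exact hout' x o h hx'
        · exact o.2 (hs.index j o x h hx' ▸ hj)
      revert hij'
      rcases e.symm i with _ | i <;> rcases e.symm j with _ | j <;> intro hij'
      · exact absurd rfl hij'
      · exact key j
      · exact (key i).symm
      · exact hsys.2.2.2.1 i j fun h => hij' (by rw [Subtype.ext h])
    · have hij' : e.symm i ≠ e.symm j := fun h => hij (e.symm.injective h)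
      show ∀ p ∈ F (e.symm i) ∪ F' (e.symm i) ∪ F'' (e.symm i),
        ∀ q ∈ F (e.symm j) ∪ F' (e.symm j) ∪ F'' (e.symm j),
          (G.Adj p q ↔ p ∈ F' (e.symm i) ∧ q ∈ F' (e.symm j))
      revert hij'
      rcases e.symm i with _ | i <;> rcases e.symm j with _ | j <;> intro hij'
      · exact absurd rfl hij'
      · exact hcr j j.2
      · intro p hp q hq
        rw [G.adj_comm, hcr i i.2 q hq p hp, and_comm]
        rfl
      · exact hsys.2.2.2.2.1 i j fun h => hij' (by rw [Subtype.ext h])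
    · intro ha
      rcases (hcover a).2 ⟨_, ha⟩ with h | ⟨j, h⟩
      · exact hout a h (Set.mem_insert _ _)
      · exact hs.apex j a h rfl
    · show ∀ p ∈ F (e.symm i) ∪ F' (e.symm i) ∪ F'' (e.symm i), (G.Adj a p ↔ p ∈ F (e.symm i))
      rcases e.symm i with _ | j
      · intro p hp
        rcases (hmem p).1 hp with h | ⟨j, hj, h⟩
        · have h1 := hP p
          have h2 := hQ p
          have h3 := hout' p
          simp only [F, mergeFam, Set.mem_ofPred_eq]
          grind
        · rw [hs.adj_apex j p h]
          have h3 := hout' p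
          have := hs.index; have := hs.memA; have := hs.memB; have := hs.memC
          simp only [F, mergeFam, Set.mem_ofPred_eq]
          grind
      · exact hsys.2.2.2.2.2.2 j
  have hverts : ∀ x, x ∈ PSSVerts a (fun i => F (e.symm i)) (fun i => F' (e.symm i))
      (fun i => F'' (e.symm i)) ↔ x = a ∨ ∃ o, x ∈ F o ∪ F' o ∪ F'' o := by
    intro x
    simp only [PSSVerts, Set.mem_insert_iff, Set.mem_iUnion]
    refine or_congr_right ⟨fun ⟨i, h⟩ => ⟨_, h⟩, fun ⟨o, h⟩ => ⟨e o, ?_⟩⟩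
    simpa using h
  have := hmax _ _ _ _ hsys' (fun i => by
    show ConnectedSubset G (F (e.symm i) ∪ F'' (e.symm i))
    rcases e.symm i with _ | j
    · obtain ⟨x, hx⟩ := hne
      obtain ⟨α, β, n, S, h1, h2, -⟩ := hrung x hx
      exact connectedSubset_iff.2 ⟨⟨α, Or.inl h1⟩, hconn⟩
    · exact hidc j) (fun x hx => by
      rw [hverts]
      rcases hx with hx | hx
      · exact Or.inl hx
      · exact Or.inr ((hcover x).1 (Or.inr (Set.mem_iUnion.1 hx))))
  obtain ⟨x, hx⟩ := hne
  exact hout x hx (this ▸ (hverts x).2 (Or.inr ((hcover x).1 (Or.inl hx))))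

end Merge

section Rungs

variable {V : Type*} {G : SimpleGraph V} {a : V} {k : ℕ} {A B C X : Fin k → Set V}

/-- `S` is the vertex set of a rung with `n` edges of the `i`th strip. -/
structure GRung (G : SimpleGraph V) (A B C : Fin k → Set V) (i : Fin k) (α b : V) (n : ℕ)
    (S : Set V) : Prop where
  left : α ∈ A i
  right : b ∈ B i
  path : IPath G α b n S
  sub : S ⊆ insert α (insert b (C i))

namespace GRung

variable {i j : Fin k} {α b α' b' : V} {n m : ℕ} {S T : Set V}

theorem facts (hs : Strips G a A B C) (h : GRung G A B C i α b n S) :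
    α ∈ A i ∧ b ∈ B i ∧ α ∈ S ∧ b ∈ S ∧ (∀ w ∈ S, w ∈ strV A B C i) ∧
    (∀ w ∈ S, w ∈ A i → w = α) ∧ (∀ w ∈ S, w ∈ B i → w = b) ∧
    (∀ w ∈ S, w = α ∨ w = b ∨ w ∈ C i) ∧ α ≠ b ∧ 1 ≤ n := by
  have h1 := h.left
  have h2 := h.right
  have h3 := hs.ab i
  have h4 := hs.ac i
  have h5 := hs.bc i
  have h6 : ∀ w ∈ S, w = α ∨ w = b ∨ w ∈ C i := fun w hw => h.sub hw
  have h7 := hs.memA i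
  have h8 := hs.memB i
  have h9 := hs.memC i
  have hne : α ≠ b := fun e => h3 α h1 (e ▸ h2)
  refine ⟨h1, h2, h.path.left_mem, h.path.right_mem, ?_, ?_, ?_, h6, hne, ?_⟩
  · grind
  · grind
  · grind
  · rcases Nat.eq_zero_or_pos n with h0 | h0
    · exact absurd (h.path.zero_iff.1 h0) hne
    · exact h0

theorem mono (h : GRung G A B C i α b n S) (hX : C i ⊆ X i) : GRung G A B X i α b n S :=
  ⟨h.left, h.right, h.path,
    h.sub.trans (Set.insert_subset_insert (Set.insert_subset_insert hX))⟩

end GRung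

variable {i j : Fin k} {α b α' b' : V} {n m : ℕ} {S T : Set V}

theorem Strips.disj (hs : Strips G a A B C) (hij : i ≠ j) (hS : ∀ w ∈ S, w ∈ strV A B C i)
    (hT : ∀ w ∈ T, w ∈ strV A B C j) : ∀ w ∈ S, w ∉ T :=
  fun w h h' => hij (hs.index i j w (hS w h) (hT w h'))

theorem Strips.edge (hs : Strips G a A B C) (hij : i ≠ j) (hS : ∀ w ∈ S, w ∈ strV A B C i)
    (hT : ∀ w ∈ T, w ∈ strV A B C j) : ∀ u ∈ S, ∀ w ∈ T, G.Adj u w → u ∈ B i ∧ w ∈ B j :=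
  fun u h w h' => (hs.cross i j u w hij (hS u h) (hT w h')).1

theorem Strips.adjB (hs : Strips G a A B C) (hij : i ≠ j) {b b' : V} (h : b ∈ B i) (h' : b' ∈ B j) :
    G.Adj b b' :=
  (hs.cross i j b b' hij (hs.memB i b h) (hs.memB j b' h')).2 ⟨h, h'⟩

theorem Strips.adjA (hs : Strips G a A B C) {α : V} (h : α ∈ A i) : G.Adj a α :=
  (hs.adj_apex i α (hs.memA i α h)).2 h

theorem Strips.apex_edge (hs : Strips G a A B C) (hS : ∀ w ∈ S, w ∈ strV A B C i) :
    ∀ w ∈ S, G.Adj a w → w ∈ A i :=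
  fun w h => (hs.adj_apex i w (hS w h)).1

theorem Strips.apex_notMem (hs : Strips G a A B C) (hS : ∀ w ∈ S, w ∈ strV A B C i) : a ∉ S :=
  fun h => hs.apex i a (hS a h) rfl

theorem GRung.adj (hs : Strips G a A B C) (h : GRung G A B C i α b n S)
    (h' : GRung G A B C j α' b' m T) (hij : i ≠ j) :
    ∀ u ∈ S, ∀ w ∈ T, G.Adj u w → u = b ∧ w = b' := by
  have f := h.facts hs
  have f' := h'.facts hs
  have := hs.edge hij f.2.2.2.2.1 f'.2.2.2.2.1
  grind

theorem Strips.even_rungs (hs : Strips G a A B C) (hG : EvenHoleFree G) (hij : i ≠ j)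
    (h : GRung G A B C i α b n S) (h' : GRung G A B C j α' b' m T) : Even (n + m) := by
  have f := h.facts hs
  have f' := h'.facts hs
  have hc := hs.cross i j
  have hx := hs.index i j
  have ha := hs.adj_apex
  have hap := hs.apex
  have hj := h.path.join h'.path.symm ((hc _ _ hij (by grind) (by grind)).2 ⟨f.2.1, f'.2.1⟩)
    (Set.disjoint_left.2 (by grind)) (by grind)
  have := hG.odd_of_vertex hj (v := a) (by grind) ((ha i α (by grind)).2 f.1)
    ((ha j α' (by grind)).2 f'.1) (by omega) (by grind)
  grind

/-- An induced path starting at a neighbour of the apex, going through a strip and then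
leaving it, joined to another one. -/
theorem Strips.odd_link (hs : Strips G a A B C) (hG : EvenHoleFree G) (hij : i ≠ j)
    {z z' x y : V} {d e : ℕ} {U U' : Set V}
    (h : IPath G α z d U) (hα : α ∈ A i) (hU : ∀ w ∈ U, w ∈ strV A B C i)
    (hUA : ∀ w ∈ U, w ∈ A i → w = α) (hUB : ∀ w ∈ U, w ∉ B i)
    (h' : IPath G α' z' e U') (hα' : α' ∈ A j) (hU' : ∀ w ∈ U', w ∈ strV A B C j)
    (hUA' : ∀ w ∈ U', w ∈ A j → w = α')
    (hS : IPath G x y n S) (hSa : ∀ s ∈ S, s ≠ a ∧ ¬ G.Adj a s) (hSU : ∀ s ∈ S, s ∉ U)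
    (hSU' : ∀ s ∈ S, s ∉ U') (hxz : G.Adj x z) (hyz : G.Adj y z')
    (hc : ∀ s ∈ S, ∀ w ∈ U, G.Adj s w → s = x ∧ w = z)
    (hc' : ∀ s ∈ S, ∀ w ∈ U', G.Adj s w → s = y ∧ w = z') : Odd (d + n + e) := by
  have hcr := hs.cross i j
  have hx := hs.index i j
  have ha := hs.adj_apex
  have hap := hs.apex
  have hA := hs.memA
  have h1 := h.join hS hxz.symm (Set.disjoint_left.2 (by grind)) (fun u hu w hw had => by
    have := hc w hw u hu had.symm; grind)
  have m1 := h.left_mem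
  have m2 := h'.left_mem
  have h2 := h1.join h'.symm hyz (Set.disjoint_left.2 (by grind)) (by grind)
  have := hG.odd_of_vertex h2 (v := a) (by grind) ((ha i α (by grind)).2 hα)
    ((ha j α' (by grind)).2 hα') (by omega) (by grind)
  grind

end Rungs

section MaxSys

variable {V : Type*} {G : SimpleGraph V} {a : V} {k : ℕ} {A B C : Fin k → Set V}

/-- A maximal indecomposable pyramid strip system in an even-hole-free graph, with a splendid apex
that is not an end of the cross-edge of an extended near-prism. -/
structure MaxSys (G : SimpleGraph V) (a : V) {k : ℕ} (A B C : Fin k → Set V) : Prop where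
  ehf : EvenHoleFree G
  splendid : Splendid G a
  not_cross : ¬ ExtNearPrismCrossEnd G a
  sys : IsPyramidStripSystem G a A B C
  indec : ∀ i, ConnectedSubset G (A i ∪ C i)
  max : ∀ (k' : ℕ) (A' B' C' : Fin k' → Set V),
      IsPyramidStripSystem G a A' B' C' →
      (∀ i, ConnectedSubset G (A' i ∪ C' i)) →
      PSSVerts a A B C ⊆ PSSVerts a A' B' C' →
      PSSVerts a A' B' C' = PSSVerts a A B C

namespace MaxSys

variable {i j l : Fin k} {x y : V} {n m : ℕ} {S T : Set V}

theorem strips (h : MaxSys G a A B C) : Strips G a A B C := h.sys.strips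

theorem rung_through (h : MaxSys G a A B C) (hx : x ∈ strV A B C i) :
    ∃ α b n S, GRung G A B C i α b n S ∧ x ∈ S := by
  obtain ⟨α, b, P, hP, hxP⟩ := (h.sys.2.1 i).2.2.2.2 x hx
  refine ⟨α, b, _, _, ⟨hP.2.1, hP.2.2.1, ipath_of_walk P hP.1 hP.2.2.2.2.2, fun v hv => ?_⟩, hxP⟩
  have := hP.2.2.2.1 v hv
  simp only [Set.mem_insert_iff]
  tauto

theorem rung_of_A (h : MaxSys G a A B C) {α : V} (hα : α ∈ A i) :
    ∃ b n S, GRung G A B C i α b n S := by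
  obtain ⟨α', b, n, S, hS, hm⟩ := h.rung_through (h.strips.memA i _ hα)
  obtain rfl := (hS.facts h.strips).2.2.2.2.2.1 α hm hα
  exact ⟨b, n, S, hS⟩

theorem rung_of_B (h : MaxSys G a A B C) {b : V} (hb : b ∈ B i) :
    ∃ α n S, GRung G A B C i α b n S := by
  obtain ⟨α, b', n, S, hS, hm⟩ := h.rung_through (h.strips.memB i _ hb)
  obtain rfl := (hS.facts h.strips).2.2.2.2.2.2.1 b hm hb
  exact ⟨α, n, S, hS⟩

theorem exists_B (h : MaxSys G a A B C) (i : Fin k) : ∃ b, b ∈ B i := (h.sys.2.1 i).2.1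

theorem exists_A (h : MaxSys G a A B C) (i : Fin k) : ∃ x, x ∈ A i := (h.sys.2.1 i).1

theorem conn (h : MaxSys G a A B C) (i : Fin k) :
    ∀ x ∈ A i ∪ C i, ∀ y ∈ A i ∪ C i, Rch G (A i ∪ C i) x y :=
  (connectedSubset_iff.1 (h.indec i)).2

theorem exists_third (h : MaxSys G a A B C) (i j : Fin k) : ∃ l, l ≠ i ∧ l ≠ j := by
  have := h.sys.1
  by_contra hc
  push Not at hc
  have h0 := hc ⟨0, by omega⟩
  have h1 := hc ⟨1, by omega⟩
  have h2 := hc ⟨2, by omega⟩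
  grind

theorem rch_all {Z : Set V} {c : V} (h : ∀ x ∈ Z, Rch G Z x c) :
    ∀ x ∈ Z, ∀ y ∈ Z, Rch G Z x y :=
  fun x hx y hy => (h x hx).trans ((h y hy).symm hy)

end MaxSys
end MaxSys

section Separation

variable {V : Type*} {G : SimpleGraph V} {a : V} {k : ℕ} {A B C : Fin k → Set V}

/-- The vertices outside of a strip system that are not adjacent to its apex. -/
def Out (G : SimpleGraph V) (a : V) {k : ℕ} (A B C : Fin k → Set V) : Set V :=
  {x | x ∉ PSSVerts a A B C ∧ ¬ G.Adj a x}

theorem Out.facts {x : V} (h : x ∈ Out G a A B C) :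
    x ≠ a ∧ ¬ G.Adj a x ∧ ∀ i, x ∉ strV A B C i :=
  ⟨fun e => h.1 (e ▸ Set.mem_insert _ _), h.2,
    fun i hi => h.1 (Set.mem_insert_of_mem _ (Set.mem_iUnion.2 ⟨i, hi⟩))⟩

namespace MaxSys

variable {i j l : Fin k} {x y : V} {n m : ℕ} {S T : Set V}

theorem ext_prism_false (h : MaxSys G a A B C) {z z' αi αj αl bi bj bl : V}
    {d e ri rl : ℕ} {U U' Ri Rl : Set V} (hij : i ≠ j) (hil : l ≠ i) (hjl : l ≠ j)
    (hRi : GRung G A B C i αi bi ri Ri) (hRl : GRung G A B C l αl bl rl Rl)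
    (hU : IPath G αj z d U) (hU' : IPath G z' bj e U') (hαj : αj ∈ A j) (hbj : bj ∈ B j)
    (hUs : ∀ w ∈ U, w ∈ A j ∪ C j) (hUs' : ∀ w ∈ U', w ∈ B j ∪ C j)
    (hUA : ∀ w ∈ U, w ∈ A j → w = αj) (hUB : ∀ w ∈ U', w ∈ B j → w = bj)
    (hd : Disjoint U U') (hcr : ∀ u ∈ U, ∀ w ∈ U', G.Adj u w → u = z ∧ w = z')
    (hzz : G.Adj z z')
    (hS : IPath G x y n S) (hO : S ⊆ Out G a A B C)
    (hxi : G.Adj x αi) (hcx : ∀ s ∈ S, ∀ w ∈ Ri, G.Adj s w → s = x ∧ w = αi)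
    (hy : G.Adj y z) (hy' : G.Adj y z')
    (hcy : ∀ s ∈ S, ∀ w ∈ U, G.Adj s w → s = y ∧ w = z)
    (hcy' : ∀ s ∈ S, ∀ w ∈ U', G.Adj s w → s = y ∧ w = z')
    (hcl : ∀ s ∈ S, ∀ w ∈ Rl, ¬ G.Adj s w) : False := by
  have hs := h.strips
  have fi := hRi.facts hs
  have fl := hRl.facts hs
  have mU := hU.left_mem
  have mU2 := hU.right_mem
  have mU' := hU'.left_mem
  have mU'2 := hU'.right_mem
  have mS := hS.left_mem
  have mS2 := hS.right_mem
  have e1 : ∀ w ∈ U, w ∈ strV A B C j := fun w hw =>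
    (hUs w hw).elim (hs.memA j w) (hs.memC j w)
  have e2 : ∀ w ∈ U', w ∈ strV A B C j := fun w hw =>
    (hUs' w hw).elim (hs.memB j w) (hs.memC j w)
  have e3 : ∀ w ∈ U, w ∉ B j := by
    have h1 := hs.ab j; have h2 := hs.bc j
    clear * - h1 h2 hUs; grind
  have e4 : ∀ w ∈ U', w ∉ A j := by
    have h1 := hs.ab j; have h2 := hs.ac j
    clear * - h1 h2 hUs'; grind
  have e5 : ∀ w ∈ U, w ∉ U' := fun w h1 h2 => Set.disjoint_left.1 hd h1 h2
  have dUl := hs.disj hjl.symm e1 fl.2.2.2.2.1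
  have dUi := hs.disj hij.symm e1 fi.2.2.2.2.1
  have dli := hs.disj hil fl.2.2.2.2.1 fi.2.2.2.2.1
  have dU'l := hs.disj hjl.symm e2 fl.2.2.2.2.1
  have dU'i := hs.disj hij.symm e2 fi.2.2.2.2.1
  have cUl := hs.edge hjl.symm e1 fl.2.2.2.2.1
  have cUi := hs.edge hij.symm e1 fi.2.2.2.2.1
  have cli := hRl.adj hs hRi hil
  have clU' := hs.edge hjl fl.2.2.2.2.1 e2
  have ciU' := hs.edge hij fi.2.2.2.2.1 e2
  have naU := hs.apex_notMem e1
  have naU' := hs.apex_notMem e2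
  have nai := hs.apex_notMem fi.2.2.2.2.1
  have nal := hs.apex_notMem fl.2.2.2.2.1
  have aaU := hs.apex_edge e1
  have aaU' := hs.apex_edge e2
  have aai := hs.apex_edge fi.2.2.2.2.1
  have aal := hs.apex_edge fl.2.2.2.2.1
  have dSU : ∀ s ∈ S, s ∉ U := fun s hs h => (Out.facts (hO hs)).2.2 j (e1 s h)
  have dSU' : ∀ s ∈ S, s ∉ U' := fun s hs h => (Out.facts (hO hs)).2.2 j (e2 s h)
  have dSi : ∀ s ∈ S, s ∉ Ri := fun s hs h => (Out.facts (hO hs)).2.2 i (fi.2.2.2.2.1 s h)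
  have dSl : ∀ s ∈ S, s ∉ Rl := fun s hs h => (Out.facts (hO hs)).2.2 l (fl.2.2.2.2.1 s h)
  have haS : ∀ s ∈ S, s ≠ a ∧ ¬ G.Adj a s := fun s hs =>
    ⟨(Out.facts (hO hs)).1, (Out.facts (hO hs)).2.1⟩
  have b1 : G.Adj bl bi := hs.adjB hil fl.2.1 fi.2.1
  have b2 : G.Adj bl bj := hs.adjB hjl fl.2.1 hbj
  have b3 : G.Adj bi bj := hs.adjB hij fi.2.1 hbj
  have aα := hs.adjA fi.1
  have aαl := hs.adjA fl.1
  have aαj := hs.adjA hαj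
  have p1 := hU.symm.snoc (z := a) aαj.symm naU (by grind)
  have uA := fl.2.2.2.2.2.1
  have p2 := p1.join hRl.path aαl (Set.disjoint_left.2 (by
      rintro u (rfl | hu)
      exacts [nal, dUl u hu])) (by
      rintro u (rfl | hu) w hw had
      · exact ⟨rfl, uA w hw (aal w hw had)⟩
      · exact absurd (cUl u hu w hw had).1 (e3 u hu))
  have p3 := hS.symm.join hRi.path hxi (Set.disjoint_left.2 dSi) hcx
  obtain ⟨P1, q1, -, q2, q3⟩ := p2.walk
  obtain ⟨P2, q4, -, q5, q6⟩ := p3.walk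
  obtain ⟨P3, q7, -, q8, q9⟩ := hU'.walk
  have s1 : ∀ w, w ∈ P1.support ↔ w = a ∨ w ∈ U ∨ w ∈ Rl := fun w => by
    rw [q2]; simp [or_assoc]
  have s2 : ∀ w, w ∈ P2.support ↔ w ∈ S ∨ w ∈ Ri := fun w => by
    rw [q5]; simp
  have t1 : ∀ w ∈ P1.support, w ∉ P2.support := fun w h1 h2 => by
    rw [s1] at h1; rw [s2] at h2
    clear * - h1 h2 haS nai dSU dUi dSl dli
    grind
  have t2 : ∀ w ∈ P1.support, w ∉ P3.support := fun w h1 h2 => by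
    rw [s1] at h1; rw [q8] at h2
    clear * - h1 h2 naU' e5 dU'l
    grind
  have t3 : ∀ w ∈ P2.support, w ∉ P3.support := fun w h1 h2 => by
    rw [s2] at h1; rw [q8] at h2
    clear * - h1 h2 dSU' dU'i
    grind
  have c12 : ∀ p ∈ P1.support, ∀ q ∈ P2.support, G.Adj p q →
      (p = z ∧ q = y) ∨ (p = bl ∧ q = bi) ∨ (p = a ∧ q = αi) := by
    intro p hp q hq had
    have uAi := fi.2.2.2.2.2.1
    rcases (s1 p).1 hp with rfl | hp | hp <;> rcases (s2 q).1 hq with hq | hq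
    · exact absurd had (haS q hq).2
    · exact Or.inr (Or.inr ⟨rfl, uAi q hq (aai q hq had)⟩)
    · exact Or.inl (hcy q hq p hp had.symm).symm
    · exact absurd (cUi p hp q hq had).1 (e3 p hp)
    · exact absurd had.symm (hcl q hq p hp)
    · exact Or.inr (Or.inl (cli p hp q hq had))
  have c13 : ∀ p ∈ P1.support, ∀ q ∈ P3.support, G.Adj p q →
      (p = z ∧ q = z') ∨ (p = bl ∧ q = bj) := by
    intro p hp q hq had
    rw [q8] at hq
    have uBl := fl.2.2.2.2.2.2.1
    rcases (s1 p).1 hp with rfl | hp | hp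
    · exact absurd (aaU' q hq had) (e4 q hq)
    · exact Or.inl (hcr p hp q hq had)
    · have := clU' p hp q hq had
      exact Or.inr ⟨uBl p hp this.1, hUB q hq this.2⟩
  have c23 : ∀ p ∈ P2.support, ∀ q ∈ P3.support, G.Adj p q →
      (p = y ∧ q = z') ∨ (p = bi ∧ q = bj) := by
    intro p hp q hq had
    rw [q8] at hq
    have uBi := fi.2.2.2.2.2.2.1
    rcases (s2 p).1 hp with hp | hp
    · exact Or.inl (hcy' p hp q hq had)
    · have := ciU' p hp q hq had
      exact Or.inr ⟨uBi p hp this.1, hUB q hq this.2⟩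
  refine h.not_cross ⟨z, y, z', bl, bi, bj, P1, P2, P3, αi, Or.inl ⟨hy.symm, hzz, hy', b1, b2, b3,
    ?_, q1, q4, q7, t1, t2, t3, ?_, ?_, ?_, ?_, ?_, ?_, ?_, ?_⟩⟩
  · ext w
    simp only [Set.mem_inter_iff, Set.mem_insert_iff, Set.mem_singleton_iff]
    grind
  · grind
  · grind
  · grind
  · grind
  · grind
  · grind
  · exact aα
  · intro p q hp hq had
    have e12 : ∀ u v : V, s(u, v) = s(v, u) := fun u v => Sym2.eq_swap
    rcases hp with hp | hp | hp <;> rcases hq with hq | hq | hq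
    · exact Or.inl (q3 p q hp hq had)
    · rcases c12 p hp q hq had with ⟨rfl, rfl⟩ | ⟨rfl, rfl⟩ | ⟨rfl, rfl⟩ <;> simp
    · rcases c13 p hp q hq had with ⟨rfl, rfl⟩ | ⟨rfl, rfl⟩ <;> simp
    · rw [e12 p q]
      rcases c12 q hq p hp had.symm with ⟨rfl, rfl⟩ | ⟨rfl, rfl⟩ | ⟨rfl, rfl⟩ <;> simp
    · exact Or.inr (Or.inl (q6 p q hp hq had))
    · rcases c23 p hp q hq had with ⟨rfl, rfl⟩ | ⟨rfl, rfl⟩ <;> simp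
    · rw [e12 p q]
      rcases c13 q hq p hp had.symm with ⟨rfl, rfl⟩ | ⟨rfl, rfl⟩ <;> simp
    · rw [e12 p q]
      rcases c23 q hq p hp had.symm with ⟨rfl, rfl⟩ | ⟨rfl, rfl⟩ <;> simp
    · exact Or.inr (Or.inr (Or.inl (q9 p q hp hq had)))

end MaxSys
end Separation

section Separation

variable {V : Type*} {G : SimpleGraph V} {a : V} {k : ℕ} {A B C : Fin k → Set V}

namespace MaxSys

variable {i j l : Fin k} {x y : V} {n m : ℕ} {S T : Set V}

theorem no_link_aux (h : MaxSys G a A B C) {αi αj αl bi bj bl : V} {ri rj rl : ℕ}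
    {Ri Rj Rl : Set V} (hij : i ≠ j) (hil : l ≠ i) (hjl : l ≠ j)
    (hRi : GRung G A B C i αi bi ri Ri) (hRj : GRung G A B C j αj bj rj Rj)
    (hRl : GRung G A B C l αl bl rl Rl) (hS : IPath G x y n S) (hO : S ⊆ Out G a A B C)
    (hxi : G.Adj x αi) (hcx : ∀ s ∈ S, ∀ w ∈ Ri, G.Adj s w → s = x ∧ w = αi)
    (hyj : ∃ w ∈ Rj, w ≠ bj ∧ G.Adj y w) (hcy : ∀ s ∈ S, ∀ w ∈ Rj, G.Adj s w → s = y)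
    (hcl : ∀ s ∈ S, ∀ w ∈ Rl, ¬ G.Adj s w) : False := by
  have hs := h.strips
  have fi := hRi.facts hs
  have fj := hRj.facts hs
  have fl := hRl.facts hs
  obtain ⟨p, hp, hpb, hyp⟩ := hyj
  obtain ⟨z, z', d, e, U, U', hU, hU', sU, sU', yz, yz', uz, uz', ax, bx, hcase⟩ :=
    hRj.path.extremes (G.Adj y) ⟨p, hp, hyp⟩
  have hbU : bj ∉ U := fun hb => hpb (bx hb p hp hyp)
  have dS : ∀ {i}, ∀ s ∈ S, ∀ {T : Set V}, (∀ w ∈ T, w ∈ strV A B C i) → s ∉ T :=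
    fun {i} s hs T hT hsT => (Out.facts (hO hs)).2.2 i (hT s hsT)
  have haS : ∀ s ∈ S, s ≠ a ∧ ¬ G.Adj a s := fun s hs =>
    ⟨(Out.facts (hO hs)).1, (Out.facts (hO hs)).2.1⟩
  have mU : ∀ w ∈ U, w ∈ strV A B C j := fun w hw => fj.2.2.2.2.1 w (sU hw)
  have mU' : ∀ w ∈ U', w ∈ strV A B C j := fun w hw => fj.2.2.2.2.1 w (sU' hw)
  have AU : ∀ w ∈ U, w ∈ A j → w = αj := fun w hw => fj.2.2.2.2.2.1 w (sU hw)
  have BU : ∀ w ∈ U, w ∉ B j := fun w hw hB => hbU (fj.2.2.2.2.2.2.1 w (sU hw) hB ▸ hw)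
  have cU : ∀ s ∈ S, ∀ w ∈ U, G.Adj s w → s = y ∧ w = z := fun s hs w hw had => by
    obtain rfl := hcy s hs w (sU hw) had
    exact ⟨rfl, uz w hw had⟩
  have cU' : ∀ s ∈ S, ∀ w ∈ U', G.Adj s w → s = y ∧ w = z' := fun s hs w hw had => by
    obtain rfl := hcy s hs w (sU' hw) had
    exact ⟨rfl, uz' w hw had⟩
  have o1 := hs.odd_link h.ehf hij.symm hU fj.1 mU AU BU (.single αi) fi.1
    (by rintro w rfl; exact hs.memA i _ fi.1) (by rintro w rfl _; rfl) hS.symm haS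
    (fun s hm => dS s hm mU) (fun s hm => dS s hm (by rintro w rfl; exact hs.memA i _ fi.1))
    yz hxi cU (by rintro s hm w rfl had; exact ⟨(hcx s hm w fi.2.2.1 had).1, rfl⟩)
  have p1 := hS.symm.join hRi.path hxi (Set.disjoint_left.2 fun s hm => dS s hm fi.2.2.2.2.1) hcx
  have ej := hs.edge hij fi.2.2.2.2.1 mU'
  have o2 := h.ehf.closeup p1 hU' yz' (hs.adjB hij fi.2.1 fj.2.1) (Set.disjoint_left.2 (by
      rintro s (hs1 | hs1)
      exacts [dS s hs1 mU', hs.disj hij fi.2.2.2.2.1 mU' s hs1])) (by omega) (by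
      rintro s (hs1 | hs1) w hw had
      · exact Or.inl (cU' s hs1 w hw had)
      · have := ej s hs1 w hw had
        exact Or.inr ⟨fi.2.2.2.2.2.2.1 s hs1 this.1, fj.2.2.2.2.2.2.1 w (sU' hw) this.2⟩)
  have o3 := hs.even_rungs h.ehf hij hRi hRj
  have o4 := hs.even_rungs h.ehf hil hRl hRi
  rcases hcase with ⟨rfl, hde⟩ | ⟨hzz, hde, hd, hcr⟩ | ⟨hd, hcr⟩
  · grind
  · refine h.ext_prism_false hij hil hjl hRi hRl hU hU' fj.1 fj.2.1 (fun w hw => ?_)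
      (fun w hw => ?_) AU (fun w hw => fj.2.2.2.2.2.2.1 w (sU' hw)) hd hcr hzz hS hO hxi hcx yz yz'
      cU cU' hcl
    · rcases fj.2.2.2.2.2.2.2.1 w (sU hw) with rfl | rfl | hC
      exacts [Or.inl fj.1, absurd hw hbU, Or.inr hC]
    · rcases fj.2.2.2.2.2.2.2.1 w (sU' hw) with rfl | rfl | hC
      exacts [absurd hw (Set.disjoint_left.1 hd hU.left_mem), Or.inl fj.2.1, Or.inr hC]
  · have p2 := hU'.cons (x := y) yz' (fun hy => dS y hS.right_mem mU' hy)
      (fun w hw had => uz' w hw had)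
    have el := hs.edge hjl.symm mU' fl.2.2.2.2.1
    have o5 := hs.odd_link h.ehf hjl.symm hU fj.1 mU AU BU hRl.path.symm.symm fl.1 fl.2.2.2.2.1
      fl.2.2.2.2.2.1 p2 (by
        rintro s (rfl | hs1)
        · exact haS _ hS.right_mem
        · refine ⟨fun e => hs.apex_notMem mU' (e ▸ hs1), fun had => ?_⟩
          have := fj.2.2.2.2.2.1 s (sU' hs1) (hs.apex_edge mU' s hs1 had)
          exact Set.disjoint_left.1 hd hU.left_mem (this ▸ hs1)) (by
        rintro s (rfl | hs1)
        exacts [dS _ hS.right_mem mU, fun h1 => Set.disjoint_left.1 hd h1 hs1]) (by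
        rintro s (rfl | hs1)
        exacts [dS _ hS.right_mem fl.2.2.2.2.1, hs.disj hjl.symm mU' fl.2.2.2.2.1 s hs1])
      yz (hs.adjB hjl.symm fj.2.1 fl.2.1) (by
        rintro s (rfl | hs1) w hw had
        exacts [cU _ hS.right_mem w hw had, absurd had.symm (hcr w hw s hs1)]) (by
        rintro s (rfl | hs1) w hw had
        · exact absurd had (hcl _ hS.right_mem w hw)
        · have := el s hs1 w hw had
          exact ⟨fj.2.2.2.2.2.2.1 s (sU' hs1) this.1, fl.2.2.2.2.2.2.1 w hw this.2⟩)
    grind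

theorem no_link (h : MaxSys G a A B C) {αi αj αl bi bj bl : V} {ri rj rl : ℕ}
    {Ri Rj Rl : Set V} (hij : i ≠ j) (hil : l ≠ i) (hjl : l ≠ j)
    (hRi : GRung G A B C i αi bi ri Ri) (hRj : GRung G A B C j αj bj rj Rj)
    (hRl : GRung G A B C l αl bl rl Rl) (hS : IPath G x y n S) (hO : S ⊆ Out G a A B C)
    (hxi : ∃ w ∈ Ri, w ≠ bi ∧ G.Adj x w) (hcx : ∀ s ∈ S, ∀ w ∈ Ri, G.Adj s w → s = x)
    (hyj : ∃ w ∈ Rj, w ≠ bj ∧ G.Adj y w) (hcy : ∀ s ∈ S, ∀ w ∈ Rj, G.Adj s w → s = y)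
    (hcl : ∀ s ∈ S, ∀ w ∈ Rl, ¬ G.Adj s w) : False := by
  have hs := h.strips
  have dS : ∀ {i}, ∀ s ∈ S, ∀ {T : Set V}, (∀ w ∈ T, w ∈ strV A B C i) → s ∉ T :=
    fun {i} s hs T hT hsT => (Out.facts (hO hs)).2.2 i (hT s hsT)
  have haS : ∀ s ∈ S, s ≠ a ∧ ¬ G.Adj a s := fun s hs =>
    ⟨(Out.facts (hO hs)).1, (Out.facts (hO hs)).2.1⟩
  have fl := hRl.facts hs
  -- one half of the data, with the last link going through the third strip
  have key : ∀ {i j : Fin k} {αi bi αj bj x y : V} {ri rj : ℕ} {Ri Rj : Set V}, i ≠ j → l ≠ i →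
      l ≠ j → GRung G A B C i αi bi ri Ri → GRung G A B C j αj bj rj Rj → IPath G x y n S →
      (∀ s ∈ S, ∀ w ∈ Ri, G.Adj s w → s = x) → (∀ s ∈ S, ∀ w ∈ Rj, G.Adj s w → s = y) →
      ∀ {z z' : V} {d e : ℕ} {U U' : Set V}, IPath G αi z d U → U ⊆ Ri → bi ∉ U → G.Adj x z →
      (∀ w ∈ U, G.Adj x w → w = z) → IPath G z' bj e U' → U' ⊆ Rj → αj ∉ U' → G.Adj y z' →
      (∀ w ∈ U', G.Adj y w → w = z') → Odd (d + (n + e + 1) + rl) := by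
    intro i j αi bi αj bj x y ri rj Ri Rj hij hil hjl hRi hRj hS hcx hcy z z' d e U U' hU sU hbU xz
      uz hU' sU' haU' yz' uz'
    have fi := hRi.facts hs
    have fj := hRj.facts hs
    have mU : ∀ w ∈ U, w ∈ strV A B C i := fun w hw => fi.2.2.2.2.1 w (sU hw)
    have mU' : ∀ w ∈ U', w ∈ strV A B C j := fun w hw => fj.2.2.2.2.1 w (sU' hw)
    have BU : ∀ w ∈ U, w ∉ B i := fun w hw hB => hbU (fi.2.2.2.2.2.2.1 w (sU hw) hB ▸ hw)
    have cU' : ∀ s ∈ S, ∀ w ∈ U', G.Adj s w → s = y ∧ w = z' := fun s hs w hw had => by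
      obtain rfl := hcy s hs w (sU' hw) had
      exact ⟨rfl, uz' w hw had⟩
    have p1 := hS.join hU' yz' (Set.disjoint_left.2 fun s hs => dS s hs mU') cU'
    have el := hs.edge hjl.symm mU' fl.2.2.2.2.1
    have ei := hs.edge hij mU mU'
    refine hs.odd_link h.ehf hil.symm hU fi.1 mU (fun w hw => fi.2.2.2.2.2.1 w (sU hw)) BU
      hRl.path fl.1 fl.2.2.2.2.1 fl.2.2.2.2.2.1 p1 ?_ ?_ ?_ xz (hs.adjB hjl.symm fj.2.1 fl.2.1)
      ?_ ?_
    · rintro s (hs1 | hs1)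
      · exact haS s hs1
      · refine ⟨fun e => hs.apex_notMem mU' (e ▸ hs1), fun had => haU' ?_⟩
        exact fj.2.2.2.2.2.1 s (sU' hs1) (hs.apex_edge mU' s hs1 had) ▸ hs1
    · rintro s (hs1 | hs1)
      exacts [dS s hs1 mU, hs.disj hij.symm mU' mU s hs1]
    · rintro s (hs1 | hs1)
      exacts [dS s hs1 fl.2.2.2.2.1, hs.disj hjl.symm mU' fl.2.2.2.2.1 s hs1]
    · rintro s (hs1 | hs1) w hw had
      · obtain rfl := hcx s hs1 w (sU hw) had
        exact ⟨rfl, uz w hw had⟩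
      · exact absurd (ei w hw s hs1 had.symm).1 (BU w hw)
    · rintro s (hs1 | hs1) w hw had
      · exact absurd had (hcl s hs1 w hw)
      · have := el s hs1 w hw had
        exact ⟨fj.2.2.2.2.2.2.1 s (sU' hs1) this.1, fl.2.2.2.2.2.2.1 w hw this.2⟩
  have fi := hRi.facts hs
  have fj := hRj.facts hs
  obtain ⟨p, hp, hpb, hxp⟩ := id hxi
  obtain ⟨q, hq, hqb, hyq⟩ := id hyj
  obtain ⟨z₁, z₁', d₁, e₁, U₁, U₁', hU₁, hU₁', sU₁, sU₁', xz₁, xz₁', uz₁, uz₁', ax₁, bx₁, -⟩ :=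
    hRi.path.extremes (G.Adj x) ⟨p, hp, hxp⟩
  obtain ⟨z₂, z₂', d₂, e₂, U₂, U₂', hU₂, hU₂', sU₂, sU₂', yz₂, yz₂', uz₂, uz₂', ax₂, bx₂, -⟩ :=
    hRj.path.extremes (G.Adj y) ⟨q, hq, hyq⟩
  have hb₁ : bi ∉ U₁ := fun hb => hpb (bx₁ hb p hp hxp)
  have hb₂ : bj ∉ U₂ := fun hb => hqb (bx₂ hb q hq hyq)
  by_cases ha₁ : αi ∈ U₁'
  · have hall := ax₁ ha₁
    refine h.no_link_aux hij hil hjl hRi hRj hRl hS hO (hall p hp hxp ▸ hxp) (fun s hs w hw had => ?_)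
      hyj hcy hcl
    obtain rfl := hcx s hs w hw had
    exact ⟨rfl, hall w hw had⟩
  by_cases ha₂ : αj ∈ U₂'
  · have hall := ax₂ ha₂
    refine h.no_link_aux hij.symm hjl hil hRj hRi hRl hS.symm hO (hall q hq hyq ▸ hyq)
      (fun s hs w hw had => ?_) hxi hcx hcl
    obtain rfl := hcy s hs w hw had
    exact ⟨rfl, hall w hw had⟩
  have o3 := key hij hil hjl hRi hRj hS hcx hcy hU₁ sU₁ hb₁ xz₁ uz₁ hU₂' sU₂' ha₂ yz₂' uz₂'
  have o4 := key hij.symm hjl hil hRj hRi hS.symm hcy hcx hU₂ sU₂ hb₂ yz₂ uz₂ hU₁' sU₁' ha₁ xz₁' uz₁'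
  have mU₁ : ∀ w ∈ U₁, w ∈ strV A B C i := fun w hw => fi.2.2.2.2.1 w (sU₁ hw)
  have mU₁' : ∀ w ∈ U₁', w ∈ strV A B C i := fun w hw => fi.2.2.2.2.1 w (sU₁' hw)
  have mU₂ : ∀ w ∈ U₂, w ∈ strV A B C j := fun w hw => fj.2.2.2.2.1 w (sU₂ hw)
  have mU₂' : ∀ w ∈ U₂', w ∈ strV A B C j := fun w hw => fj.2.2.2.2.1 w (sU₂' hw)
  have o1 := hs.odd_link h.ehf hij hU₁ fi.1 mU₁ (fun w hw => fi.2.2.2.2.2.1 w (sU₁ hw))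
    (fun w hw hB => hb₁ (fi.2.2.2.2.2.2.1 w (sU₁ hw) hB ▸ hw)) hU₂ fj.1 mU₂
    (fun w hw => fj.2.2.2.2.2.1 w (sU₂ hw)) hS haS (fun s hs => dS s hs mU₁)
    (fun s hs => dS s hs mU₂) xz₁ yz₂ (fun s hs w hw had => by
      obtain rfl := hcx s hs w (sU₁ hw) had
      exact ⟨rfl, uz₁ w hw had⟩) (fun s hs w hw had => by
      obtain rfl := hcy s hs w (sU₂ hw) had
      exact ⟨rfl, uz₂ w hw had⟩)
  have p1 := hS.symm.join hU₁' xz₁' (Set.disjoint_left.2 fun s hs => dS s hs mU₁')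
    (fun s hs w hw had => by
      obtain rfl := hcx s hs w (sU₁' hw) had
      exact ⟨rfl, uz₁' w hw had⟩)
  have e12 := hs.edge hij mU₁' mU₂'
  have o2 := h.ehf.closeup p1 hU₂' yz₂' (hs.adjB hij fi.2.1 fj.2.1) (Set.disjoint_left.2 (by
      rintro s (hs1 | hs1)
      exacts [dS s hs1 mU₂', hs.disj hij mU₁' mU₂' s hs1])) (by omega) (by
      rintro s (hs1 | hs1) w hw had
      · obtain rfl := hcy s hs1 w (sU₂' hw) had
        exact Or.inl ⟨rfl, uz₂' w hw had⟩
      · have := e12 s hs1 w hw had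
        exact Or.inr ⟨fi.2.2.2.2.2.2.1 s (sU₁' hs1) this.1,
          fj.2.2.2.2.2.2.1 w (sU₂' hw) this.2⟩)
  grind

end MaxSys
end Separation

section Separation

variable {V : Type*} {G : SimpleGraph V} {a : V} {k : ℕ} {A B C : Fin k → Set V}

theorem IPath.initial {x y z : V} {n : ℕ} {S : Set V} (h : IPath G x y n S) (hz : z ∈ S)
    (hzy : z ≠ y) : ∃ d T, IPath G x z d T ∧ T ⊆ S ∧ y ∉ T ∧ d < n := by
  obtain ⟨d, e, S₁, S₂, h1, h2, h3, h4, h5, -⟩ := h.split hz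
  refine ⟨d, S₁, h1, h4 ▸ Set.subset_union_left, fun hy => hzy ?_, ?_⟩
  · have : y ∈ S₁ ∩ S₂ := ⟨hy, h2.right_mem⟩
    rw [h5] at this
    exact this.symm
  · have := mt h2.zero_iff.1 hzy
    omega

namespace MaxSys

variable {i j l : Fin k} {x y : V} {n m : ℕ} {S T : Set V}

theorem attach_left (h : MaxSys G a A B C) {p : V} (hp : p ∈ A i ∪ C i) (hx : G.Adj x p) :
    ∃ α b r R, GRung G A B C i α b r R ∧ (∃ w ∈ R, w ≠ b ∧ G.Adj x w) ∧
      ∃ z d U, IPath G α z d U ∧ U ⊆ R ∧ b ∉ U ∧ G.Adj x z ∧ ∀ w ∈ U, G.Adj x w → w = z := by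
  have hs := h.strips
  obtain ⟨α, b, r, R, hR, hpR⟩ := h.rung_through (x := p) (i := i)
    (hp.elim (hs.memA i p) (hs.memC i p))
  have hpb : p ≠ b := by
    rintro rfl
    exact hp.elim (fun hA => hs.ab i p hA hR.right) (hs.bc i p hR.right)
  obtain ⟨z, d, U, hU, sU, xz, uz, -, hb⟩ := hR.path.first (G.Adj x) ⟨p, hpR, hx⟩
  exact ⟨α, b, r, R, hR, ⟨p, hpR, hpb, hx⟩, z, d, U, hU, sU,
    fun hbU => hpb ((hb hbU).1 p hpR hx), xz, uz⟩

/-- Two different strips are not linked by a path outside of the strip system that is attached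
to `A ∪ C` at both ends. -/
theorem no_double_link (h : MaxSys G a A B C) (hij : i ≠ j) (hS : IPath G x y n S)
    (hO : S ⊆ Out G a A B C) (hx : ∃ p ∈ A i ∪ C i, G.Adj x p) (hy : ∃ p ∈ A j ∪ C j, G.Adj y p)
    (h₁ : ∀ z ∈ S, ∀ j' ≠ i, ∀ q ∈ strV A B C j', G.Adj z q → z = y)
    (h₂ : ∀ z ∈ S, ∀ i' ≠ j, ∀ q ∈ strV A B C i', G.Adj z q → z = x) : False := by
  have hs := h.strips
  obtain ⟨p, hp, hxp⟩ := hx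
  obtain ⟨q, hq, hyq⟩ := hy
  obtain ⟨αi, bi, ri, Ri, hRi, hxi, zi, di, Ui, hUi, sUi, bUi, xi, ui⟩ := h.attach_left hp hxp
  obtain ⟨αj, bj, rj, Rj, hRj, hyj, zj, dj, Uj, hUj, sUj, bUj, xj, uj⟩ := h.attach_left hq hyq
  obtain ⟨l, hli, hlj⟩ := h.exists_third i j
  obtain ⟨αl, hαl⟩ := h.exists_A l
  obtain ⟨bl, rl, Rl, hRl⟩ := h.rung_of_A hαl
  have fi := hRi.facts hs
  have fj := hRj.facts hs
  have fl := hRl.facts hs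
  by_cases hl : ∀ s ∈ S, ∀ w ∈ Rl, ¬ G.Adj s w
  · exact h.no_link hij hli hlj hRi hRj hRl hS hO hxi
      (fun s hm w hw had => h₂ s hm i hij w (fi.2.2.2.2.1 w hw) had) hyj
      (fun s hm w hw had => h₁ s hm j hij.symm w (fj.2.2.2.2.1 w hw) had) hl
  push Not at hl
  obtain ⟨s, hm, w, hw, had⟩ := hl
  obtain rfl := h₁ s hm l hli w (fl.2.2.2.2.1 w hw) had
  obtain rfl := h₂ s hm l hlj w (fl.2.2.2.2.1 w hw) had
  obtain ⟨zl, dl, Ul, hUl, sUl, xl, ul, -, -⟩ := hRl.path.first (G.Adj s) ⟨w, hw, had⟩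
  have hO' := Out.facts (hO hm)
  have key : ∀ {i j : Fin k} {α α' b z z' : V} {d e : ℕ} {U U' R R' : Set V}, i ≠ j →
      (∀ w ∈ R, w ∈ strV A B C i) → (∀ w ∈ R, w ∈ A i → w = α) → (∀ w ∈ R, w ∈ B i → w = b) →
      (∀ w ∈ R', w ∈ strV A B C j) → (∀ w ∈ R', w ∈ A j → w = α') → α ∈ A i → α' ∈ A j →
      IPath G α z d U → U ⊆ R → b ∉ U → G.Adj s z → (∀ w ∈ U, G.Adj s w → w = z) →
      IPath G α' z' e U' → U' ⊆ R' → G.Adj s z' → (∀ w ∈ U', G.Adj s w → w = z') →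
      Odd (d + 0 + e) := by
    intro i j α α' b z z' d e U U' R R' hij mR AR BR mR' AR' hα hα' hU sU hb sz uz hU' sU' sz' uz'
    refine hs.odd_link h.ehf hij hU hα (fun w hw => mR w (sU hw)) (fun w hw => AR w (sU hw))
      (fun w hw hB => hb (BR w (sU hw) hB ▸ hw)) hU' hα' (fun w hw => mR' w (sU' hw))
      (fun w hw => AR' w (sU' hw)) (.single s) ?_ ?_ ?_ sz sz' ?_ ?_
    · rintro _ rfl; exact ⟨hO'.1, hO'.2.1⟩
    · rintro _ rfl hsU; exact hO'.2.2 i (mR _ (sU hsU))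
    · rintro _ rfl hsU; exact hO'.2.2 j (mR' _ (sU' hsU))
    · rintro _ rfl w hw had; exact ⟨rfl, uz w hw had⟩
    · rintro _ rfl w hw had; exact ⟨rfl, uz' w hw had⟩
  have o1 := key hij fi.2.2.2.2.1 fi.2.2.2.2.2.1 fi.2.2.2.2.2.2.1 fj.2.2.2.2.1 fj.2.2.2.2.2.1
    fi.1 fj.1 hUi sUi bUi xi ui hUj sUj xj uj
  have o2 := key hli.symm fi.2.2.2.2.1 fi.2.2.2.2.2.1 fi.2.2.2.2.2.2.1 fl.2.2.2.2.1
    fl.2.2.2.2.2.1 fi.1 fl.1 hUi sUi bUi xi ui hUl sUl xl ul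
  have o3 := key hlj.symm fj.2.2.2.2.1 fj.2.2.2.2.2.1 fj.2.2.2.2.2.2.1 fl.2.2.2.2.1
    fl.2.2.2.2.2.1 fj.1 fl.1 hUj sUj bUj xj uj hUl sUl xl ul
  grind

/-- A path outside of the strip system that is attached to `A ∪ C` in one strip and only to `B` in
the other ones extends the strip system. -/
theorem no_end_link (h : MaxSys G a A B C) (hij : i ≠ j) (hS : IPath G x y n S)
    (hO : S ⊆ Out G a A B C) (hx : ∃ p ∈ A i ∪ C i, G.Adj x p) (hy : ∃ q ∈ B j, G.Adj y q)
    (h₀ : ∀ z ∈ S, ∀ p ∈ A i ∪ C i, G.Adj z p → z = x)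
    (h₁ : ∀ z ∈ S, ∀ j' ≠ i, ∀ q ∈ strV A B C j', G.Adj z q → z = y ∧ q ∈ B j') : False := by
  have hs := h.strips
  obtain ⟨p, hp, hxp⟩ := hx
  obtain ⟨q, hq, hyq⟩ := hy
  obtain ⟨αi, bi, ri, Ri, hRi, -, z, d, U, hU, sU, bU, xz, uz⟩ := h.attach_left hp hxp
  have fi := hRi.facts hs
  have mU : ∀ w ∈ U, w ∈ strV A B C i := fun w hw => fi.2.2.2.2.1 w (sU hw)
  have BU : ∀ w ∈ U, w ∉ B i := fun w hw hB => bU (fi.2.2.2.2.2.2.1 w (sU hw) hB ▸ hw)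
  have CU : ∀ w ∈ U, w = αi ∨ w ∈ C i := fun w hw => by
    rcases fi.2.2.2.2.2.2.2.1 w (sU hw) with rfl | rfl | hC
    exacts [Or.inl rfl, absurd hw bU, Or.inr hC]
  have ACU : ∀ w ∈ U, w ∈ A i ∪ C i := fun w hw =>
    (CU w hw).elim (fun e => Or.inl (e ▸ fi.1)) Or.inr
  have haS : ∀ s ∈ S, s ≠ a ∧ ¬ G.Adj a s := fun s hs =>
    ⟨(Out.facts (hO hs)).1, (Out.facts (hO hs)).2.1⟩
  have dS : ∀ {i}, ∀ s ∈ S, ∀ {T : Set V}, (∀ w ∈ T, w ∈ strV A B C i) → s ∉ T :=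
    fun {i} s hs T hT hsT => (Out.facts (hO hs)).2.2 i (hT s hsT)
  have cU : ∀ s ∈ S, ∀ w ∈ U, G.Adj s w → s = x ∧ w = z := fun s hs w hw had => by
    obtain rfl := h₀ s hs w (ACU w hw) had
    exact ⟨rfl, uz w hw had⟩
  have AU : ∀ w ∈ U, w ∈ A i → w = αi := fun w hw => fi.2.2.2.2.2.1 w (sU hw)
  have full : ∀ j' ≠ i, ∀ j'' ≠ i, j' ≠ j'' → ∀ q ∈ B j', G.Adj y q → ∀ b ∈ B j'', G.Adj y b := by
    intro j' hj' j'' hj'' hjj q hq hyq b hb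
    by_contra hyb
    obtain ⟨α, r, R, hR⟩ := h.rung_of_B hq
    obtain ⟨α', r', R', hR'⟩ := h.rung_of_B hb
    have f := hR.facts hs
    have f' := hR'.facts hs
    have cR : ∀ s ∈ S, ∀ w ∈ R, G.Adj s w → s = y ∧ w = q := fun s hm w hw had => by
      have := h₁ s hm j' hj' w (f.2.2.2.2.1 w hw) had
      exact ⟨this.1, f.2.2.2.2.2.2.1 w hw this.2⟩
    have cR' : ∀ s ∈ S, ∀ w ∈ R', ¬ G.Adj s w := fun s hm w hw had => by
      have := h₁ s hm j'' hj'' w (f'.2.2.2.2.1 w hw) had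
      obtain rfl := f'.2.2.2.2.2.2.1 w hw this.2
      exact hyb (this.1 ▸ had)
    have o1 := hs.odd_link h.ehf hj'.symm hU fi.1 mU AU BU hR.path f.1 f.2.2.2.2.1
      f.2.2.2.2.2.1 hS haS (fun s hm => dS s hm mU) (fun s hm => dS s hm f.2.2.2.2.1) xz hyq cU cR
    have o2 := hs.even_rungs h.ehf hjj hR hR'
    have mq := hs.memB j' q hq
    have p1 := hS.snoc hyq (fun hm => (Out.facts (hO hm)).2.2 j' mq)
      (fun w hm had => (cR w hm q f.2.2.2.1 had.symm).1)
    have ei := hs.edge hj' (S := {q}) (by rintro _ rfl; exact mq) mU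
    have ej := hs.edge hjj (S := {q}) (by rintro _ rfl; exact mq) f'.2.2.2.2.1
    have o3 := hs.odd_link h.ehf hj''.symm hU fi.1 mU AU BU hR'.path f'.1 f'.2.2.2.2.1
      f'.2.2.2.2.2.1 p1 (by
        rintro s (rfl | hm)
        · exact ⟨hs.apex j' _ mq, fun had => hs.ab j' _ ((hs.adj_apex j' _ mq).1 had) hq⟩
        · exact haS s hm) (by
        rintro s (rfl | hm)
        exacts [fun hsU => hj' (hs.index _ _ _ mq (mU _ hsU)), dS s hm mU]) (by
        rintro s (rfl | hm)
        exacts [fun hsU => hjj (hs.index _ _ _ mq (f'.2.2.2.2.1 _ hsU)), dS s hm f'.2.2.2.2.1])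
      xz (hs.adjB hjj hq hb) (by
        rintro s (rfl | hm) w hw had
        exacts [absurd (ei _ rfl w hw had).2 (BU w hw), cU s hm w hw had]) (by
        rintro s (rfl | hm) w hw had
        exacts [⟨rfl, f'.2.2.2.2.2.2.1 w hw (ej _ rfl w hw had).2⟩, absurd had (cR' s hm w hw)])
    grind
  obtain ⟨l, hli, hlj⟩ := h.exists_third i j
  obtain ⟨bl, hbl⟩ := h.exists_B l
  have ybl := full j hij.symm l hli hlj.symm q hq hyq bl hbl
  have yj := full l hli j hij.symm hlj bl hbl ybl
  have yfull : ∀ j' ≠ i, ∀ b ∈ B j', G.Adj y b := fun j' hj' b hb => by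
    by_cases hjj : j = j'
    · exact yj b (hjj ▸ hb)
    · exact full j hij.symm j' hj' hjj q hq hyq b hb
  have hne : ∀ {w}, w ∈ (∅ : Set V) ∪ {y} ∪ S \ {y} → w ∈ S := by
    rintro w ((hw | rfl) | hw)
    exacts [hw.elim, hS.right_mem, hw.1]
  refine merge_false a h.sys h.indec h.max {i} (l₁ := j) (l₂ := l) hlj.symm hij.symm hli ∅ {y}
    (S \ {y}) ⟨y, by simp⟩ (fun w hw => (hO (hne hw)).1) (by simp) (by simp) (by simp) (by simp)
    (fun w hw => (haS w (hne (Set.union_assoc _ _ _ ▸ Or.inr hw))).2) ?_ ?_ ?_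
  · intro w hw j' hj' p hp
    constructor
    · exact fun had => h₁ w (hne hw) j' hj' p hp had
    · rintro ⟨rfl, hp⟩
      exact yfull j' hj' p hp
  · intro w hw
    refine ⟨αi, y, _, _, Or.inr ⟨i, rfl, fi.1⟩, Or.inl rfl,
      hU.join hS xz.symm (Set.disjoint_right.2 fun s hm => dS s hm mU)
        (fun u hu w hw had => (cU w hw u hu had.symm).symm), Or.inr (hne hw), ?_⟩
    rintro u (hu | hu)
    · rcases CU u hu with rfl | hC
      · exact Set.mem_insert _ _
      · exact Or.inr (Or.inr (Or.inr ⟨i, rfl, hC⟩))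
    · by_cases huy : u = y
      · exact Or.inr (Or.inl huy)
      · exact Or.inr (Or.inr (Or.inl ⟨hu, huy⟩))
  · have hsub : A i ∪ C i ⊆ mergeFam {i} ∅ A none ∪ mergeFam {i} (S \ {y}) C none := by
      rintro u (hu | hu)
      exacts [Or.inl (Or.inr ⟨i, rfl, hu⟩), Or.inr (Or.inr ⟨i, rfl, hu⟩)]
    refine rch_all (c := z) ?_
    have mz := ACU z hU.right_mem
    rintro u ((hu | ⟨_, rfl, hu⟩) | (⟨hu, huy⟩ | ⟨_, rfl, hu⟩))
    · exact hu.elim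
    · exact (h.conn _ u (Or.inl hu) z mz).mono hsub
    · obtain ⟨d, T, hT, sT, yT, -⟩ := hS.initial hu huy
      refine ((hT.symm.rch x hT.left_mem).mono fun w hw => Or.inr (Or.inl ⟨sT hw, ?_⟩)).trans
        (.step xz (hsub mz))
      rintro rfl
      exact yT hw
    · exact (h.conn _ u (Or.inr hu) z mz).mono hsub

/-- No path outside of the strip system is attached to `A ∪ C` in one strip and to another
strip. -/
theorem separated (h : MaxSys G a A B C) : ∀ (n : ℕ) {i j : Fin k} {x y : V} {S : Set V}, i ≠ j →
    IPath G x y n S → S ⊆ Out G a A B C → (∃ p ∈ A i ∪ C i, G.Adj x p) →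
    (∃ q ∈ strV A B C j, G.Adj y q) → False := by
  intro n
  induction n using Nat.strong_induction_on with
  | _ n ih =>
    intro i j x y S hij hS hO hx hy
    have hs := h.strips
    have hxy : ∀ {i x y S}, IPath G x y n S → S ⊆ Out G a A B C → (∃ p ∈ A i ∪ C i, G.Adj x p) →
        ∀ z ∈ S, ∀ j' ≠ i, ∀ q ∈ strV A B C j', G.Adj z q → z = y := by
      intro i x y S hS hO hx z hz j' hj' q hq hzq
      by_contra hzy
      obtain ⟨d, T, hT, sT, -, hd⟩ := hS.initial hz hzy
      exact ih d hd hj'.symm hT (sT.trans hO) hx ⟨q, hq, hzq⟩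
    have h₁ := hxy hS hO hx
    by_cases hc : ∃ j', j' ≠ i ∧ ∃ q ∈ A j' ∪ C j', G.Adj y q
    · obtain ⟨j', hj', hy'⟩ := hc
      exact h.no_double_link hj'.symm hS hO hx hy' h₁ (hxy hS.symm hO hy')
    · push Not at hc
      have hB : ∀ j' ≠ i, ∀ q ∈ strV A B C j', G.Adj y q → q ∈ B j' := by
        rintro j' hj' q ((hq | hq) | hq) had
        exacts [absurd had (hc j' hj' q (Or.inl hq)), hq, absurd had (hc j' hj' q (Or.inr hq))]
      obtain ⟨q, hq, hyq⟩ := id hy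
      refine h.no_end_link hij hS hO hx ⟨q, hB j hij.symm q hq hyq, hyq⟩ ?_ ?_
      · intro z hz p hp had
        by_contra hzx
        obtain ⟨d, T, hT, sT, -, hd⟩ := hS.symm.initial hz hzx
        exact ih d hd hij hT.symm (sT.trans hO) ⟨p, hp, had⟩ hy
      · intro z hz j' hj' q hq had
        obtain rfl := h₁ z hz j' hj' q hq had
        exact ⟨rfl, hB j' hj' q hq had⟩

end MaxSys
end Separation

section Frame

variable {V : Type*} {G : SimpleGraph V} {a : V} {k : ℕ} {A B C : Fin k → Set V}

/-- A walk leaving a set has a last vertex before leaving it. -/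
theorem Rch.exit {X D : Set V} {x y : V} (h : Rch G X x y) (hx : x ∈ D) (hy : y ∉ D) :
    ∃ u u', Rch G D x u ∧ u ∈ D ∧ G.Adj u u' ∧ u' ∈ X ∧ u' ∉ D := by
  by_contra hc
  push Not at hc
  have aux : Rch G D x y := by
    clear hy
    induction h with
    | refl => exact .refl
    | @tail u w _ h2 ih => exact ih.trans (.step h2.1 (hc _ _ ih (ih.mem hx) h2.1 h2.2))
  exact hy (aux.mem hx)

/-- A maximal pyramid strip system together with the distribution of the remaining nonneighbours of
the apex: `T i` consists of `C i` and of the components attached to `A i ∪ C i`, and `O` of the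
other components. -/
structure Frame (G : SimpleGraph V) (a : V) {k : ℕ} (A B C T : Fin k → Set V) (O : Set V) :
    Prop where
  sys : MaxSys G a A B C
  st : Strips G a A B T
  rungA : ∀ i, ∀ α ∈ A i, ∃ b n S, GRung G A B T i α b n S
  rungB : ∀ i, ∀ b ∈ B i, ∃ α n S, GRung G A B T i α b n S
  toA : ∀ i, ∀ t ∈ T i, ∃ t' ∈ T i, Rch G (T i) t t' ∧ ∃ α ∈ A i, G.Adj t' α
  toB : ∀ i, ∀ t ∈ T i, ∃ t' ∈ T i, Rch G (T i) t t' ∧ ∃ b ∈ B i, G.Adj t' b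
  conn : ∀ i, ∀ x ∈ A i ∪ T i, ∀ y ∈ A i ∪ T i, Rch G (A i ∪ T i) x y
  out : ∀ x ∈ O, x ≠ a ∧ ¬ G.Adj a x ∧ ∀ i, x ∉ strV A B T i
  far : ∀ x ∈ O, ∀ i, ∀ p ∈ A i ∪ T i, ¬ G.Adj x p
  outB : ∀ x ∈ O, ∃ y ∈ O, Rch G O x y ∧ ∃ i, ∃ b ∈ B i, G.Adj y b
  cover : ∀ x, x ≠ a → ¬ G.Adj a x → x ∈ O ∨ ∃ i, x ∈ B i ∪ T i
  nbr : ∀ v, G.Adj a v → ∃ w, G.Adj v w ∧ w ≠ a ∧ ¬ G.Adj a w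
  sub : ∀ i, C i ⊆ T i
  notMem : ∀ i, ∀ x ∈ T i, x ∉ C i → x ∉ PSSVerts a A B C
  out_notMem : ∀ x ∈ O, x ∉ PSSVerts a A B C

namespace MaxSys

variable {i j l : Fin k} {x y : V} {n m : ℕ} {S T : Set V}

/-- The vertices in the components attached to `A i ∪ C i`. -/
def Attd (G : SimpleGraph V) (a : V) {k : ℕ} (A B C : Fin k → Set V) (i : Fin k) : Set V :=
  {x | x ∈ Out G a A B C ∧ ∃ y, Rch G (Out G a A B C) x y ∧ ∃ p ∈ A i ∪ C i, G.Adj y p}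

theorem rch_separated (h : MaxSys G a A B C) (hij : i ≠ j) (hx : x ∈ Out G a A B C)
    (hr : Rch G (Out G a A B C) x y) {p q : V} (hp : p ∈ A i ∪ C i) (hxp : G.Adj x p)
    (hq : q ∈ strV A B C j) (hyq : G.Adj y q) : False := by
  obtain ⟨n, S, hS, sS⟩ := hr.exists_path
  exact h.separated n hij hS (sS.trans (Set.insert_subset hx le_rfl)) ⟨p, hp, hxp⟩ ⟨q, hq, hyq⟩

theorem attd_closed (hx : x ∈ Attd G a A B C i) (hy : y ∈ Out G a A B C) (h : G.Adj x y) :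
    y ∈ Attd G a A B C i := by
  obtain ⟨h1, z, h2, h3⟩ := hx
  exact ⟨hy, z, (Rch.step h.symm h1).trans h2, h3⟩

theorem attd_rch (hx : x ∈ Attd G a A B C i) (h : Rch G (Out G a A B C) x y) :
    Rch G (Attd G a A B C i) x y := by
  induction h with
  | refl => exact .refl
  | @tail u w h1 h2 ih => exact ih.trans (.step h2.1 (attd_closed (ih.mem hx) h2.2 h2.1))

theorem attd_strip (h : MaxSys G a A B C) (hij : i ≠ j) (hx : x ∈ Attd G a A B C i) {q : V}
    (hq : q ∈ strV A B C j) : ¬ G.Adj x q := fun had => by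
  obtain ⟨h1, z, h2, p, hp, hzp⟩ := hx
  exact h.rch_separated hij (h2.mem h1) (h2.symm h1) hp hzp hq had

theorem attd_attd (h : MaxSys G a A B C) (hij : i ≠ j) (hx : x ∈ Attd G a A B C i) :
    x ∉ Attd G a A B C j := fun hx' => by
  obtain ⟨h1, z, h2, p, hp, hzp⟩ := hx
  obtain ⟨-, z', h2', p', hp', hzp'⟩ := hx'
  exact h.rch_separated hij (h2.mem h1) ((h2.symm h1).trans h2') hp hzp
    (hp'.elim (h.strips.memA j p') (h.strips.memC j p')) hzp'

theorem big_cases {i : Fin k} {x : V}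
    (hx : x ∈ strV A B (fun i => C i ∪ Attd G a A B C i) i) :
    x ∈ strV A B C i ∨ x ∈ Attd G a A B C i := by
  rcases hx with hx | hx | hx
  exacts [Or.inl (Or.inl hx), Or.inl (Or.inr hx), Or.inr hx]

theorem big_strips (h : MaxSys G a A B C) :
    Strips G a A B (fun i => C i ∪ Attd G a A B C i) where
  three := h.sys.1
  ab := h.strips.ab
  ac i x hx := by
    rintro (hC | hD)
    exacts [h.strips.ac i x hx hC, (Out.facts hD.1).2.2 i (h.strips.memA i x hx)]
  bc i x hx := by
    rintro (hC | hD)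
    exacts [h.strips.bc i x hx hC, (Out.facts hD.1).2.2 i (h.strips.memB i x hx)]
  index i j x hx hx' := by
    rcases big_cases hx with hx | hx <;> rcases big_cases hx' with hx' | hx'
    · exact h.strips.index i j x hx hx'
    · exact absurd hx ((Out.facts hx'.1).2.2 i)
    · exact absurd hx' ((Out.facts hx.1).2.2 j)
    · by_contra hij
      exact h.attd_attd hij hx hx'
  cross i j x y hij hx hy := by
    have aux : ∀ {i x}, x ∈ Attd G a A B C i → x ∉ B i := fun hx hB =>
      (Out.facts hx.1).2.2 _ (h.strips.memB _ _ hB)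
    rcases big_cases hx with hx | hx <;> rcases big_cases hy with hy | hy
    · exact h.strips.cross i j x y hij hx hy
    · exact ⟨fun had => absurd had.symm (h.attd_strip hij.symm hy hx), fun hB => absurd hB.2 (aux hy)⟩
    · exact ⟨fun had => absurd had (h.attd_strip hij hx hy), fun hB => absurd hB.1 (aux hx)⟩
    · exact ⟨fun had => absurd hy (h.attd_attd hij (attd_closed hx hy.1 had)),
        fun hB => absurd hB.1 (aux hx)⟩
  apex i x hx := by
    rcases big_cases hx with hx | hx
    exacts [h.strips.apex i x hx, (Out.facts hx.1).1]
  adj_apex i x hx := by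
    rcases big_cases hx with hx | hx
    · exact h.strips.adj_apex i x hx
    · exact ⟨fun had => absurd had (Out.facts hx.1).2.1,
        fun hA => absurd (h.strips.memA i x hA) ((Out.facts hx.1).2.2 i)⟩

theorem frame (h : MaxSys G a A B C) :
    Frame G a A B C (fun i => C i ∪ Attd G a A B C i)
      (Out G a A B C \ ⋃ i, Attd G a A B C i) := by
  have hs := h.strips
  have hW := (connectedSubset_iff.1 h.splendid.1).2
  have memW : ∀ {x}, x ∈ (closedNbhd G a)ᶜ ↔ x ≠ a ∧ ¬ G.Adj a x := by
    intro x
    simp [closedNbhd]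
  have memPSS : ∀ {x}, x ∈ PSSVerts a A B C ↔ x = a ∨ ∃ i, x ∈ strV A B C i := by
    intro x
    simp [PSSVerts, strV]
  have cov : ∀ x, x ≠ a → ¬ G.Adj a x → x ∈ Out G a A B C ∨ ∃ i, x ∈ B i ∪ C i := by
    intro x h1 h2
    by_cases hx : x ∈ PSSVerts a A B C
    · rcases memPSS.1 hx with rfl | ⟨i, (hx | hx) | hx⟩
      exacts [absurd rfl h1, absurd (hs.adjA hx) h2, Or.inr ⟨i, Or.inl hx⟩, Or.inr ⟨i, Or.inr hx⟩]
    · exact Or.inl ⟨hx, h2⟩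
  have memB : ∀ {i b}, b ∈ B i → b ≠ a ∧ ¬ G.Adj a b := fun {i b} hb =>
    ⟨hs.apex i b (hs.memB i b hb),
      fun had => hs.ab i b ((hs.adj_apex i b (hs.memB i b hb)).1 had) hb⟩
  have toA0 : ∀ i, ∀ t ∈ C i, ∃ t' ∈ C i, Rch G (C i) t t' ∧ ∃ α ∈ A i, G.Adj t' α := by
    intro i t ht
    obtain ⟨α, b, n, S, hS, htS⟩ := h.rung_through (hs.memC i t ht)
    have f := hS.facts hs
    obtain ⟨d, T, hT, sT, bT, -⟩ := hS.path.initial htS (fun e => hs.bc i b f.2.1 (e ▸ ht))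
    cases d with
    | zero => exact absurd ht (hT.eq_singleton.2 ▸ hs.ac i α f.1)
    | succ d =>
      obtain ⟨t', T', g1, g2, g3, rfl, -⟩ := hT.uncons
      have sub : T' ⊆ C i := fun w hw => by
        have hw' : w ∈ insert α T' := Or.inr hw
        rcases f.2.2.2.2.2.2.2.1 w (sT hw') with rfl | rfl | hC
        exacts [absurd hw g3, absurd hw' bT, hC]
      exact ⟨t', sub g2.left_mem, (g2.symm.rch t' g2.left_mem).mono sub, α, f.1, g1.symm⟩
  have toB0 : ∀ i, ∀ t ∈ C i, ∃ t' ∈ C i, Rch G (C i) t t' ∧ ∃ b ∈ B i, G.Adj t' b := by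
    intro i t ht
    obtain ⟨α, b, n, S, hS, htS⟩ := h.rung_through (hs.memC i t ht)
    have f := hS.facts hs
    obtain ⟨d, T, hT, sT, bT, -⟩ := hS.path.symm.initial htS (fun e => hs.ac i α f.1 (e ▸ ht))
    cases d with
    | zero => exact absurd ht (hT.eq_singleton.2 ▸ hs.bc i b f.2.1)
    | succ d =>
      obtain ⟨t', T', g1, g2, g3, rfl, -⟩ := hT.uncons
      have sub : T' ⊆ C i := fun w hw => by
        have hw' : w ∈ insert b T' := Or.inr hw
        rcases f.2.2.2.2.2.2.2.1 w (sT hw') with rfl | rfl | hC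
        exacts [absurd hw' bT, absurd hw g3, hC]
      exact ⟨t', sub g2.left_mem, (g2.symm.rch t' g2.left_mem).mono sub, b, f.2.1, g1.symm⟩
  have toA : ∀ i, ∀ t ∈ C i ∪ Attd G a A B C i, ∃ t' ∈ C i ∪ Attd G a A B C i,
      Rch G (C i ∪ Attd G a A B C i) t t' ∧ ∃ α ∈ A i, G.Adj t' α := by
    have up : ∀ i, ∀ t ∈ C i, ∃ t' ∈ C i ∪ Attd G a A B C i,
      Rch G (C i ∪ Attd G a A B C i) t t' ∧ ∃ α ∈ A i, G.Adj t' α := fun i t ht => by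
      obtain ⟨t', g1, g2, g3⟩ := toA0 i t ht
      exact ⟨t', Or.inl g1, g2.mono Set.subset_union_left, g3⟩
    rintro i t (ht | ht)
    · exact up i t ht
    · obtain ⟨-, y, h2, p, hp, hyp⟩ := id ht
      have h3 := attd_rch ht h2
      have hy := h3.mem ht
      rcases hp with hp | hp
      · exact ⟨y, Or.inr hy, h3.mono Set.subset_union_right, p, hp, hyp⟩
      · obtain ⟨t', g1, g2, g3⟩ := up i p hp
        exact ⟨t', g1, ((h3.mono Set.subset_union_right).trans
          (.step hyp (Or.inl hp))).trans g2, g3⟩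
  have toB : ∀ i, ∀ t ∈ C i ∪ Attd G a A B C i, ∃ t' ∈ C i ∪ Attd G a A B C i,
      Rch G (C i ∪ Attd G a A B C i) t t' ∧ ∃ b ∈ B i, G.Adj t' b := by
    have up : ∀ i, ∀ t ∈ C i, ∃ t' ∈ C i ∪ Attd G a A B C i,
      Rch G (C i ∪ Attd G a A B C i) t t' ∧ ∃ b ∈ B i, G.Adj t' b := fun i t ht => by
      obtain ⟨t', g1, g2, g3⟩ := toB0 i t ht
      exact ⟨t', Or.inl g1, g2.mono Set.subset_union_left, g3⟩
    rintro i t (ht | ht)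
    · exact up i t ht
    · obtain ⟨b, hb⟩ := h.exists_B i
      have ft := Out.facts ht.1
      have hbD : b ∉ Attd G a A B C i := fun hD => (Out.facts hD.1).2.2 i (hs.memB i b hb)
      obtain ⟨u, u', g1, g2, g3, g4, g5⟩ :=
        (hW t (memW.2 ⟨ft.1, ft.2.1⟩) b (memW.2 (memB hb))).exit ht hbD
      rcases cov u' (memW.1 g4).1 (memW.1 g4).2 with g6 | ⟨j, g6⟩
      · exact absurd (attd_closed g2 g6 g3) g5
      · have hji : i = j := by
          by_contra hij
          exact h.attd_strip hij g2 (g6.elim (hs.memB j u') (hs.memC j u')) g3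
        subst hji
        rcases g6 with g6 | g6
        · exact ⟨u, Or.inr g2, g1.mono Set.subset_union_right, u', g6, g3⟩
        · obtain ⟨t', k1, k2, k3⟩ := up _ u' g6
          exact ⟨t', k1, ((g1.mono Set.subset_union_right).trans (.step g3 (Or.inl g6))).trans k2,
            k3⟩
  have far : ∀ x ∈ Out G a A B C \ ⋃ i, Attd G a A B C i, ∀ i,
      ∀ p ∈ A i ∪ (C i ∪ Attd G a A B C i), ¬ G.Adj x p := by
    rintro x ⟨hx, hxD⟩ i p hp had
    refine hxD (Set.mem_iUnion.2 ⟨i, ?_⟩)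
    rcases hp with hp | hp | hp
    exacts [⟨hx, x, .refl, p, Or.inl hp, had⟩, ⟨hx, x, .refl, p, Or.inr hp, had⟩,
      attd_closed hp hx had.symm]
  exact {
    sys := h
    st := h.big_strips
    rungA := fun i α hα => by
      obtain ⟨b, n, S, hS⟩ := h.rung_of_A hα
      exact ⟨b, n, S, hS.mono Set.subset_union_left⟩
    rungB := fun i b hb => by
      obtain ⟨α, n, S, hS⟩ := h.rung_of_B hb
      exact ⟨α, n, S, hS.mono Set.subset_union_left⟩
    toA := toA
    toB := toB
    conn := fun i => by
      obtain ⟨α₀, hα₀⟩ := h.exists_A i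
      have cA : ∀ α ∈ A i, Rch G (A i ∪ (C i ∪ Attd G a A B C i)) α α₀ := fun α hα =>
        (h.conn i α (Or.inl hα) α₀ (Or.inl hα₀)).mono
          (Set.union_subset_union_right _ Set.subset_union_left)
      refine rch_all (c := α₀) ?_
      rintro x (hx | hx)
      · exact cA x hx
      · obtain ⟨t', g1, g2, α, hα, g3⟩ := toA i x hx
        exact (g2.mono Set.subset_union_right).trans ((Rch.step g3 (Or.inl hα)).trans (cA α hα))
    out := by
      rintro x ⟨hx, hxD⟩
      have f := Out.facts hx
      refine ⟨f.1, f.2.1, fun i hi => ?_⟩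
      rcases big_cases hi with hi | hi
      exacts [f.2.2 i hi, hxD (Set.mem_iUnion.2 ⟨i, hi⟩)]
    far := far
    outB := by
      rintro x hx
      have f := Out.facts hx.1
      obtain ⟨b, hb⟩ := h.exists_B ⟨0, by have := h.sys.1; omega⟩
      obtain ⟨u, u', g1, g2, g3, g4, g5⟩ :=
        (hW x (memW.2 ⟨f.1, f.2.1⟩) b (memW.2 (memB hb))).exit hx
          (fun hb' => (Out.facts hb'.1).2.2 _ (hs.memB _ b hb))
      refine ⟨u, g2, g1, ?_⟩
      rcases cov u' (memW.1 g4).1 (memW.1 g4).2 with g6 | ⟨j, g6 | g6⟩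
      · have : u' ∈ ⋃ i, Attd G a A B C i := by
          by_contra hc
          exact g5 ⟨g6, hc⟩
        obtain ⟨i, hi⟩ := Set.mem_iUnion.1 this
        exact absurd g3 (far u g2 i u' (Or.inr (Or.inr hi)))
      · exact ⟨j, u', g6, g3⟩
      · exact absurd g3 (far u g2 j u' (Or.inr (Or.inl g6)))
    cover := by
      intro x h1 h2
      rcases cov x h1 h2 with hx | ⟨i, hx | hx⟩
      · by_cases hD : x ∈ ⋃ i, Attd G a A B C i
        · obtain ⟨i, hi⟩ := Set.mem_iUnion.1 hD
          exact Or.inr ⟨i, Or.inr (Or.inr hi)⟩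
        · exact Or.inl ⟨hx, hD⟩
      · exact Or.inr ⟨i, Or.inl hx⟩
      · exact Or.inr ⟨i, Or.inr (Or.inl hx)⟩
    nbr := fun v hv => by
      obtain ⟨w, hw, hvw⟩ := h.splendid.2.1 v hv
      exact ⟨w, hvw, memW.1 hw⟩
    sub := fun i => Set.subset_union_left
    notMem := by
      rintro i x (hx | hx) hC
      exacts [absurd hx hC, hx.1.1]
    out_notMem := fun x hx => hx.1.1 }

end MaxSys
end Frame

section Tails

variable {V : Type*} {G : SimpleGraph V} {a : V} {k : ℕ} {A B C T : Fin k → Set V} {O : Set V}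

/-- All rungs have the same parity as `ρ`. -/
def RungParity (G : SimpleGraph V) {k : ℕ} (A B T : Fin k → Set V) (ρ : ℕ) : Prop :=
  ∀ {i α b r R}, GRung G A B T i α b r R → Even (r + ρ)

/-- `S` is the vertex set of a path with `n` edges from `v` through `T i` to `B i`. -/
structure Tail (G : SimpleGraph V) {k : ℕ} (B T : Fin k → Set V) (v : V) (i : Fin k) (b : V) (n : ℕ)
    (S : Set V) : Prop where
  right : b ∈ B i
  path : IPath G v b n S
  sub : S ⊆ insert v (insert b (T i))

/-- `v` has a neighbour in `B i ∪ T i`. -/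
def Hits (G : SimpleGraph V) {k : ℕ} (B T : Fin k → Set V) (v : V) (i : Fin k) : Prop :=
  ∃ w ∈ B i ∪ T i, G.Adj v w

namespace Frame

variable {i j l : Fin k} {v α b : V} {n m r ρ : ℕ} {P R S : Set V}

theorem exists_parity (F : Frame G a A B C T O) : ∃ ρ, RungParity G A B T ρ := by
  have h3 := F.st.three
  have ex : ∀ i, ∃ α b r R, GRung G A B T i α b r R := fun i => by
    obtain ⟨α, hα⟩ := F.sys.exists_A i
    exact ⟨α, F.rungA i α hα⟩
  obtain ⟨α₀, b₀, r₀, R₀, h₀⟩ := ex ⟨0, by omega⟩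
  obtain ⟨α₁, b₁, r₁, R₁, h₁⟩ := ex ⟨1, by omega⟩
  have h01 := F.st.even_rungs F.sys.ehf (by simp) h₀ h₁
  refine ⟨r₀, fun {i α b r R} h => ?_⟩
  by_cases hi : i = ⟨0, by omega⟩
  · subst hi
    have := F.st.even_rungs F.sys.ehf (by simp) h h₁
    grind
  · exact F.st.even_rungs F.sys.ehf hi h h₀

/-- Basic facts about a neighbour of the apex outside of the strip system. -/
theorem ext_facts (F : Frame G a A B C T O) (hv : G.Adj a v) (hvS : v ∉ PSSVerts a A B C) :
    v ≠ a ∧ v ∉ O ∧ ∀ i, v ∉ strV A B T i := by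
  refine ⟨hv.ne', fun h => (F.out v h).2.1 hv, fun i hi => hvS ?_⟩
  exact Set.mem_insert_of_mem _ (Set.mem_iUnion.2 ⟨i, Or.inl (Or.inl ((F.st.adj_apex i v hi).1 hv))⟩)

theorem bt_facts (F : Frame G a A B C T O) {w : V} (hw : w ∈ B i ∪ T i) :
    w ∈ strV A B T i ∧ w ≠ a ∧ ¬ G.Adj a w ∧ w ∉ A i := by
  have h1 : w ∈ strV A B T i := hw.elim (F.st.memB i w) (F.st.memC i w)
  have h2 : w ∉ A i := fun hA => hw.elim (F.st.ab i w hA) (F.st.ac i w hA)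
  exact ⟨h1, F.st.apex i w h1, fun had => h2 ((F.st.adj_apex i w h1).1 had), h2⟩

theorem tail_facts (F : Frame G a A B C T O) (hv : G.Adj a v) (hvS : v ∉ PSSVerts a A B C)
    (h : Tail G B T v i b n S) :
    v ≠ b ∧ 1 ≤ n ∧ (∀ w ∈ S, w = v ∨ w ∈ B i ∪ T i) ∧ (∀ w ∈ S, w ∈ B i → w = b) ∧
      (∀ w ∈ S, w ≠ v → w ≠ b → w ∈ T i) ∧
      ∀ w ∈ S, w ≠ v → w ∈ strV A B T i ∧ w ≠ a ∧ ¬ G.Adj a w ∧ w ∉ A i := by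
  have f := F.ext_facts hv hvS
  have hb := h.right
  have e : ∀ w ∈ S, w = v ∨ w = b ∨ w ∈ T i := fun w hw => h.sub hw
  have hvb : v ≠ b := by
    rintro rfl
    exact f.2.2 i (F.st.memB i _ hb)
  have e1 : ∀ w ∈ S, w = v ∨ w ∈ B i ∪ T i := fun w hw => by
    rcases e w hw with h | rfl | h
    exacts [Or.inl h, Or.inr (Or.inl hb), Or.inr (Or.inr h)]
  refine ⟨hvb, ?_, e1, ?_, fun w hw h1 h2 => ((e w hw).resolve_left h1).resolve_left h2,
    fun w hw hwv => F.bt_facts ((e1 w hw).resolve_left hwv)⟩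
  · rcases Nat.eq_zero_or_pos n with h0 | h0
    · exact absurd (h.path.zero_iff.1 h0) hvb
    · exact h0
  · intro w hw hwB
    rcases e w hw with rfl | h | h
    exacts [absurd (F.st.memB i _ hwB) (f.2.2 i), h, absurd h (F.st.bc i w hwB)]

theorem tail_of_rch (hb : b ∈ B i) (h : Rch G (insert b (T i)) v b) :
    ∃ n S, Tail G B T v i b n S := by
  obtain ⟨n, S, hS, sS⟩ := h.exists_path
  exact ⟨n, S, hb, hS, sS⟩

theorem exists_tail (F : Frame G a A B C T O) (h : Hits G B T v i) :
    ∃ b n S, Tail G B T v i b n S := by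
  obtain ⟨w, hw | hw, hvw⟩ := h
  · obtain ⟨n, S, h⟩ := tail_of_rch (T := T) hw (.step hvw (Set.mem_insert _ _))
    exact ⟨w, n, S, h⟩
  · obtain ⟨t, ht, hr, b, hb, htb⟩ := F.toB i w hw
    obtain ⟨n, S, h⟩ := tail_of_rch (T := T) hb (v := v)
      (((Rch.step hvw (Or.inr hw)).trans (hr.mono (Set.subset_insert _ _))).trans
        (.step htb (Set.mem_insert _ _)))
    exact ⟨b, n, S, h⟩

theorem hits_of_tail (F : Frame G a A B C T O) (hv : G.Adj a v) (hvS : v ∉ PSSVerts a A B C)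
    (h : Tail G B T v i b n S) : Hits G B T v i := by
  have f := F.tail_facts hv hvS h
  obtain ⟨n, rfl⟩ := Nat.exists_eq_add_of_le' f.2.1
  obtain ⟨w, S', h1, h2, h3, rfl, -⟩ := h.path.uncons
  refine ⟨w, (f.2.2.1 w (Or.inr h2.left_mem)).resolve_left ?_, h1⟩
  rintro rfl
  exact h3 h2.left_mem

/-- The parity of a path from a neighbour of the apex to the end of a rung. -/
theorem adj_iff_even (F : Frame G a A B C T O) (hv : G.Adj a v)
    (hR : GRung G A B T i α b r R) (hP : IPath G v b m P) (hm : 1 ≤ m)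
    (hPa : ∀ u ∈ P, u ≠ v → u ≠ a ∧ ¬ G.Adj a u) (hd : ∀ u ∈ P, u ∈ R → u = b)
    (hc : ∀ u ∈ P, ∀ w ∈ R, u ≠ b → w ≠ b → G.Adj u w → u = v ∧ w = α) :
    G.Adj v α ↔ Even (m + r) := by
  have f := hR.facts F.st
  constructor
  · exact fun had => F.sys.ehf.even_of_common_end hP hR.path had hm f.2.2.2.2.2.2.2.2.2 hd hc
  · intro he
    by_contra hna
    have haP : a ∉ P := fun h => (hPa a h hv.ne).1 rfl
    have p1 := hP.cons hv haP (fun w hw had => by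
      by_contra hwv
      exact (hPa w hw hwv).2 had)
    have aR := F.st.apex_edge f.2.2.2.2.1
    have := F.sys.ehf.even_of_common_end p1 hR.path (F.st.adjA f.1) (by omega)
      f.2.2.2.2.2.2.2.2.2 (by
        rintro u (rfl | hu) hR
        exacts [absurd hR (F.st.apex_notMem f.2.2.2.2.1), hd u hu hR]) (by
        rintro u (rfl | hu) w hw hub hwb had
        · exact ⟨rfl, f.2.2.2.2.2.1 w hw (aR w hw had)⟩
        · obtain ⟨rfl, rfl⟩ := hc u hu w hw hub hwb had
          exact absurd had hna)
    grind

theorem rung_not_adj (F : Frame G a A B C T O) (hv : ¬ Hits G B T v i)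
    (hR : GRung G A B T i α b r R) : ∀ w ∈ R, G.Adj v w → w = α := by
  intro w hw had
  have f := hR.facts F.st
  rcases f.2.2.2.2.2.2.2.1 w hw with h | rfl | h
  exacts [h, absurd ⟨w, Or.inl f.2.1, had⟩ hv, absurd ⟨w, Or.inr h, had⟩ hv]

theorem even_tails_of_ne (F : Frame G a A B C T O) (hv : G.Adj a v) (hvS : v ∉ PSSVerts a A B C)
    {b' : V} (hij : i ≠ j) (h : Tail G B T v i b n S) (h' : Tail G B T v j b' m P) :
    Even (n + m) := by
  have f := F.tail_facts hv hvS h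
  have f' := F.tail_facts hv hvS h'
  refine F.sys.ehf.even_of_common_end h.path.symm h'.path.symm (F.st.adjB hij h.right h'.right)
    f.2.1 f'.2.1 ?_ ?_
  · intro u hu hu'
    by_contra huv
    exact hij (F.st.index i j u (f.2.2.2.2.2 u hu huv).1 (f'.2.2.2.2.2 u hu' huv).1)
  · intro u hu w hw huv hwv had
    have := (F.st.cross i j u w hij (f.2.2.2.2.2 u hu huv).1 (f'.2.2.2.2.2 w hw hwv).1).1 had
    exact ⟨f.2.2.2.1 u hu this.1, f'.2.2.2.1 w hw this.2⟩

theorem adj_A_iff (F : Frame G a A B C T O) (hv : G.Adj a v) (hvS : v ∉ PSSVerts a A B C)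
    (hρ : RungParity G A B T ρ) (h : Tail G B T v i b n S) (hj : ¬ Hits G B T v j)
    (hα : α ∈ A j) : G.Adj v α ↔ Even (n + 1 + ρ) := by
  have f := F.tail_facts hv hvS h
  have fv := F.ext_facts hv hvS
  have hij : i ≠ j := by
    rintro rfl
    exact hj (F.hits_of_tail hv hvS h)
  obtain ⟨b', r, R, hR⟩ := F.rungA j α hα
  have fR := hR.facts F.st
  have hmB := F.st.memB j b' fR.2.1
  have hP := h.path.snoc (F.st.adjB hij h.right fR.2.1) (fun hb' => by
      by_cases e : b' = v
      · exact fv.2.2 j (e ▸ hmB)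
      · exact hij (F.st.index i j b' (f.2.2.2.2.2 b' hb' e).1 hmB)) (fun w hw had => by
      by_cases e : w = v
      · subst e
        exact absurd ⟨b', Or.inl fR.2.1, had.symm⟩ hj
      · exact f.2.2.2.1 w hw
          ((F.st.cross i j w b' hij (f.2.2.2.2.2 w hw e).1 hmB).1 had.symm).1)
  rw [F.adj_iff_even hv hR hP (by omega) ?_ ?_ ?_]
  · have := hρ hR
    grind
  · rintro u (rfl | hu) huv
    · have := F.bt_facts (w := u) (i := j) (Or.inl fR.2.1)
      exact ⟨this.2.1, this.2.2.1⟩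
    · have := f.2.2.2.2.2 u hu huv
      exact ⟨this.2.1, this.2.2.1⟩
  · rintro u (rfl | hu) huR
    · rfl
    · by_cases e : u = v
      · exact absurd (e ▸ fR.2.2.2.2.1 u huR) (fv.2.2 j)
      · exact absurd (F.st.index i j u (f.2.2.2.2.2 u hu e).1 (fR.2.2.2.2.1 u huR)) hij
  · rintro u (rfl | hu) w hw hub hwb had
    · exact absurd rfl hub
    · by_cases e : u = v
      · subst e
        exact ⟨rfl, F.rung_not_adj hj hR w hw had⟩
      · have := (F.st.cross i j u w hij (f.2.2.2.2.2 u hu e).1 (fR.2.2.2.2.1 w hw)).1 had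
        exact absurd (fR.2.2.2.2.2.2.1 w hw this.2) hwb

theorem even_tails (F : Frame G a A B C T O) (hv : G.Adj a v) (hvS : v ∉ PSSVerts a A B C)
    {b' : V} (h : Tail G B T v i b n S) (h' : Tail G B T v j b' m P) : Even (n + m) := by
  by_cases hij : i = j
  · subst hij
    obtain ⟨l, hl, -⟩ := F.sys.exists_third i i
    by_cases hh : Hits G B T v l
    · obtain ⟨c, d, Q, hQ⟩ := F.exists_tail hh
      have h1 := F.even_tails_of_ne hv hvS hl hQ h
      have h2 := F.even_tails_of_ne hv hvS hl hQ h'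
      grind
    · obtain ⟨ρ, hρ⟩ := F.exists_parity
      obtain ⟨α, hα⟩ := F.sys.exists_A l
      have h1 := F.adj_A_iff hv hvS hρ h hh hα
      have h2 := F.adj_A_iff hv hvS hρ h' hh hα
      rw [h1] at h2
      grind
  · exact F.even_tails_of_ne hv hvS hij h h'

/-- A tail of the same parity as the rungs leaves at most one strip alone. -/
theorem tail_false (F : Frame G a A B C T O) (hv : G.Adj a v) (hvS : v ∉ PSSVerts a A B C)
    (hρ : RungParity G A B T ρ) (h : Tail G B T v i b n S) (hn : Even (n + ρ)) (hjl : j ≠ l)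
    (hj : ¬ Hits G B T v j) (hl : ¬ Hits G B T v l) : False := by
  have fv := F.ext_facts hv hvS
  have ex : ∀ i : {i // Hits G B T v i}, ∃ b n S, Tail G B T v i b n S := fun i => F.exists_tail i.2
  choose b' n' S' hS using ex
  have touch : ∀ i : {i // Hits G B T v i}, ∃ u ∈ S' i, u ≠ b' i ∧ ∃ w ∈ A i ∪ C i,
      u = w ∨ G.Adj u w := by
    intro i
    by_contra hc
    push Not at hc
    have f := F.tail_facts hv hvS (hS i)
    obtain ⟨α, r, R, hR⟩ := F.sys.rung_of_B (hS i).right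
    have fR := hR.facts F.sys.strips
    have key : ∀ u ∈ S' i, u ≠ b' i → ∀ w ∈ R, w ≠ b' i → u ≠ w ∧ ¬ G.Adj u w := by
      intro u hu hub w hw hwb
      refine hc u hu hub w ?_
      rcases fR.2.2.2.2.2.2.2.1 w hw with rfl | h | h
      exacts [Or.inl fR.1, absurd h hwb, Or.inr h]
    have hαb := fR.2.2.2.2.2.2.2.2.1
    refine (key v (hS i).path.left_mem f.1 α fR.2.2.1 hαb).2 ?_
    rw [F.adj_iff_even hv (hR.mono (F.sub i)) (hS i).path f.2.1
      (fun u hu huv => ⟨(f.2.2.2.2.2 u hu huv).2.1, (f.2.2.2.2.2 u hu huv).2.2.1⟩)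
      (fun u hu huR => by
        by_contra hub
        exact (key u hu hub u huR hub).1 rfl)
      (fun u hu w hw hub hwb had => absurd had (key u hu hub w hw hwb).2)]
    have h1 := F.even_tails hv hvS h (hS i)
    have h2 := hρ (hR.mono (F.sub i))
    grind
  have memR : ∀ i : {i // Hits G B T v i}, ∀ u ∈ S' i, u ≠ b' i → u = v ∨ u ∈ T i := by
    intro i u hu hub
    by_cases e : u = v
    exacts [Or.inl e, Or.inr ((F.tail_facts hv hvS (hS i)).2.2.2.2.1 u hu e hub)]
  let J : Set (Fin k) := {i | Hits G B T v i}
  let R : Set V := {w | ∃ i, w ∈ S' i ∧ w ∈ T i ∧ w ∉ C i}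
  have hR : ∀ w ∈ R, ∃ i ∈ J, w ∈ T i := by
    rintro w ⟨i, -, h1, -⟩
    exact ⟨i, i.2, h1⟩
  have hmem : ∀ i : {i // Hits G B T v i}, ∀ u ∈ S' i, u ≠ b' i →
      u ∈ mergeFam J {v} A none ∪ mergeFam J R C none := by
    intro i u hu hub
    rcases memR i u hu hub with rfl | hT
    · exact Or.inl (Or.inl rfl)
    · by_cases hC : u ∈ C i
      · exact Or.inr (Or.inr ⟨i, i.2, hC⟩)
      · exact Or.inr (Or.inl ⟨i, hu, hT, hC⟩)
  have hcon : ∀ i : {i // Hits G B T v i}, ∀ u ∈ S' i, u ≠ b' i →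
      Rch G (mergeFam J {v} A none ∪ mergeFam J R C none) u v := by
    intro i u hu hub
    obtain ⟨d, U, hU, sU, bU, -⟩ := (hS i).path.initial hu hub
    refine (hU.symm.rch v hU.left_mem).mono fun w hw => hmem i w (sU hw) ?_
    rintro rfl
    exact bU hw
  have hi₀ := F.hits_of_tail hv hvS h
  refine merge_false a F.sys.sys F.sys.indec F.sys.max J (l₁ := j) (l₂ := l) hjl hj hl {v} ∅ R
    ⟨v, by simp⟩ ?_ (by simp) ?_ (by simp) (by rintro x rfl; exact hv) ?_ ?_ ?_ ?_
  · rintro x ((rfl | hx) | ⟨i, -, h1, h2⟩)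
    exacts [hvS, hx.elim, F.notMem i x h1 h2]
  · rw [Set.disjoint_left]
    rintro x rfl hx
    obtain ⟨i, -, hT⟩ := hR x hx
    exact fv.2.2 i (F.st.memC i x hT)
  · rintro x (hx | hx)
    · exact hx.elim
    · obtain ⟨i, -, hT⟩ := hR x hx
      exact (F.bt_facts (i := i) (Or.inr hT)).2.2.1
  · intro x hx j' hj' p hp
    refine ⟨fun had => ?_, fun hx => hx.1.elim⟩
    rcases hx with (rfl | hx) | hx
    · rcases hp with (hp | hp) | hp
      · have := (F.adj_A_iff hv hvS hρ h hj' hp).1 had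
        grind
      · exact absurd ⟨p, Or.inl hp, had⟩ hj'
      · exact absurd ⟨p, Or.inr (F.sub j' hp), had⟩ hj'
    · exact hx.elim
    · obtain ⟨i, hi, hT⟩ := hR x hx
      have hij : i ≠ j' := fun e => hj' (e ▸ hi)
      have hp' : p ∈ strV A B T j' := by
        rcases hp with (hp | hp) | hp
        exacts [F.st.memA _ _ hp, F.st.memB _ _ hp, F.st.memC _ _ (F.sub j' hp)]
      exact absurd hT
        (F.st.bc i x ((F.st.cross i j' x p hij (F.st.memC i x hT) hp').1 had).1)
  · have key : ∀ i : {i // Hits G B T v i}, ∀ x ∈ S' i, ∃ α β n S, α ∈ mergeFam J {v} A none ∧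
        β ∈ mergeFam J ∅ B none ∧ IPath G α β n S ∧ x ∈ S ∧
        S ⊆ insert α (insert β (mergeFam J R C none)) := by
      intro i x hx
      refine ⟨v, b' i, n' i, S' i, Or.inl rfl, Or.inr ⟨i, i.2, (hS i).right⟩, (hS i).path, hx, ?_⟩
      intro u hu
      by_cases hub : u = b' i
      · exact Or.inr (Or.inl hub)
      · rcases memR i u hu hub with rfl | hT
        · exact Or.inl rfl
        · by_cases hC : u ∈ C i
          · exact Or.inr (Or.inr (Or.inr ⟨i, i.2, hC⟩))
          · exact Or.inr (Or.inr (Or.inl ⟨i, hu, hT, hC⟩))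
    rintro x ((rfl | hx) | ⟨i, hx, -⟩)
    exacts [key ⟨_, hi₀⟩ _ (hS ⟨_, hi₀⟩).path.left_mem, hx.elim, key i x hx]
  · refine MaxSys.rch_all (c := v) ?_
    have hAC : ∀ i ∈ J, ∀ x ∈ A i ∪ C i,
        Rch G (mergeFam J {v} A none ∪ mergeFam J R C none) x v := by
      intro i hi x hx
      have hsub : A i ∪ C i ⊆ mergeFam J {v} A none ∪ mergeFam J R C none := by
        rintro u (hu | hu)
        exacts [Or.inl (Or.inr ⟨i, hi, hu⟩), Or.inr (Or.inr ⟨i, hi, hu⟩)]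
      obtain ⟨u, hu, hub, w, hw, huw⟩ := touch ⟨i, hi⟩
      have h1 := (F.sys.conn i x hx w hw).mono hsub
      rcases huw with rfl | huw
      · exact h1.trans (hcon _ u hu hub)
      · exact h1.trans ((Rch.step huw.symm (hmem _ u hu hub)).trans (hcon _ u hu hub))
    rintro x ((rfl | ⟨i, hi, hx⟩) | ⟨i, hx, hT, -⟩ | ⟨i, hi, hx⟩)
    · exact .refl
    · exact hAC i hi x (Or.inl hx)
    · refine hcon i x hx ?_
      rintro rfl
      exact F.st.bc _ _ (hS i).right hT
    · exact hAC i hi x (Or.inr hx)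

end Frame
end Tails

section Quills

variable {V : Type*} {G : SimpleGraph V} {a : V} {k : ℕ} {A B C T : Fin k → Set V} {O : Set V}

/-- `S` is the vertex set of a path with `m` edges from `v` through `O` to `q`, and `q` is the only
vertex of the path with neighbours in the sets `B i`. -/
structure Quill (G : SimpleGraph V) {k : ℕ} (B : Fin k → Set V) (O : Set V) (v q : V) (m : ℕ)
    (S : Set V) : Prop where
  path : IPath G v q m S
  sub : S ⊆ insert v O
  ne : q ≠ v
  only : ∀ u ∈ S, ∀ i, ∀ b ∈ B i, G.Adj u b → u = q
  ex : ∃ i, ∃ b ∈ B i, G.Adj q b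

namespace Frame

variable {i j l : Fin k} {v α b q x c b' : V} {n m r ρ : ℕ} {P R S : Set V}

theorem exists_strip_path (F : Frame G a A B C T O) (hα : α ∈ A j) (hvα : G.Adj v α)
    (hb : b ∈ B j) : ∃ t S, IPath G v b t S ∧ S ⊆ {v, b} ∪ (A j ∪ T j) := by
  obtain ⟨β, r, R, hR⟩ := F.rungB j b hb
  have f := hR.facts F.st
  have h1 : Rch G (insert b (A j ∪ T j)) v b := by
    refine ((Rch.step hvα (Or.inr (Or.inl hα))).trans ((F.conn j α (Or.inl hα) β
      (Or.inl f.1)).mono (Set.subset_insert _ _))).trans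
      ((hR.path.rch b f.2.2.2.1).mono fun w hw => ?_)
    rcases f.2.2.2.2.2.2.2.1 w hw with rfl | rfl | h
    exacts [Or.inr (Or.inl f.1), Or.inl rfl, Or.inr (Or.inr h)]
  obtain ⟨t, S, hS, sS⟩ := h1.exists_path
  refine ⟨t, S, hS, fun w hw => ?_⟩
  rcases sS hw with rfl | rfl | h
  exacts [Or.inl (Or.inl rfl), Or.inl (Or.inr rfl), Or.inr h]

theorem rung_path (F : Frame G a A B C T O) (hv : G.Adj a v) (hvS : v ∉ PSSVerts a A B C)
    (hl : ¬ Hits G B T v l) (hR : GRung G A B T l α c r R) (hvα : G.Adj v α) (hjl : j ≠ l)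
    (hb : b ∈ B j) (hvb : ¬ G.Adj v b) : IPath G v b (r + 2) (insert v (insert b R)) := by
  have f := hR.facts F.st
  have fv := F.ext_facts hv hvS
  have hbR : b ∉ R := fun h => hjl (F.st.index j l b (F.st.memB j b hb) (f.2.2.2.2.1 b h))
  have p1 := hR.path.snoc (F.st.adjB hjl.symm f.2.1 hb) hbR (fun w hw had =>
    f.2.2.2.2.2.2.1 w hw
      ((F.st.cross j l b w hjl (F.st.memB j b hb) (f.2.2.2.2.1 w hw)).1 had).2)
  refine p1.cons hvα ?_ ?_
  · rintro (rfl | h)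
    exacts [fv.2.2 j (F.st.memB j _ hb), fv.2.2 l (f.2.2.2.2.1 _ h)]
  · rintro w (rfl | h) had
    exacts [absurd had hvb, F.rung_not_adj hl hR w h had]

theorem far_strips (F : Frame G a A B C T O) (hij : i ≠ j) :
    Far G (A i ∪ T i) (strV A B T j) := by
  intro x hx y hy
  have hx' : x ∈ strV A B T i := hx.elim (F.st.memA i x) (F.st.memC i x)
  refine ⟨fun e => hij (F.st.index i j x hx' (e ▸ hy)), fun had => ?_⟩
  have := ((F.st.cross i j x y hij hx' hy).1 had).1
  exact hx.elim (fun h => F.st.ab i x h this) (fun h => F.st.bc i x this h)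

theorem far_out (F : Frame G a A B C T O) : Far G (A i ∪ T i) O := by
  intro x hx y hy
  refine ⟨?_, fun had => F.far y hy i x hx had.symm⟩
  rintro rfl
  exact (F.out x hy).2.2 i (hx.elim (F.st.memA i x) (F.st.memC i x))

theorem out_path_adj_iff (F : Frame G a A B C T O) (hv : G.Adj a v) (hvS : v ∉ PSSVerts a A B C)
    (hi : ¬ Hits G B T v i) (hR : GRung G A B T i α b r R) (hP : IPath G v b n P)
    (hsub : ∀ u ∈ P, u = v ∨ u = b ∨ u ∈ O ∨ ∃ j, j ≠ i ∧ u ∈ B j) :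
    G.Adj v α ↔ Even (n + r) := by
  have f := hR.facts F.st
  have fv := F.ext_facts hv hvS
  have hn : 1 ≤ n := by
    rcases Nat.eq_zero_or_pos n with h0 | h0
    · exact absurd (F.st.memB i b f.2.1) ((hP.zero_iff.1 h0) ▸ fv.2.2 i)
    · exact h0
  refine F.adj_iff_even hv hR hP hn ?_ ?_ ?_
  · intro u hu huv
    rcases hsub u hu with h | rfl | h | ⟨j, -, h⟩
    · exact absurd h huv
    · have := F.bt_facts (w := u) (i := i) (Or.inl f.2.1)
      exact ⟨this.2.1, this.2.2.1⟩
    · exact ⟨(F.out u h).1, (F.out u h).2.1⟩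
    · have := F.bt_facts (w := u) (i := j) (Or.inl h)
      exact ⟨this.2.1, this.2.2.1⟩
  · intro u hu huR
    rcases hsub u hu with rfl | rfl | h | ⟨j, hj, h⟩
    · exact absurd (f.2.2.2.2.1 u huR) (fv.2.2 i)
    · rfl
    · exact absurd (f.2.2.2.2.1 u huR) ((F.out u h).2.2 i)
    · exact absurd (F.st.index j i u (F.st.memB j u h) (f.2.2.2.2.1 u huR)) hj
  · intro u hu w hw hub hwb had
    rcases hsub u hu with rfl | h | h | ⟨j, hj, h⟩
    · exact ⟨rfl, F.rung_not_adj hi hR w hw had⟩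
    · exact absurd h hub
    · rcases f.2.2.2.2.2.2.2.1 w hw with rfl | h' | h'
      exacts [absurd had (F.far u h i w (Or.inl f.1)), absurd h' hwb,
        absurd had (F.far u h i w (Or.inr h'))]
    · have := ((F.st.cross j i u w hj (F.st.memB j u h) (f.2.2.2.2.1 w hw)).1 had).2
      exact absurd (f.2.2.2.2.2.2.1 w hw this) hwb

theorem quill_notMem (F : Frame G a A B C T O) (hv : G.Adj a v) (hvS : v ∉ PSSVerts a A B C)
    (h : Quill G B O v q m S) (hb : b ∈ B i) : b ∉ S := by
  intro hbS
  rcases h.sub hbS with rfl | hO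
  exacts [(F.ext_facts hv hvS).2.2 i (F.st.memB i _ hb), (F.out b hO).2.2 i (F.st.memB i _ hb)]

theorem quill_path (F : Frame G a A B C T O) (hv : G.Adj a v) (hvS : v ∉ PSSVerts a A B C)
    (h : Quill G B O v q m S) (hb : b ∈ B i) (hqb : G.Adj q b) :
    IPath G v b (m + 1) (insert b S) :=
  h.path.snoc hqb (F.quill_notMem hv hvS h hb) fun w hw had => h.only w hw i b hb had.symm

theorem quill_path_cross (F : Frame G a A B C T O) (hv : G.Adj a v) (hvS : v ∉ PSSVerts a A B C)
    (h : Quill G B O v q m S) (hij : i ≠ j) (hx : x ∈ B i) (hqx : G.Adj q x) (hb : b ∈ B j)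
    (hqb : ¬ G.Adj q b) : IPath G v b (m + 2) (insert b (insert x S)) := by
  refine (F.quill_path hv hvS h hx hqx).snoc (F.st.adjB hij hx hb) ?_ ?_
  · rintro (rfl | hbS)
    exacts [hqb hqx, F.quill_notMem hv hvS h hb hbS]
  · rintro w (rfl | hw) had
    · rfl
    · have := h.only w hw j b hb had.symm
      subst this
      exact absurd had.symm hqb

theorem quill_adj_iff (F : Frame G a A B C T O) (hv : G.Adj a v) (hvS : v ∉ PSSVerts a A B C)
    (hi : ¬ Hits G B T v i) (h : Quill G B O v q m S) (hR : GRung G A B T i α b r R)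
    (hqb : G.Adj q b) : G.Adj v α ↔ Even (m + 1 + r) := by
  refine F.out_path_adj_iff hv hvS hi hR (F.quill_path hv hvS h (hR.facts F.st).2.1 hqb) ?_
  rintro u (rfl | hu)
  · exact Or.inr (Or.inl rfl)
  · rcases h.sub hu with h | h
    exacts [Or.inl h, Or.inr (Or.inr (Or.inl h))]

theorem quill_adj_iff_cross (F : Frame G a A B C T O) (hv : G.Adj a v)
    (hvS : v ∉ PSSVerts a A B C) (hi : ¬ Hits G B T v i) (h : Quill G B O v q m S)
    (hR : GRung G A B T i α b r R) (hqb : ¬ G.Adj q b) (hij : j ≠ i) (hx : x ∈ B j)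
    (hqx : G.Adj q x) : G.Adj v α ↔ Even (m + 2 + r) := by
  refine F.out_path_adj_iff hv hvS hi hR
    (F.quill_path_cross hv hvS h hij hx hqx (hR.facts F.st).2.1 hqb) ?_
  rintro u (rfl | rfl | hu)
  · exact Or.inr (Or.inl rfl)
  · exact Or.inr (Or.inr (Or.inr ⟨j, hij, hx⟩))
  · rcases h.sub hu with h | h
    exacts [Or.inl h, Or.inr (Or.inr (Or.inl h))]

theorem quill_mixed_odd (F : Frame G a A B C T O) (hv : G.Adj a v) (hvS : v ∉ PSSVerts a A B C)
    (hρ : RungParity G A B T ρ) (hH : ∀ i, ¬ Hits G B T v i) (h : Quill G B O v q m S)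
    (hm : Odd (m + 1 + ρ)) (hb : b ∈ B j) (hqb : G.Adj q b) (hb' : b' ∈ B j)
    (hqb' : ¬ G.Adj q b') (hij : i ≠ j) (hx : x ∈ B i) (hqx : G.Adj q x) (hlj : j ≠ l)
    (hc : c ∈ B l) (hqc : ¬ G.Adj q c) : False := by
  have fv := F.ext_facts hv hvS
  have hvb : ¬ G.Adj v b := fun had => hH j ⟨b, Or.inl hb, had⟩
  have nvb : v ≠ b := fun e => fv.2.2 j (e ▸ F.st.memB j b hb)
  obtain ⟨α, r, R, hR⟩ := F.rungB j b' hb'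
  obtain ⟨β, s, U, hU⟩ := F.rungB l c hc
  have e1 := hρ hR
  have e2 := hρ hU
  have hvα : G.Adj v α := by
    rw [F.quill_adj_iff_cross hv hvS (hH j) h hR hqb' hij hx hqx]
    grind
  have hvβ : G.Adj v β := by
    rw [F.quill_adj_iff_cross hv hvS (hH l) h hU hqc hlj hb hqb]
    grind
  obtain ⟨t, S', hS', sS'⟩ := F.exists_strip_path (hR.facts F.st).1 hvα hb
  have o1 := F.sys.ehf.odd_of_far hS' (F.quill_path hv hvS h hb hqb) nvb hvb sS'
    (Y := O) (by
      rintro u (rfl | hu)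
      · exact Or.inl (Or.inr rfl)
      · rcases h.sub hu with rfl | h
        exacts [Or.inl (Or.inl rfl), Or.inr h]) F.far_out
  have o2 := F.sys.ehf.odd_of_far hS' (F.rung_path hv hvS (hH l) hU hvβ hlj hb hvb) nvb hvb sS'
    (Y := strV A B T l) (by
      rintro u (rfl | rfl | hu)
      exacts [Or.inl (Or.inl rfl), Or.inl (Or.inr rfl),
        Or.inr ((hU.facts F.st).2.2.2.2.1 u hu)]) (F.far_strips hlj)
  grind

theorem quill_mixed_even (F : Frame G a A B C T O) (hv : G.Adj a v) (hvS : v ∉ PSSVerts a A B C)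
    (hρ : RungParity G A B T ρ) (hH : ∀ i, ¬ Hits G B T v i) (h : Quill G B O v q m S)
    (hm : Even (m + 1 + ρ)) (hb : b ∈ B j) (hqb : G.Adj q b) (hb' : b' ∈ B j)
    (hqb' : ¬ G.Adj q b') (hlj : j ≠ l) (hc : c ∈ B l) (hqc : G.Adj q c) : False := by
  have fv := F.ext_facts hv hvS
  have hvb : ¬ G.Adj v b' := fun had => hH j ⟨b', Or.inl hb', had⟩
  have nvb : v ≠ b' := fun e => fv.2.2 j (e ▸ F.st.memB j b' hb')
  obtain ⟨α, r, R, hR⟩ := F.rungB j b hb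
  obtain ⟨β, s, U, hU⟩ := F.rungB l c hc
  have e1 := hρ hR
  have e2 := hρ hU
  have hvα : G.Adj v α := by
    rw [F.quill_adj_iff hv hvS (hH j) h hR hqb]
    grind
  have hvβ : G.Adj v β := by
    rw [F.quill_adj_iff hv hvS (hH l) h hU hqc]
    grind
  obtain ⟨t, S', hS', sS'⟩ := F.exists_strip_path (hR.facts F.st).1 hvα hb'
  have o1 := F.sys.ehf.odd_of_far hS' (F.quill_path_cross hv hvS h hlj.symm hc hqc hb' hqb')
    nvb hvb sS' (Y := strV A B T l ∪ O) (by
      rintro u (rfl | rfl | hu)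
      · exact Or.inl (Or.inr rfl)
      · exact Or.inr (Or.inl (F.st.memB l _ hc))
      · rcases h.sub hu with rfl | h
        exacts [Or.inl (Or.inl rfl), Or.inr (Or.inr h)])
    (fun x hx y hy => hy.elim (F.far_strips hlj x hx y) (F.far_out x hx y))
  have o2 := F.sys.ehf.odd_of_far hS' (F.rung_path hv hvS (hH l) hU hvβ hlj hb' hvb) nvb hvb sS'
    (Y := strV A B T l) (by
      rintro u (rfl | rfl | hu)
      exacts [Or.inl (Or.inl rfl), Or.inl (Or.inr rfl),
        Or.inr ((hU.facts F.st).2.2.2.2.1 u hu)]) (F.far_strips hlj)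
  grind

/-- If the quill attaches uniformly to two strips, it can be merged with the other strips. -/
theorem quill_merge_false (F : Frame G a A B C T O) (hv : G.Adj a v) (hvS : v ∉ PSSVerts a A B C)
    (hH : ∀ i, ¬ Hits G B T v i) (h : Quill G B O v q m S) (J : Set (Fin k)) (p : Prop)
    {l₁ l₂ : Fin k} (hl : l₁ ≠ l₂) (hl₁ : l₁ ∉ J) (hl₂ : l₂ ∉ J)
    (hJA : ∀ j ∉ J, ∀ x ∈ A j, ¬ G.Adj v x) (hJB : ∀ j ∉ J, ∀ x ∈ B j, G.Adj q x ↔ p)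
    (hr : ¬ p → ∃ i ∈ J, ∃ b ∈ B i, G.Adj q b) (hJ : ∀ j ∈ J, ∃ α ∈ A j, G.Adj v α) : False := by
  have fv := F.ext_facts hv hvS
  have hqS := h.path.right_mem
  have hO : ∀ x ∈ S, x ≠ v → x ∈ O := fun x hx hxv => (h.sub hx).resolve_left hxv
  have hqO := hO q hqS h.ne
  have key : ∀ x ∈ ({v} : Set V) ∪ {x | x = q ∧ p} ∪ {x | x ∈ S ∧ x ≠ v ∧ ¬ (x = q ∧ p)},
      x ∈ S := by
    rintro x ((rfl | ⟨rfl, -⟩) | hx)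
    exacts [h.path.left_mem, hqS, hx.1]
  have keyO : ∀ x ∈ ({x | x = q ∧ p} : Set V) ∪ {x | x ∈ S ∧ x ≠ v ∧ ¬ (x = q ∧ p)}, x ∈ O := by
    rintro x (⟨rfl, -⟩ | hx)
    exacts [hqO, hO x hx.1 hx.2.1]
  refine merge_false a F.sys.sys F.sys.indec F.sys.max J hl hl₁ hl₂ {v} {x | x = q ∧ p}
    {x | x ∈ S ∧ x ≠ v ∧ ¬ (x = q ∧ p)} ⟨v, by simp⟩ ?_ ?_ ?_ ?_ (by rintro x rfl; exact hv)
    (fun x hx => (F.out x (keyO x hx)).2.1) ?_ ?_ ?_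
  · rintro x ((rfl | hx) | hx)
    exacts [hvS, F.out_notMem x (keyO x (Or.inl hx)), F.out_notMem x (keyO x (Or.inr hx))]
  · rw [Set.disjoint_left]
    rintro x rfl ⟨h1, -⟩
    exact h.ne h1.symm
  · rw [Set.disjoint_left]
    rintro x rfl hx
    exact hx.2.1 rfl
  · rw [Set.disjoint_left]
    rintro x hx hx'
    exact hx'.2.2 hx
  · intro x hx j hj y hy
    by_cases hxv : x = v
    · subst hxv
      refine ⟨fun had => ?_, fun hx => absurd hx.1.1.symm h.ne⟩
      rcases hy with (hy | hy) | hy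
      exacts [absurd had (hJA j hj y hy), absurd ⟨y, Or.inl hy, had⟩ (hH j),
        absurd ⟨y, Or.inr (F.sub j hy), had⟩ (hH j)]
    · have hxS := key x hx
      have hxO := hO x hxS hxv
      constructor
      · intro had
        rcases hy with (hy | hy) | hy
        · exact absurd had (F.far x hxO j y (Or.inl hy))
        · have := h.only x hxS j y hy had
          subst this
          exact ⟨⟨rfl, (hJB j hj y hy).1 had⟩, hy⟩
        · exact absurd had (F.far x hxO j y (Or.inr (F.sub j hy)))
      · rintro ⟨⟨rfl, hp⟩, hy⟩
        exact (hJB j hj y hy).2 hp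
  · intro x hx
    have hxS := key x hx
    by_cases hp : p
    · refine ⟨v, q, m, S, Or.inl rfl, Or.inl ⟨rfl, hp⟩, h.path, hxS, fun u hu => ?_⟩
      by_cases h1 : u = v
      · exact Or.inl h1
      by_cases h2 : u = q
      · exact Or.inr (Or.inl h2)
      exact Or.inr (Or.inr (Or.inl ⟨hu, h1, fun h => h2 h.1⟩))
    · obtain ⟨i, hi, b, hb, hqb⟩ := hr hp
      refine ⟨v, b, m + 1, insert b S, Or.inl rfl, Or.inr ⟨i, hi, hb⟩,
        F.quill_path hv hvS h hb hqb, Or.inr hxS, ?_⟩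
      rintro u (rfl | hu)
      · exact Or.inr (Or.inl rfl)
      by_cases h1 : u = v
      · exact Or.inl h1
      exact Or.inr (Or.inr (Or.inl ⟨hu, h1, fun h => hp h.2⟩))
  · refine MaxSys.rch_all (c := v) ?_
    have hAC : ∀ i ∈ J, ∀ x ∈ A i ∪ C i, Rch G (mergeFam J {v} A none ∪
        mergeFam J {x | x ∈ S ∧ x ≠ v ∧ ¬ (x = q ∧ p)} C none) x v := by
      intro i hi x hx
      obtain ⟨α, hα, hvα⟩ := hJ i hi
      refine ((F.sys.conn i x hx α (Or.inl hα)).mono ?_).trans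
        (.step hvα.symm (Or.inl (Or.inl rfl)))
      rintro u (hu | hu)
      exacts [Or.inl (Or.inr ⟨i, hi, hu⟩), Or.inr (Or.inr ⟨i, hi, hu⟩)]
    rintro x ((rfl | ⟨i, hi, hx⟩) | hx | ⟨i, hi, hx⟩)
    · exact .refl
    · exact hAC i hi x (Or.inl hx)
    · have main : ∀ d U, IPath G v x d U → U ⊆ S → (p → q ∉ U ) →
          Rch G (mergeFam J {v} A none ∪
            mergeFam J {x | x ∈ S ∧ x ≠ v ∧ ¬ (x = q ∧ p)} C none) x v := by
        intro d U hU sU hq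
        refine (hU.symm.rch v hU.left_mem).mono fun u hu => ?_
        by_cases huv : u = v
        · exact Or.inl (Or.inl huv)
        · exact Or.inr (Or.inl ⟨sU hu, huv, fun h => hq h.2 (h.1 ▸ hu)⟩)
      by_cases hxq : x = q
      · subst hxq
        exact main m S h.path subset_rfl fun hp => absurd ⟨rfl, hp⟩ hx.2.2
      · obtain ⟨d, U, hU, sU, bU, -⟩ := h.path.initial hx.1 hxq
        exact main d U hU sU fun _ => bU
    · exact hAC i hi x (Or.inr hx)

/-- A neighbour of the apex that hits no strip is complete to all but one of the sets `A i`. -/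
theorem quill_uniform (F : Frame G a A B C T O) (hv : G.Adj a v) (hvS : v ∉ PSSVerts a A B C)
    (hρ : RungParity G A B T ρ) (hH : ∀ i, ¬ Hits G B T v i) (h : Quill G B O v q m S) :
    ∃ i, (∀ j, j ≠ i → ∀ x ∈ A j, G.Adj v x) ∧
      (((∀ j, j ≠ i → ∀ b ∈ B j, ¬ G.Adj q b) ∧ Odd (m + 1 + ρ)) ∨
        ((∀ j, j ≠ i → ∀ b ∈ B j, G.Adj q b) ∧ Even (m + 1 + ρ))) := by
  have two : ∀ J : Set (Fin k), (∀ l₁ l₂, l₁ ≠ l₂ → l₁ ∉ J → l₂ ∉ J → False) →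
      ∀ j, ∃ l, j ≠ l ∧ l ∈ J := by
    intro J hJ j
    obtain ⟨l, hl, -⟩ := F.sys.exists_third j j
    obtain ⟨l', hl', hll⟩ := F.sys.exists_third j l
    by_cases h1 : l ∈ J
    · exact ⟨l, hl.symm, h1⟩
    by_cases h2 : l' ∈ J
    · exact ⟨l', hl'.symm, h2⟩
    exact (hJ l l' hll.symm h1 h2).elim
  obtain ⟨i, x, hx, hqx⟩ := h.ex
  rcases Nat.even_or_odd (m + 1 + ρ) with hm | hm
  · have h2 : ∀ l₁ l₂, l₁ ≠ l₂ → l₁ ∉ {j | ∃ b ∈ B j, G.Adj q b} →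
        l₂ ∉ {j | ∃ b ∈ B j, G.Adj q b} → False := by
      intro l₁ l₂ hl h1 h2
      refine F.quill_merge_false hv hvS hH h {j | ∃ b ∈ B j, G.Adj q b} False hl h1 h2 ?_
        (fun j hj y hy => iff_false_intro fun had => hj ⟨y, hy, had⟩)
        (fun _ => ⟨i, ⟨x, hx, hqx⟩, x, hx, hqx⟩) ?_
      · intro j hj y hy
        obtain ⟨b, r, R, hR⟩ := F.rungA j y hy
        rw [F.quill_adj_iff_cross hv hvS (hH j) h hR (fun had => hj ⟨b, hR.right, had⟩)
          (fun e => hj ⟨x, e ▸ hx, hqx⟩) hx hqx]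
        have := hρ hR
        grind
      · rintro j ⟨b, hb, hqb⟩
        obtain ⟨α, r, R, hR⟩ := F.rungB j b hb
        refine ⟨α, (hR.facts F.st).1, ?_⟩
        rw [F.quill_adj_iff hv hvS (hH j) h hR hqb]
        have := hρ hR
        grind
    have comp : ∀ j ∈ {j | ∃ b ∈ B j, G.Adj q b}, ∀ b ∈ B j, G.Adj q b := by
      rintro j ⟨b, hb, hqb⟩ b' hb'
      by_contra hqb'
      obtain ⟨l, hjl, c, hc, hqc⟩ := two _ h2 j
      exact F.quill_mixed_even hv hvS hρ hH h hm hb hqb hb' hqb' hjl hc hqc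
    have compA : ∀ j ∈ {j | ∃ b ∈ B j, G.Adj q b}, ∀ y ∈ A j, G.Adj v y := by
      intro j hj y hy
      obtain ⟨b, r, R, hR⟩ := F.rungA j y hy
      rw [F.quill_adj_iff hv hvS (hH j) h hR (comp j hj b hR.right)]
      have := hρ hR
      grind
    by_cases hall : ∃ i, i ∉ {j | ∃ b ∈ B j, G.Adj q b}
    · obtain ⟨i, hi⟩ := hall
      have hj : ∀ j, j ≠ i → j ∈ {j | ∃ b ∈ B j, G.Adj q b} := by
        intro j hj
        by_contra hc
        exact h2 j i hj hc hi
      exact ⟨i, fun j hji => compA j (hj j hji), Or.inr ⟨fun j hji => comp j (hj j hji), hm⟩⟩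
    · push Not at hall
      exact ⟨i, fun j _ => compA j (hall j), Or.inr ⟨fun j _ => comp j (hall j), hm⟩⟩
  · by_cases hone : ∀ j, j ≠ i → ∀ b ∈ B j, ¬ G.Adj q b
    · refine ⟨i, fun j hj y hy => ?_, Or.inl ⟨hone, hm⟩⟩
      obtain ⟨b, r, R, hR⟩ := F.rungA j y hy
      rw [F.quill_adj_iff_cross hv hvS (hH j) h hR (hone j hj b hR.right) hj.symm hx hqx]
      have := hρ hR
      grind
    · exfalso
      push Not at hone
      obtain ⟨i', hii, x', hx', hqx'⟩ := hone
      have oth : ∀ j, ∃ l, l ≠ j ∧ ∃ y ∈ B l, G.Adj q y := by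
        intro j
        by_cases e : i = j
        · exact ⟨i', e ▸ hii, x', hx', hqx'⟩
        · exact ⟨i, e, x, hx, hqx⟩
      have h2 : ∀ l₁ l₂, l₁ ≠ l₂ → l₁ ∉ {j | ∃ b ∈ B j, ¬ G.Adj q b} →
          l₂ ∉ {j | ∃ b ∈ B j, ¬ G.Adj q b} → False := by
        intro l₁ l₂ hl h1 h2
        have hc : ∀ j ∉ {j | ∃ b ∈ B j, ¬ G.Adj q b}, ∀ y ∈ B j, G.Adj q y := by
          intro j hj y hy
          by_contra hn
          exact hj ⟨y, hy, hn⟩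
        refine F.quill_merge_false hv hvS hH h {j | ∃ b ∈ B j, ¬ G.Adj q b} True hl h1 h2 ?_
          (fun j hj y hy => iff_true_intro (hc j hj y hy)) (fun h => absurd trivial h) ?_
        · intro j hj y hy
          obtain ⟨b, r, R, hR⟩ := F.rungA j y hy
          rw [F.quill_adj_iff hv hvS (hH j) h hR (hc j hj b hR.right)]
          have := hρ hR
          grind
        · rintro j ⟨b, hb, hqb⟩
          obtain ⟨α, r, R, hR⟩ := F.rungB j b hb
          obtain ⟨l, hlj, y, hy, hqy⟩ := oth j
          refine ⟨α, (hR.facts F.st).1, ?_⟩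
          rw [F.quill_adj_iff_cross hv hvS (hH j) h hR hqb hlj hy hqy]
          have := hρ hR
          grind
      have fin : ∀ j ∈ {j | ∃ b ∈ B j, ¬ G.Adj q b}, ∀ y ∈ B j, G.Adj q y → False := by
        rintro j ⟨b', hb', hqb'⟩ y hy hqy
        obtain ⟨l, hlj, z, hz, hqz⟩ := oth j
        obtain ⟨l', hjl, c, hc, hqc⟩ := two _ h2 j
        exact F.quill_mixed_odd hv hvS hρ hH h hm hy hqy hb' hqb' hlj hz hqz hjl hc hqc
      exact h2 i i' hii.symm (fun hi => fin i hi x hx hqx) (fun hi => fin i' hi x' hx' hqx')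

end Frame
end Quills

section Types

variable {V : Type*} {G : SimpleGraph V} {a : V} {k : ℕ} {A B C T : Fin k → Set V} {O : Set V}

theorem Splendid.short_pyramid_false (hs : Splendid G a) {b₁ b₂ b₃ : V} {n m : ℕ}
    {S₁ S₂ S₃ : Set V} (h₁ : IPath G a b₁ 1 S₁) (h₂ : IPath G a b₂ n S₂) (h₃ : IPath G a b₃ m S₃)
    (hn : 2 ≤ n) (hm : 2 ≤ m) (h12 : G.Adj b₁ b₂) (h13 : G.Adj b₁ b₃) (h23 : G.Adj b₂ b₃)
    (d12 : ∀ u ∈ S₁, u ∈ S₂ → u = a) (d13 : ∀ u ∈ S₁, u ∈ S₃ → u = a)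
    (d23 : ∀ u ∈ S₂, u ∈ S₃ → u = a)
    (c12 : ∀ u ∈ S₁, ∀ w ∈ S₂, u ≠ a → w ≠ a → G.Adj u w → u = b₁ ∧ w = b₂)
    (c13 : ∀ u ∈ S₁, ∀ w ∈ S₃, u ≠ a → w ≠ a → G.Adj u w → u = b₁ ∧ w = b₃)
    (c23 : ∀ u ∈ S₂, ∀ w ∈ S₃, u ≠ a → w ≠ a → G.Adj u w → u = b₂ ∧ w = b₃) : False := by
  have ne : ∀ {b n S}, IPath G a b n S → 1 ≤ n → a ≠ b := fun h hn e => by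
    have := h.zero_iff.2 e
    omega
  obtain ⟨p₁, hp₁, l₁, m₁, i₁⟩ := h₁.walk
  obtain ⟨p₂, hp₂, l₂, m₂, i₂⟩ := h₂.walk
  obtain ⟨p₃, hp₃, l₃, m₃, i₃⟩ := h₃.walk
  refine hs.2.2 ⟨b₁, b₂, b₃, p₁, p₂, p₃, ⟨h12, h13, h23, ne h₁ le_rfl, ne h₂ (by omega),
    ne h₃ (by omega), hp₁, hp₂, hp₃, ?_, ?_, ?_, Or.inr (Or.inr ⟨by omega, by omega⟩), ?_⟩,
    Or.inl l₁⟩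
  · exact fun v h h' => d12 v ((m₁ v).1 h) ((m₂ v).1 h')
  · exact fun v h h' => d13 v ((m₁ v).1 h) ((m₃ v).1 h')
  · exact fun v h h' => d23 v ((m₂ v).1 h) ((m₃ v).1 h')
  · have key : ∀ {c d n m S S'} {p : G.Walk a c} {p' : G.Walk a d}, IPath G a c n S →
        IPath G a d m S' → (∀ v, v ∈ p.support ↔ v ∈ S) → (∀ v, v ∈ p'.support ↔ v ∈ S') →
        InducedWalk G p → InducedWalk G p' →
        (∀ u ∈ S, ∀ w ∈ S', u ≠ a → w ≠ a → G.Adj u w → u = c ∧ w = d) →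
        ∀ u w, u ∈ p.support → w ∈ p'.support → G.Adj u w →
          s(u, w) ∈ p.edges ∨ s(u, w) ∈ p'.edges ∨ s(u, w) = s(c, d) := by
      intro c d n m S S' p p' h h' hm hm' hi hi' hc u w hu hw had
      by_cases hua : u = a
      · subst hua
        exact Or.inr (Or.inl (hi' u w ((hm' u).2 h'.left_mem) hw had))
      by_cases hwa : w = a
      · subst hwa
        exact Or.inl (hi u w hu ((hm w).2 h.left_mem) had)
      obtain ⟨rfl, rfl⟩ := hc u ((hm u).1 hu) w ((hm' w).1 hw) hua hwa had
      exact Or.inr (Or.inr rfl)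
    rintro u w (hu | hu | hu) (hw | hw | hw) had
    · exact Or.inl (i₁ u w hu hw had)
    · have := key h₁ h₂ m₁ m₂ i₁ i₂ c12 u w hu hw had
      tauto
    · have := key h₁ h₃ m₁ m₃ i₁ i₃ c13 u w hu hw had
      tauto
    · have := key h₁ h₂ m₁ m₂ i₁ i₂ c12 w u hw hu had.symm
      rw [Sym2.eq_swap]
      tauto
    · exact Or.inr (Or.inl (i₂ u w hu hw had))
    · have := key h₂ h₃ m₂ m₃ i₂ i₃ c23 u w hu hw had
      tauto
    · have := key h₁ h₃ m₁ m₃ i₁ i₃ c13 w u hw hu had.symm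
      rw [Sym2.eq_swap]
      tauto
    · have := key h₂ h₃ m₂ m₃ i₂ i₃ c23 w u hw hu had.symm
      rw [Sym2.eq_swap]
      tauto
    · exact Or.inr (Or.inr (Or.inl (i₃ u w hu hw had)))

/-- `v` has no neighbours in `A l ∪ T l`. -/
def Misses (G : SimpleGraph V) {k : ℕ} (A T : Fin k → Set V) (v : V) (l : Fin k) : Prop :=
  ∀ w ∈ A l ∪ T l, ¬ G.Adj v w

namespace Frame

variable {i j l : Fin k} {v α b q x c b' α' : V} {n m r ρ : ℕ} {P R S R' : Set V}

theorem short_pyramid_false (F : Frame G a A B C T O) (hv : G.Adj a v)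
    (hvS : v ∉ PSSVerts a A B C) (hij : i ≠ j) (hR : GRung G A B T i α b r R)
    (hR' : GRung G A B T j α' b' n R') (hb : G.Adj v b) (hb' : G.Adj v b')
    (hu : ∀ w ∈ R, G.Adj v w → w = b) (hu' : ∀ w ∈ R', G.Adj v w → w = b') : False := by
  have f := hR.facts F.st
  have f' := hR'.facts F.st
  have fv := F.ext_facts hv hvS
  have aR : ∀ {i α b r R}, GRung G A B T i α b r R → IPath G a b (r + 1) (insert a R) :=
    fun h => h.path.cons (F.st.adjA h.left) (F.st.apex_notMem (h.facts F.st).2.2.2.2.1)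
      (fun w hw had => (h.facts F.st).2.2.2.2.2.1 w hw
        (F.st.apex_edge (h.facts F.st).2.2.2.2.1 w hw had))
  have vR : ∀ {i α b r R}, GRung G A B T i α b r R → v ∉ R := fun h hw =>
    fv.2.2 _ ((h.facts F.st).2.2.2.2.1 v hw)
  have hav : IPath G a v 1 (insert a {v}) := (IPath.single v).cons hv (fun h => fv.1 h.symm)
    (fun w hw _ => hw)
  refine F.sys.splendid.short_pyramid_false hav (aR hR) (aR hR')
    (by have := f.2.2.2.2.2.2.2.2.2; omega) (by have := f'.2.2.2.2.2.2.2.2.2; omega) hb hb'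
    (F.st.adjB hij f.2.1 f'.2.1) ?_ ?_ ?_ ?_ ?_ ?_
  · rintro u (e | rfl) (e' | h)
    exacts [e, e, e', absurd h (vR hR)]
  · rintro u (e | rfl) (e' | h)
    exacts [e, e, e', absurd h (vR hR')]
  · rintro u (e | h) (e' | h')
    exacts [e, e, e', absurd h' (F.st.disj hij f.2.2.2.2.1 f'.2.2.2.2.1 u h)]
  · rintro u (rfl | rfl) w (rfl | h) h1 h2 had
    exacts [absurd rfl h1, absurd rfl h1, absurd rfl h2, ⟨rfl, hu w h had⟩]
  · rintro u (rfl | rfl) w (rfl | h) h1 h2 had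
    exacts [absurd rfl h1, absurd rfl h1, absurd rfl h2, ⟨rfl, hu' w h had⟩]
  · rintro u (rfl | h) w (rfl | h') h1 h2 had
    exacts [absurd rfl h1, absurd rfl h1, absurd rfl h2, hR.adj F.st hR' hij u h w h' had]

theorem quill_of_path (hH : ∀ i, ¬ Hits G B T v i)
    (hP : IPath G v q m P) (hsub : P ⊆ insert v O) (hx : x ∈ P) (hb : b ∈ B i)
    (hxb : G.Adj x b) : ∃ q' m' S, Quill G B O v q' m' S ∧ S ⊆ P := by
  obtain ⟨z, d, S, hS, sS, ⟨j, c, hc, hzc⟩, hu, -⟩ :=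
    hP.first (fun u => ∃ i, ∃ b ∈ B i, G.Adj u b) ⟨x, hx, i, b, hb, hxb⟩
  refine ⟨z, d, S, ⟨hS, sS.trans hsub, ?_, fun u hu' i b hb h => hu u hu' ⟨i, b, hb, h⟩,
    j, c, hc, hzc⟩, sS⟩
  rintro rfl
  exact hH j ⟨c, Or.inl hc, hzc⟩

theorem exists_quill (F : Frame G a A B C T O) (hv : G.Adj a v) (hH : ∀ i, ¬ Hits G B T v i) :
    ∃ q m S, Quill G B O v q m S := by
  obtain ⟨w, hvw, hwa, haw⟩ := F.nbr v hv
  rcases F.cover w hwa haw with hw | ⟨i, hw⟩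
  · obtain ⟨y, hy, hr, i, b, hb, hyb⟩ := F.outB w hw
    obtain ⟨n, S, hS, sS⟩ := ((Rch.step hvw hw).trans hr).exists_path
    obtain ⟨q, m, S', hQ, -⟩ := quill_of_path hH hS sS hS.right_mem hb hyb
    exact ⟨q, m, S', hQ⟩
  · exact absurd ⟨w, hw, hvw⟩ (hH i)

theorem even_of_misses (F : Frame G a A B C T O) (hv : G.Adj a v) (hvS : v ∉ PSSVerts a A B C)
    (hρ : RungParity G A B T ρ) (hl : Misses G A T v l) (hb : b ∈ B l) (hvb : G.Adj v b) :
    Even ρ := by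
  obtain ⟨α, r, R, hR⟩ := F.rungB l b hb
  have f := hR.facts F.st
  have fv := F.ext_facts hv hvS
  have hvb' : v ∉ ({b} : Set V) := by
    rintro rfl
    exact hvb.ne rfl
  have p1 := (IPath.single (G := G) b).cons hvb hvb' (fun w hw _ => hw)
  have := F.adj_iff_even hv hR p1 le_rfl (by
    rintro u (rfl | rfl) huv
    · exact absurd rfl huv
    · have := F.bt_facts (w := u) (i := l) (Or.inl hb)
      exact ⟨this.2.1, this.2.2.1⟩) (by
    rintro u (rfl | rfl) h
    exacts [absurd (f.2.2.2.2.1 u h) (fv.2.2 l), rfl]) (by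
    rintro u (rfl | rfl) w hw hub hwb had
    · rcases f.2.2.2.2.2.2.2.1 w hw with rfl | h | h
      exacts [⟨rfl, rfl⟩, absurd h hwb, absurd had (hl w (Or.inr h))]
    · exact absurd rfl hub)
  have h1 := hρ hR
  have h2 := hl α (Or.inl f.1)
  grind

theorem tail_of_adj (hb : b ∈ B i) (hvb : G.Adj v b) :
    Tail G B T v i b 1 {v, b} := by
  refine ⟨hb, (IPath.single b).cons hvb (fun h => hvb.ne h) (fun w hw _ => hw), ?_⟩
  rintro w (rfl | rfl)
  exacts [Or.inl rfl, Or.inr (Or.inl rfl)]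

/-- The three possibilities for a neighbour of the apex that misses a strip. -/
theorem misses_cases (F : Frame G a A B C T O) (hv : G.Adj a v) (hvS : v ∉ PSSVerts a A B C)
    (hρ : RungParity G A B T ρ) (hl : Misses G A T v l) :
    ((∀ {i b n S}, Tail G B T v i b n S → Even (n + ρ)) ∧ (∀ w ∈ strV A B T l, ¬ G.Adj v w) ∧
        ∀ j, j ≠ l → Hits G B T v j) ∨
      (Even ρ ∧ ∃ b ∈ B l, G.Adj v b) ∨
      ((∀ j, ¬ Hits G B T v j) ∧ (∀ j, j ≠ l → ∀ x ∈ A j, G.Adj v x)) := by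
  by_cases h1 : Hits G B T v l
  · obtain ⟨b, hb | hb, hvb⟩ := h1
    · exact Or.inr (Or.inl ⟨F.even_of_misses hv hvS hρ hl hb hvb, b, hb, hvb⟩)
    · exact absurd hvb (hl b (Or.inr hb))
  obtain ⟨α, hα⟩ := F.sys.exists_A l
  have hvα := hl α (Or.inl hα)
  by_cases h2 : ∃ j, Hits G B T v j
  · obtain ⟨j, hj⟩ := h2
    have even : ∀ {i b n S}, Tail G B T v i b n S → Even (n + ρ) := fun h => by
      rw [F.adj_A_iff hv hvS hρ h h1 hα] at hvα
      grind
    refine Or.inl ⟨even, fun w hw had => ?_, fun i hi => ?_⟩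
    · rcases hw with (hw | hw) | hw
      exacts [hl w (Or.inl hw) had, h1 ⟨w, Or.inl hw, had⟩, hl w (Or.inr hw) had]
    · by_contra hc
      obtain ⟨b, n, S, hS⟩ := F.exists_tail hj
      exact F.tail_false hv hvS hρ hS (even hS) hi hc h1
  · push Not at h2
    refine Or.inr (Or.inr ⟨h2, ?_⟩)
    obtain ⟨q, m, S, hQ⟩ := F.exists_quill hv h2
    obtain ⟨i, hi, -⟩ := F.quill_uniform hv hvS hρ h2 hQ
    have : l = i := by
      by_contra hli
      exact hvα (hi l hli α hα)
    exact this ▸ hi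

theorem misses_unique (F : Frame G a A B C T O) (hv : G.Adj a v) (hvS : v ∉ PSSVerts a A B C)
    (hl : Misses G A T v l) (hj : Misses G A T v j) : l = j := by
  by_contra hlj
  obtain ⟨ρ, hρ⟩ := F.exists_parity
  have e3 : ∀ {l j}, l ≠ j → (∀ w ∈ strV A B T l, ¬ G.Adj v w) →
      (∀ i, i ≠ j → Hits G B T v i) → False := by
    intro l j hlj h1 h2
    obtain ⟨w, hw, had⟩ := h2 l hlj
    exact h1 w (hw.elim (F.st.memB l w) (F.st.memC l w)) had
  have e12 : ∀ {j b}, b ∈ B j → G.Adj v b → Even ρ →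
      (∀ {i b n S}, Tail G B T v i b n S → Even (n + ρ)) → False := by
    intro j b hb hvb he h
    have := h (tail_of_adj hb hvb)
    grind
  rcases F.misses_cases hv hvS hρ hl with ⟨h1, h2, h3⟩ | ⟨he, b, hb, hvb⟩ | ⟨h1, h2⟩ <;>
    rcases F.misses_cases hv hvS hρ hj with ⟨h1', h2', h3'⟩ | ⟨he', b', hb', hvb'⟩ | ⟨h1', h2'⟩
  · exact e3 hlj h2 h3'
  · exact e12 hb' hvb' he' h1
  · exact h1' j (h3 j (Ne.symm hlj))
  · exact e12 hb hvb he h1'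
  · obtain ⟨α, r, R, hR⟩ := F.rungB l b hb
    obtain ⟨α', r', R', hR'⟩ := F.rungB j b' hb'
    refine F.short_pyramid_false hv hvS hlj hR hR' hvb hvb' ?_ ?_
    · intro w hw had
      rcases (hR.facts F.st).2.2.2.2.2.2.2.1 w hw with rfl | h | h
      exacts [absurd had (hl w (Or.inl hR.left)), h, absurd had (hl w (Or.inr h))]
    · intro w hw had
      rcases (hR'.facts F.st).2.2.2.2.2.2.2.1 w hw with rfl | h | h
      exacts [absurd had (hj w (Or.inl hR'.left)), h, absurd had (hj w (Or.inr h))]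
  · exact h1' l ⟨b, Or.inl hb, hvb⟩
  · exact h1 l (h3' l hlj)
  · exact h1 j ⟨b', Or.inl hb', hvb'⟩
  · obtain ⟨α, hα⟩ := F.sys.exists_A l
    exact hl α (Or.inl hα) (h2' l hlj α hα)

end Frame
end Types

section Rivals

variable {V : Type*} {G : SimpleGraph V} {a : V} {k : ℕ} {A B C T : Fin k → Set V} {O : Set V}

/-- Two nonadjacent neighbours of the apex outside of the strip system. -/
structure Rivals (G : SimpleGraph V) (a : V) {k : ℕ} (A B C : Fin k → Set V) (v₁ v₂ : V) :
    Prop where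
  adj₁ : G.Adj a v₁
  notMem₁ : v₁ ∉ PSSVerts a A B C
  adj₂ : G.Adj a v₂
  notMem₂ : v₂ ∉ PSSVerts a A B C
  ne : v₁ ≠ v₂
  na : ¬ G.Adj v₁ v₂

variable {i j l : Fin k} {v₁ v₂ α b : V} {n m r ρ : ℕ} {S S' Z : Set V}

theorem Rivals.symm (p : Rivals G a A B C v₁ v₂) : Rivals G a A B C v₂ v₁ :=
  ⟨p.adj₂, p.notMem₂, p.adj₁, p.notMem₁, p.ne.symm, fun h => p.na h.symm⟩

theorem exists_link (hZ : ∀ x ∈ Z, ∀ y ∈ Z, Rch G Z x y) (h₁ : ∃ w ∈ Z, G.Adj v₁ w)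
    (h₂ : ∃ w ∈ Z, G.Adj v₂ w) : ∃ n S, IPath G v₁ v₂ n S ∧ S ⊆ {v₁, v₂} ∪ Z := by
  obtain ⟨w₁, hw₁, h₁⟩ := h₁
  obtain ⟨w₂, hw₂, h₂⟩ := h₂
  obtain ⟨n, S, hS, sS⟩ := (((Rch.step h₁ (Set.mem_insert_of_mem v₂ hw₁)).trans
    ((hZ w₁ hw₁ w₂ hw₂).mono (Set.subset_insert _ _))).trans
    (.step h₂.symm (Set.mem_insert _ _))).exists_path
  refine ⟨n, S, hS, fun w hw => ?_⟩
  rcases sS hw with h | h | h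
  exacts [Or.inl (Or.inl h), Or.inl (Or.inr h), Or.inr h]

theorem Misses.exists_adj {v : V} (h : ¬ Misses G A T v i) : ∃ w ∈ A i ∪ T i, G.Adj v w := by
  unfold Misses at h
  push Not at h
  exact h

namespace Frame

theorem odd_of_avoids_apex (F : Frame G a A B C T O) (p : Rivals G a A B C v₁ v₂)
    (h : IPath G v₁ v₂ n S) (hS : S ⊆ {v₁, v₂} ∪ {u | u ≠ a ∧ ¬ G.Adj a u}) : Odd n := by
  have h1 : IPath G v₁ v₂ 2 (insert v₁ (insert a {v₂})) := by
    refine ((IPath.single v₂).cons p.adj₂ (fun h => p.adj₂.ne h) (fun w hw _ => hw)).cons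
      p.adj₁.symm ?_ ?_
    · rintro (h | h)
      exacts [p.adj₁.ne h.symm, p.ne h]
    · rintro w (h | rfl) had
      exacts [h, absurd had p.na]
  have := F.sys.ehf.odd_of_far (X := {u | u ≠ a ∧ ¬ G.Adj a u}) (Y := {a}) h h1 p.ne p.na hS (by
    rintro u (rfl | rfl | rfl)
    exacts [Or.inl (Or.inl rfl), Or.inr rfl, Or.inl (Or.inr rfl)]) (by
    rintro u hu w rfl
    exact ⟨hu.1, fun had => hu.2 had.symm⟩)
  grind

/-- The union of the strips with indices in `J`. -/
def union (A B T : Fin k → Set V) (J : Set (Fin k)) : Set V := {x | ∃ l ∈ J, x ∈ strV A B T l}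

theorem conn_strV (F : Frame G a A B C T O) (i : Fin k) :
    ∀ x ∈ strV A B T i, ∀ y ∈ strV A B T i, Rch G (strV A B T i) x y := by
  obtain ⟨α, hα⟩ := F.sys.exists_A i
  have sub : A i ∪ T i ⊆ strV A B T i := fun u hu =>
    hu.elim (F.st.memA i u) (F.st.memC i u)
  refine MaxSys.rch_all (c := α) fun x hx => ?_
  rcases hx with (hx | hx) | hx
  · exact (F.conn i x (Or.inl hx) α (Or.inl hα)).mono sub
  · obtain ⟨β, r, R, hR⟩ := F.rungB i x hx
    have f := hR.facts F.st
    exact ((hR.path.symm.rch β f.2.2.1).mono f.2.2.2.2.1).trans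
      ((F.conn i β (Or.inl f.1) α (Or.inl hα)).mono sub)
  · exact (F.conn i x (Or.inr hx) α (Or.inl hα)).mono sub

theorem conn_union (F : Frame G a A B C T O) (J : Set (Fin k)) :
    ∀ x ∈ union A B T J, ∀ y ∈ union A B T J, Rch G (union A B T J) x y := by
  have sub : ∀ i ∈ J, strV A B T i ⊆ union A B T J := fun i hi u hu => ⟨i, hi, hu⟩
  rintro x ⟨i, hi, hx⟩ y ⟨j, hj, hy⟩
  by_cases hij : i = j
  · subst hij
    exact (F.conn_strV i x hx y hy).mono (sub i hi)
  · obtain ⟨b, hb⟩ := F.sys.exists_B i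
    obtain ⟨c, hc⟩ := F.sys.exists_B j
    have hb' := F.st.memB i b hb
    have hc' := F.st.memB j c hc
    exact (((F.conn_strV i x hx b hb').mono (sub i hi)).trans
      (.step (F.st.adjB hij hb hc) (sub j hj hc'))).trans
      ((F.conn_strV j c hc' y hy).mono (sub j hj))

theorem rch_B (F : Frame G a A B C T O) {x : V} (hx : x ∈ B i ∪ T i) :
    ∃ b ∈ B i, Rch G (B i ∪ T i) x b := by
  rcases hx with hx | hx
  · exact ⟨x, hx, .refl⟩
  · obtain ⟨t, ht, hr, b, hb, htb⟩ := F.toB i x hx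
    exact ⟨b, hb, (hr.mono Set.subset_union_right).trans (.step htb (Or.inl hb))⟩

theorem conn_pair (F : Frame G a A B C T O) (hij : i ≠ j) :
    ∀ x ∈ (B i ∪ T i) ∪ (B j ∪ T j), ∀ y ∈ (B i ∪ T i) ∪ (B j ∪ T j),
      Rch G ((B i ∪ T i) ∪ (B j ∪ T j)) x y := by
  obtain ⟨b, hb⟩ := F.sys.exists_B i
  obtain ⟨c, hc⟩ := F.sys.exists_B j
  have hb' : b ∈ (B i ∪ T i) ∪ (B j ∪ T j) := Or.inl (Or.inl hb)
  have hc' : c ∈ (B i ∪ T i) ∪ (B j ∪ T j) := Or.inr (Or.inl hc)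
  refine MaxSys.rch_all (c := c) ?_
  rintro x (hx | hx)
  · obtain ⟨d, hd, h⟩ := F.rch_B hx
    exact (h.mono Set.subset_union_left).trans (.step (F.st.adjB hij hd hc) hc')
  · obtain ⟨d, hd, h⟩ := F.rch_B hx
    exact ((h.mono Set.subset_union_right).trans (.step (F.st.adjB hij hb hd).symm hb')).trans
      (.step (F.st.adjB hij hb hc) hc')

theorem subset_strV (F : Frame G a A B C T O) (i : Fin k) : A i ∪ T i ⊆ strV A B T i :=
  fun u hu => hu.elim (F.st.memA i u) (F.st.memC i u)

theorem far_union (F : Frame G a A B C T O) {J : Set (Fin k)} (hi : i ∉ J) :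
    Far G (A i ∪ T i) (union A B T J) := by
  rintro x hx y ⟨j, hj, hy⟩
  refine F.far_strips ?_ x hx y hy
  rintro rfl
  exact hi hj

theorem exists_inner (F : Frame G a A B C T O) (h₁ : ¬ Misses G A T v₁ i)
    (h₂ : ¬ Misses G A T v₂ i) : ∃ n S, IPath G v₁ v₂ n S ∧ S ⊆ {v₁, v₂} ∪ (A i ∪ T i) :=
  exists_link (F.conn i) (Misses.exists_adj h₁) (Misses.exists_adj h₂)

theorem odd_inner_add (F : Frame G a A B C T O) (p : Rivals G a A B C v₁ v₂) (hij : i ≠ j)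
    (h : IPath G v₁ v₂ n S) (hS : S ⊆ {v₁, v₂} ∪ (A i ∪ T i)) (h' : IPath G v₁ v₂ m S')
    (hS' : S' ⊆ {v₁, v₂} ∪ (A j ∪ T j)) : Odd (n + m) :=
  F.sys.ehf.odd_of_far h h' p.ne p.na hS hS'
    ((F.far_strips hij).mono subset_rfl (F.subset_strV j))

theorem three_links_false (F : Frame G a A B C T O) (p : Rivals G a A B C v₁ v₂) (hij : i ≠ j)
    (h₁i : ¬ Misses G A T v₁ i) (h₁j : ¬ Misses G A T v₁ j) (h₂i : ¬ Misses G A T v₂ i)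
    (h₂j : ¬ Misses G A T v₂ j)
    (h₁ : ∃ w ∈ union A B T {l | l ≠ i ∧ l ≠ j}, G.Adj v₁ w)
    (h₂ : ∃ w ∈ union A B T {l | l ≠ i ∧ l ≠ j}, G.Adj v₂ w) : False := by
  obtain ⟨n, S, hS, sS⟩ := F.exists_inner h₁i h₂i
  obtain ⟨m, S', hS', sS'⟩ := F.exists_inner h₁j h₂j
  obtain ⟨d, U, hU, sU⟩ := exists_link (F.conn_union _) h₁ h₂
  have e1 := F.odd_inner_add p hij hS sS hS' sS'
  have e2 := F.sys.ehf.odd_of_far hS hU p.ne p.na sS sU (F.far_union fun h => h.1 rfl)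
  have e3 := F.sys.ehf.odd_of_far hS' hU p.ne p.na sS' sU (F.far_union fun h => h.2 rfl)
  grind

theorem exists_even_inner (F : Frame G a A B C T O) (p : Rivals G a A B C v₁ v₂)
    (hi : ¬ Hits G B T v₁ i) (hc : ∀ x ∈ A i, G.Adj v₁ x) (h₂ : ¬ Misses G A T v₂ i) :
    ∃ n S, IPath G v₁ v₂ n S ∧ S ⊆ {v₁, v₂} ∪ (A i ∪ T i) ∧ Even n := by
  have f₁ := F.ext_facts p.adj₁ p.notMem₁
  have f₂ := F.ext_facts p.adj₂ p.notMem₂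
  by_cases hA : ∃ x ∈ A i, G.Adj v₂ x
  · obtain ⟨x, hx, h2x⟩ := hA
    refine ⟨2, insert v₁ (insert x {v₂}), ?_, ?_, even_two⟩
    · refine ((IPath.single v₂).cons h2x.symm (fun h => h2x.ne' h) (fun w hw _ => hw)).cons
        (hc x hx) ?_ ?_
      · rintro (h | h)
        exacts [(hc x hx).ne h, p.ne h]
      · rintro w (h | rfl) had
        exacts [h, absurd had p.na]
    · rintro u (rfl | rfl | rfl)
      exacts [Or.inl (Or.inl rfl), Or.inr (Or.inl hx), Or.inl (Or.inr rfl)]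
  · push Not at hA
    obtain ⟨w, hw | hw, h2w⟩ := Misses.exists_adj h₂
    · exact absurd h2w (hA w hw)
    obtain ⟨t, ht, hr, α, hα, htα⟩ := F.toA i w hw
    obtain ⟨n, S, hS, sS⟩ := (((Rch.step h2w (Set.mem_insert_of_mem α hw)).trans
      (hr.mono (Set.subset_insert _ _))).trans (.step htα (Set.mem_insert _ _))).exists_path
    have h2α := hA α hα
    have n2α : v₂ ≠ α := fun e => f₂.2.2 i (e ▸ F.st.memA i α hα)
    have hα1 : v₁ ≠ α := fun e => f₁.2.2 i (e ▸ F.st.memA i α hα)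
    have h1S : v₁ ∉ S := fun h => by
      rcases sS h with h | h | h
      exacts [p.ne h, hα1 h, f₁.2.2 i (F.st.memC i v₁ h)]
    have p2 : IPath G v₂ α 2 (insert v₂ (insert a {α})) := by
      refine ((IPath.single α).cons (F.st.adjA hα) (fun h => (F.st.adjA hα).ne h)
        (fun w hw _ => hw)).cons p.adj₂.symm ?_ ?_
      · rintro (h | h)
        exacts [p.adj₂.ne h.symm, n2α h]
      · rintro w (h | rfl) had
        exacts [h, absurd had h2α]
    have odd := F.sys.ehf.odd_of_far (X := T i) (Y := {a}) hS p2 n2α h2α (by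
      intro u hu
      rcases sS hu with h | h | h
      exacts [Or.inl (Or.inl h), Or.inl (Or.inr h), Or.inr h]) (by
      rintro u (h | h | h)
      exacts [Or.inl (Or.inl h), Or.inr h, Or.inl (Or.inr h)]) (by
      rintro u hu w rfl
      have := F.bt_facts (i := i) (Or.inr hu)
      exact ⟨this.2.1, fun had => this.2.2.1 had.symm⟩)
    refine ⟨n + 1, insert v₁ S, hS.symm.cons (hc α hα) h1S ?_, ?_, by grind⟩
    · intro u hu had
      rcases sS hu with rfl | h | h
      exacts [absurd had p.na, h, absurd ⟨u, Or.inr h, had⟩ hi]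
    · rintro u (h | hu)
      · exact Or.inl (Or.inl h)
      rcases sS hu with h | rfl | h
      exacts [Or.inl (Or.inr h), Or.inr (Or.inl hα), Or.inr (Or.inr h)]

theorem complete_false (F : Frame G a A B C T O) (p : Rivals G a A B C v₁ v₂) (hij : i ≠ j)
    (hH : ∀ i, ¬ Hits G B T v₁ i) (hi : ∀ x ∈ A i, G.Adj v₁ x) (hj : ∀ x ∈ A j, G.Adj v₁ x)
    (h₂i : ¬ Misses G A T v₂ i) (h₂j : ¬ Misses G A T v₂ j) : False := by
  obtain ⟨n, S, hS, sS, hn⟩ := F.exists_even_inner p (hH i) hi h₂i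
  obtain ⟨m, S', hS', sS', hm⟩ := F.exists_even_inner p (hH j) hj h₂j
  have := F.odd_inner_add p hij hS sS hS' sS'
  grind

theorem even_odd_false (F : Frame G a A B C T O) (p : Rivals G a A B C v₁ v₂)
    (hρ : RungParity G A B T ρ) {x y : Fin k} (hxy : x ≠ y) (hlx : l ≠ x) (hly : l ≠ y)
    (hl : ∀ w ∈ strV A B T l, ¬ G.Adj v₁ w)
    (he : ∀ {i b n S}, Tail G B T v₁ i b n S → Even (n + ρ))
    (hx₁ : Hits G B T v₁ x) (hy₁ : Hits G B T v₁ y) (hx₂ : ¬ Misses G A T v₂ x)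
    (hy₂ : ¬ Misses G A T v₂ y) (h : IPath G v₁ v₂ n S) (hS : S ⊆ {v₁, v₂} ∪ (A x ∪ T x))
    (hn : Even n) (h' : IPath G v₁ v₂ m S') (hS' : S' ⊆ {v₁, v₂} ∪ (A y ∪ T y))
    (hm : Odd m) : False := by
  have f₁ := F.ext_facts p.adj₁ p.notMem₁
  have f₂ := F.ext_facts p.adj₂ p.notMem₂
  have bt : ∀ i, ∀ u ∈ B i ∪ T i, u ∈ strV A B T i := fun i u hu => (F.bt_facts hu).1
  have far2 : ¬ ∃ w ∈ (B x ∪ T x) ∪ (B l ∪ T l), G.Adj v₂ w := by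
    intro h2
    obtain ⟨w, hw, h1w⟩ := hx₁
    obtain ⟨d, U, hU, sU⟩ := exists_link (F.conn_pair hlx.symm) ⟨w, Or.inl hw, h1w⟩ h2
    have e1 := F.odd_of_avoids_apex p hU (sU.trans (Set.union_subset_union_right _ (by
      rintro u (hu | hu)
      exacts [⟨(F.bt_facts hu).2.1, (F.bt_facts hu).2.2.1⟩,
        ⟨(F.bt_facts hu).2.1, (F.bt_facts hu).2.2.1⟩])))
    have e2 := F.sys.ehf.odd_of_far h' hU p.ne p.na hS' sU (by
      rintro u hu w (hw | hw)
      exacts [F.far_strips hxy.symm u hu w (bt x w hw), F.far_strips hly.symm u hu w (bt l w hw)])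
    grind
  have hx₂' : ¬ Hits G B T v₂ x := fun ⟨w, hw, had⟩ => far2 ⟨w, Or.inl hw, had⟩
  have hl₂' : ¬ Hits G B T v₂ l := fun ⟨w, hw, had⟩ => far2 ⟨w, Or.inr hw, had⟩
  have hl₂ : ¬ Misses G A T v₂ l := by
    intro hmis
    rcases F.misses_cases p.adj₂ p.notMem₂ hρ hmis with ⟨-, -, h3⟩ | ⟨-, b, hb, hvb⟩ | ⟨h1, h2⟩
    · exact hx₂' (h3 x hlx.symm)
    · exact hl₂' ⟨b, Or.inl hb, hvb⟩
    · have mis : ∀ {i}, Hits G B T v₁ i → (∀ x ∈ A i, G.Adj v₂ x) →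
          ∃ n S, IPath G v₁ v₂ n S ∧ S ⊆ {v₁, v₂} ∪ (A i ∪ T i) ∧ Even n := by
        rintro i ⟨w, hw | hw, had⟩ hc
        · by_cases hmi : Misses G A T v₁ i
          · exact absurd (F.misses_unique p.adj₁ p.notMem₁ hmi
              (fun w hw => hl w (F.subset_strV l hw))) (by
              rintro rfl
              exact hl w (F.st.memB _ w hw) had)
          · obtain ⟨n, S, h1, h2, h3⟩ := F.exists_even_inner p.symm (h1 i) hc hmi
            exact ⟨n, S, h1.symm, h2.trans (by rw [Set.pair_comm]), h3⟩
        · obtain ⟨n, S, h1, h2, h3⟩ := F.exists_even_inner p.symm (h1 i) hc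
            (fun hmi => hmi w (Or.inr hw) had)
          exact ⟨n, S, h1.symm, h2.trans (by rw [Set.pair_comm]), h3⟩
      obtain ⟨c, U, hU, sU, eU⟩ := mis hx₁ (h2 x hlx.symm)
      obtain ⟨c', U', hU', sU', eU'⟩ := mis hy₁ (h2 y hly.symm)
      have := F.odd_inner_add p hxy hU sU hU' sU'
      grind
  obtain ⟨α, hα | hα, h2α⟩ := Misses.exists_adj hl₂
  swap
  · exact hl₂' ⟨α, Or.inr hα, h2α⟩
  obtain ⟨c, r, R, hR⟩ := F.rungA l α hα
  obtain ⟨b, d, P, hP⟩ := F.exists_tail hy₁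
  have fR := hR.facts F.st
  have fP := F.tail_facts p.adj₁ p.notMem₁ hP
  have eR := hρ hR
  have eP := he hP
  by_cases hanti : ∀ w ∈ P, w ≠ v₁ → ¬ G.Adj v₂ w
  · have j1 := hP.path.join hR.path.symm (F.st.adjB hly.symm hP.right hR.right) (by
      rw [Set.disjoint_left]
      intro u hu hu'
      by_cases e : u = v₁
      · exact f₁.2.2 l (e ▸ fR.2.2.2.2.1 u hu')
      · exact hly (F.st.index l y u (fR.2.2.2.2.1 u hu') (fP.2.2.2.2.2 u hu e).1)) (by
      intro u hu w hw had
      by_cases e : u = v₁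
      · exact absurd (e ▸ had) (hl w (fR.2.2.2.2.1 w hw))
      · have := (F.st.cross y l u w hly.symm (fP.2.2.2.2.2 u hu e).1
          (fR.2.2.2.2.1 w hw)).1 had
        exact ⟨fP.2.2.2.1 u hu this.1, fR.2.2.2.2.2.2.1 w hw this.2⟩)
    have j2 := j1.snoc h2α.symm (by
      rintro (h | h)
      · exact f₂.2.2 y (fP.2.2.2.2.2 v₂ h p.ne.symm).1
      · exact f₂.2.2 l (fR.2.2.2.2.1 v₂ h)) (by
      rintro w (hw | hw) had
      · by_cases e : w = v₁
        · exact absurd (e ▸ had).symm p.na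
        · exact absurd had (hanti w hw e)
      · exact F.rung_not_adj hl₂' hR w hw had)
    have := F.sys.ehf.odd_of_far (Y := strV A B T y ∪ strV A B T l) h j2 p.ne p.na hS (by
      rintro u (h | hu | hu)
      · exact Or.inl (Or.inr h)
      · by_cases e : u = v₁
        · exact Or.inl (Or.inl e)
        · exact Or.inr (Or.inl (fP.2.2.2.2.2 u hu e).1)
      · exact Or.inr (Or.inr (fR.2.2.2.2.1 u hu))) (by
      rintro u hu w (hw | hw)
      exacts [F.far_strips hxy u hu w hw, F.far_strips hlx.symm u hu w hw])
    grind
  · push Not at hanti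
    obtain ⟨w, hw, hwv, h2w⟩ := hanti
    obtain ⟨d', rfl⟩ := Nat.exists_eq_add_of_le' fP.2.1
    obtain ⟨s, P', hvs, hP', hvP', rfl, hsu⟩ := hP.path.uncons
    obtain ⟨z, e, Q, hQ, sQ, h2z, hzu, -, hsQ⟩ := hP'.last (fun u => G.Adj v₂ u)
      ⟨w, hw.resolve_left hwv, h2w⟩
    have fQ : ∀ u ∈ Q, u ≠ v₁ ∧ u ∈ insert v₁ P' := fun u hu =>
      ⟨fun h => hvP' (h ▸ sQ hu), Or.inr (sQ hu)⟩
    have hQs : ∀ u ∈ Q, u ∈ B y ∪ T y := fun u hu =>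
      (fP.2.2.1 u (fQ u hu).2).resolve_left (fQ u hu).1
    have h2Q : v₂ ∉ Q := fun h => f₂.2.2 y (bt y v₂ (hQs v₂ h))
    have t2 : Tail G B T v₂ y b (e + 1) (insert v₂ Q) := by
      refine ⟨hP.right, hQ.cons h2z h2Q hzu, Set.insert_subset_insert fun u hu => ?_⟩
      by_cases hub : u = b
      · exact Or.inl hub
      · exact Or.inr (fP.2.2.2.2.1 u (fQ u hu).2 (fQ u hu).1 hub)
    have odd : ¬ Even (e + 1 + ρ) := fun h =>
      F.tail_false p.adj₂ p.notMem₂ hρ t2 h hlx.symm hx₂' hl₂'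
    by_cases h1Q : ∀ u ∈ Q, ¬ G.Adj v₁ u
    · obtain ⟨b', d₂, P₂, hP₂⟩ := F.exists_tail hx₁
      have fP₂ := F.tail_facts p.adj₁ p.notMem₁ hP₂
      have eP₂ := he hP₂
      have j1 := hP₂.path.join t2.path.symm (F.st.adjB hxy hP₂.right hP.right) (by
        rw [Set.disjoint_left]
        rintro u hu (rfl | hu')
        · exact f₂.2.2 x (fP₂.2.2.2.2.2 u hu p.ne.symm).1
        · exact hxy (F.st.index x y u (fP₂.2.2.2.2.2 u hu (fQ u hu').1).1
            (bt y u (hQs u hu')))) (by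
        rintro u hu w (rfl | hw) had
        · rcases fP₂.2.2.1 u hu with rfl | h
          exacts [absurd had p.na, absurd ⟨u, h, had.symm⟩ hx₂']
        · by_cases e : u = v₁
          · exact absurd (e ▸ had) (h1Q w hw)
          · have := (F.st.cross x y u w hxy (fP₂.2.2.2.2.2 u hu e).1 (bt y w (hQs w hw))).1 had
            exact ⟨fP₂.2.2.2.1 u hu this.1, fP.2.2.2.1 w (fQ w hw).2 this.2⟩)
      have := F.odd_of_avoids_apex p j1 (by
        rintro u (hu | h | hu)
        · by_cases e : u = v₁
          · exact Or.inl (Or.inl e)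
          · exact Or.inr ⟨(fP₂.2.2.2.2.2 u hu e).2.1, (fP₂.2.2.2.2.2 u hu e).2.2.1⟩
        · exact Or.inl (Or.inr h)
        · exact Or.inr ⟨(F.bt_facts (hQs u hu)).2.1, (F.bt_facts (hQs u hu)).2.2.1⟩)
      grind
    · push Not at h1Q
      obtain ⟨u, hu, h1u⟩ := h1Q
      have hus := hsu u (sQ hu) h1u
      subst hus
      have hzs := (hsQ hu).2.1
      subst hzs
      have j1 : IPath G v₁ v₂ 2 (insert v₁ (insert z {v₂})) := by
        refine ((IPath.single v₂).cons h2z.symm (fun h => h2z.ne' h) (fun w hw _ => hw)).cons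
          hvs ?_ ?_
        · rintro (h | h)
          exacts [hvs.ne h, p.ne h]
        · rintro w (h | rfl) had
          exacts [h, absurd had p.na]
      have := F.odd_of_avoids_apex p j1 (by
        rintro u (h | rfl | h)
        · exact Or.inl (Or.inl h)
        · exact Or.inr ⟨(F.bt_facts (hQs u hu)).2.1, (F.bt_facts (hQs u hu)).2.2.1⟩
        · exact Or.inl (Or.inr h))
      grind

theorem no_common_pair_aux (F : Frame G a A B C T O) (p : Rivals G a A B C v₁ v₂) (hij : i ≠ j)
    (h₁i : ¬ Misses G A T v₁ i) (h₁j : ¬ Misses G A T v₁ j) (h₂i : ¬ Misses G A T v₂ i)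
    (h₂j : ¬ Misses G A T v₂ j)
    (h₁ : ¬ ∃ w ∈ union A B T {l | l ≠ i ∧ l ≠ j}, G.Adj v₁ w) : False := by
  obtain ⟨ρ, hρ⟩ := F.exists_parity
  obtain ⟨l, hli, hlj⟩ := F.sys.exists_third i j
  have hl : ∀ w ∈ strV A B T l, ¬ G.Adj v₁ w := fun w hw had => h₁ ⟨w, ⟨l, ⟨hli, hlj⟩, hw⟩, had⟩
  rcases F.misses_cases p.adj₁ p.notMem₁ hρ (l := l) (fun w hw => hl w (F.subset_strV l hw)) with
    ⟨he, -, h3⟩ | ⟨-, b, hb, hvb⟩ | ⟨h1, h2⟩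
  · obtain ⟨n, S, hS, sS⟩ := F.exists_inner h₁i h₂i
    obtain ⟨m, S', hS', sS'⟩ := F.exists_inner h₁j h₂j
    have odd := F.odd_inner_add p hij hS sS hS' sS'
    rcases Nat.even_or_odd n with hn | hn
    · exact F.even_odd_false p hρ hij hli hlj hl he (h3 i hli.symm) (h3 j hlj.symm) h₂i h₂j
        hS sS hn hS' sS' (by grind)
    · exact F.even_odd_false p hρ hij.symm hlj hli hl he (h3 j hlj.symm) (h3 i hli.symm) h₂j h₂i
        hS' sS' (by grind) hS sS hn
  · exact hl b (F.st.memB l b hb) hvb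
  · exact F.complete_false p hij h1 (h2 i hli.symm) (h2 j hlj.symm) h₂i h₂j

/-- At most one of the sets `A i ∪ T i` contains neighbours of both rivals. -/
theorem no_common_pair (F : Frame G a A B C T O) (p : Rivals G a A B C v₁ v₂) (hij : i ≠ j)
    (h₁i : ¬ Misses G A T v₁ i) (h₁j : ¬ Misses G A T v₁ j) (h₂i : ¬ Misses G A T v₂ i)
    (h₂j : ¬ Misses G A T v₂ j) : False := by
  by_cases h₁ : ∃ w ∈ union A B T {l | l ≠ i ∧ l ≠ j}, G.Adj v₁ w
  · by_cases h₂ : ∃ w ∈ union A B T {l | l ≠ i ∧ l ≠ j}, G.Adj v₂ w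
    · exact F.three_links_false p hij h₁i h₁j h₂i h₂j h₁ h₂
    · exact F.no_common_pair_aux p.symm hij h₂i h₂j h₁i h₁j h₂
  · exact F.no_common_pair_aux p hij h₁i h₁j h₂i h₂j h₁

end Frame
end Rivals

section Owning

variable {V : Type*} {G : SimpleGraph V} {a : V} {k : ℕ} {A B C T : Fin k → Set V} {O : Set V}
variable {i j l : Fin k} {x y z v α b : V} {n m r ρ : ℕ} {R S S' : Set V}

/-- Two induced paths with a common end form an induced path. -/
theorem IPath.glue (h : IPath G x y n S) (h' : IPath G y z m S')
    (hd : ∀ u ∈ S, u ∈ S' → u = y)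
    (hc : ∀ u ∈ S, ∀ w ∈ S', u ≠ y → w ≠ y → ¬ G.Adj u w) : IPath G x z (n + m) (S ∪ S') := by
  rcases m with _ | m
  · obtain ⟨rfl, rfl⟩ := h'.eq_singleton
    exact h.congr_set (Set.union_eq_self_of_subset_right
      (Set.singleton_subset_iff.2 h.right_mem)).symm
  · obtain ⟨y', S'', hyy', h'', hy, rfl, hu⟩ := h'.uncons
    refine (h.join h'' hyy' ?_ ?_).congr_set ?_
    · rw [Set.disjoint_left]
      intro u hu hu'
      exact hy (hd u hu (Or.inr hu') ▸ hu')
    · intro u huS w hw had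
      have hwy : w ≠ y := fun e => hy (e ▸ hw)
      by_cases e : u = y
      · subst e
        exact ⟨rfl, hu w hw had⟩
      · exact absurd had (hc u huS w (Or.inr hw) e hwy)
    · ext u
      constructor
      · rintro (h | h)
        exacts [Or.inl h, Or.inr (Or.inr h)]
      · rintro (hu | rfl | hu)
        exacts [Or.inl hu, Or.inl h.right_mem, Or.inr hu]

theorem IPath.rch_diff (h : IPath G x y n S) : ∀ w ∈ S, Rch G (S \ {x}) x w := by
  intro w hw
  rcases n with _ | n
  · obtain ⟨rfl, rfl⟩ := h.eq_singleton
    cases hw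
    exact .refl
  · obtain ⟨x', S', hx, h', hxS, rfl, -⟩ := h.uncons
    have sub : S' ⊆ insert x S' \ {x} := fun u hu => ⟨Or.inr hu, fun e => hxS (e ▸ hu)⟩
    rcases hw with rfl | hw
    · exact .refl
    · exact (Rch.step hx (sub h'.left_mem)).trans ((h'.rch w hw).mono sub)

theorem GRung.of_rch (hα : α ∈ A i) (hb : b ∈ B i) (h : Rch G (insert b (T i)) α b) :
    ∃ n S, GRung G A B T i α b n S := by
  obtain ⟨n, S, hS, sS⟩ := h.exists_path
  exact ⟨n, S, hα, hb, hS, sS⟩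

theorem GRung.rch (hs : Strips G a A B T) (h : GRung G A B T i α b n S) :
    Rch G (insert b (T i)) α b := by
  have f := h.facts hs
  refine (h.path.rch_diff b f.2.2.2.1).mono fun w hw => ?_
  exact (f.2.2.2.2.2.2.2.1 w hw.1).resolve_left hw.2

theorem GRung.rch_left (hs : Strips G a A B T) (h : GRung G A B T i α b n S) {u : V} (hu : u ∈ S)
    (hub : u ≠ b) : Rch G (T i) α u := by
  have f := h.facts hs
  obtain ⟨d, U, hU, sU, bU, -⟩ := h.path.initial hu hub
  refine (hU.rch_diff u hU.right_mem).mono fun w hw => ?_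
  rcases f.2.2.2.2.2.2.2.1 w (sU hw.1) with h | rfl | h
  exacts [absurd h hw.2, absurd hw.1 bU, h]

theorem GRung.rch_right (hs : Strips G a A B T) (h : GRung G A B T i α b n S) {u : V} (hu : u ∈ S)
    (huα : u ≠ α) : Rch G (insert b (T i)) u b := by
  have f := h.facts hs
  obtain ⟨d, U, hU, sU, aU, -⟩ := h.path.symm.initial hu huα
  refine (hU.symm.rch b hU.left_mem).mono fun w hw => ?_
  rcases f.2.2.2.2.2.2.2.1 w (sU hw) with rfl | rfl | h
  exacts [absurd hw aU, Or.inl rfl, Or.inr h]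

/-- `v` is linked to `α` through `T i`. -/
def Owns (G : SimpleGraph V) {k : ℕ} (T : Fin k → Set V) (v : V) (i : Fin k) (α : V) : Prop :=
  Rch G (insert α (T i)) v α

namespace Frame

/-- A tail through strip `i` cannot avoid the vertices linked to the same end of `B i`. -/
theorem rch_end_of_owns (F : Frame G a A B C T O) (hv : G.Adj a v) (hvS : v ∉ PSSVerts a A B C)
    (hρ : RungParity G A B T ρ) (he : ∀ {i b n S}, Tail G B T v i b n S → Even (n + ρ))
    (hij : j ≠ i) (hj : Hits G B T v j) (hα : α ∈ A i) (ho : Owns G T v i α) (hb : b ∈ B i)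
    (hr : Rch G (insert b (T i)) α b) : Rch G (insert b (T i)) v b := by
  by_contra hn
  have fv := F.ext_facts hv hvS
  obtain ⟨d, D, hD, sD⟩ := ho.exists_path
  obtain ⟨r, R, hR⟩ := GRung.of_rch hα hb hr
  obtain ⟨c, n, S, hS⟩ := F.exists_tail hj
  have f := hR.facts F.st
  have fS := F.tail_facts hv hvS hS
  have eS := he hS
  have eR := hρ hR
  have hvα : v ≠ α := fun e => fv.2.2 i (e ▸ F.st.memA i α hα)
  have cD : ∀ u ∈ D, u = v ∨ u = α ∨ u ∈ T i := fun u hu => sD hu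
  have aD : a ∉ D := by
    intro h
    rcases cD a h with h | h | h
    exacts [hv.ne h, F.st.apex i α (F.st.memA i α hα) h.symm,
      F.st.apex i a (F.st.memC i a h) rfl]
  have oddD : Odd d := by
    rcases Nat.lt_or_ge d 2 with h | h
    · interval_cases d
      · exact absurd (hD.zero_iff.1 rfl) hvα
      · exact odd_one
    · refine F.sys.ehf.odd_of_vertex hD aD hv (F.st.adjA hα) h fun w hw had => ?_
      rcases cD w hw with h | h | h
      exacts [Or.inl h, Or.inr h, absurd had (F.bt_facts (i := i) (Or.inr h)).2.2.1]
  have toV : ∀ u ∈ D, u ≠ α → Rch G (T i) v u := by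
    intro u hu hua
    obtain ⟨e, U, hU, sU, aU, -⟩ := hD.initial hu hua
    refine (hU.rch_diff u hU.right_mem).mono fun w hw => ?_
    rcases cD w (sU hw.1) with h | rfl | h
    exacts [absurd h hw.2, absurd hw.1 aU, h]
  have no : ∀ u ∈ D, ∀ w ∈ R, u ≠ α → w ≠ α → ¬ (u = w ∨ G.Adj u w) := by
    intro u hu w hw hua hwa h
    have h1 := hR.rch_right F.st hw hwa
    have h2 := (toV u hu hua).mono (Set.subset_insert b (T i))
    rcases h with rfl | h
    · exact hn (h2.trans h1)
    · refine hn ((h2.trans (.step h ?_)).trans h1)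
      rcases f.2.2.2.2.2.2.2.1 w hw with h | h | h
      exacts [absurd h hwa, Or.inl h, Or.inr h]
  have g := hD.glue hR.path
    (fun u hu hu' => by
      by_contra e
      exact no u hu u hu' e e (Or.inl rfl))
    (fun u hu w hw h h' had => no u hu w hw h h' (Or.inr had))
  have cg : ∀ u ∈ D ∪ R, u = v ∨ (u ∈ strV A B T i ∧ (u ∈ B i → u = b)) := by
    rintro u (hu | hu)
    · rcases cD u hu with h | rfl | h
      · exact Or.inl h
      · exact Or.inr ⟨f.2.2.2.2.1 u f.2.2.1, f.2.2.2.2.2.2.1 u f.2.2.1⟩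
      · exact Or.inr ⟨F.st.memC i u h, fun hB => absurd h (F.st.bc i u hB)⟩
    · exact Or.inr ⟨f.2.2.2.2.1 u hu, f.2.2.2.2.2.2.1 u hu⟩
  have := F.sys.ehf.even_of_common_end g.symm hS.path.symm (F.st.adjB hij.symm hb hS.right)
    (by have := f.2.2.2.2.2.2.2.2.2; omega) fS.2.1 (by
      intro u hu hu'
      by_contra huv
      exact hij (F.st.index j i u (fS.2.2.2.2.2 u hu' huv).1
        ((cg u hu).resolve_left huv).1)) (by
      intro u hu w hw huv hwv had
      have h1 := (cg u hu).resolve_left huv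
      have h2 := (F.st.cross i j u w hij.symm h1.1 (fS.2.2.2.2.2 w hw hwv).1).1 had
      exact ⟨h1.2 h2.1, fS.2.2.2.1 w hw h2.2⟩)
  grind

theorem owns_of_rch_end (F : Frame G a A B C T O) (hv : G.Adj a v) (hvS : v ∉ PSSVerts a A B C)
    (hρ : RungParity G A B T ρ) (he : ∀ {i b n S}, Tail G B T v i b n S → Even (n + ρ))
    (hα : α ∈ A i) (hb : b ∈ B i) (hr : Rch G (insert b (T i)) α b)
    (h : Rch G (insert b (T i)) v b) : Owns G T v i α := by
  by_contra hn
  have fv := F.ext_facts hv hvS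
  obtain ⟨r, R, hR⟩ := GRung.of_rch hα hb hr
  obtain ⟨n, S, hS⟩ := tail_of_rch hb h
  have f := hR.facts F.st
  have fS := F.tail_facts hv hvS hS
  have eS := he hS
  have eR := hρ hR
  have toV : ∀ u ∈ S, u ≠ b → Rch G (T i) v u := by
    intro u hu hub
    obtain ⟨e, U, hU, sU, bU, -⟩ := hS.path.initial hu hub
    refine (hU.rch_diff u hU.right_mem).mono fun w hw => ?_
    exact fS.2.2.2.2.1 w (sU hw.1) hw.2 fun e => bU (e ▸ hw.1)
  have toα : ∀ w ∈ R, w ≠ b → Rch G (insert α (T i)) w α := by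
    intro w hw hwb
    obtain ⟨e, U, hU, sU, bU, -⟩ := hR.path.initial hw hwb
    refine (hU.symm.rch α hU.left_mem).mono fun s hs => ?_
    rcases f.2.2.2.2.2.2.2.1 s (sU hs) with h | rfl | h
    exacts [Or.inl h, absurd hs bU, Or.inr h]
  have no : ∀ u ∈ S, ∀ w ∈ R, u ≠ b → w ≠ b → ¬ (u = w ∨ G.Adj u w) := by
    intro u hu w hw hub hwb h
    have h1 := toα w hw hwb
    have h2 := (toV u hu hub).mono (Set.subset_insert α (T i))
    rcases h with rfl | h
    · exact hn (h2.trans h1)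
    · refine hn ((h2.trans (.step h ?_)).trans h1)
      rcases f.2.2.2.2.2.2.2.1 w hw with h | h | h
      exacts [Or.inl h, absurd h hwb, Or.inr h]
  have := (F.adj_iff_even hv hR hS.path fS.2.1
    (fun u hu huv => ⟨(fS.2.2.2.2.2 u hu huv).2.1, (fS.2.2.2.2.2 u hu huv).2.2.1⟩)
    (fun u hu hu' => by
      by_contra e
      exact no u hu u hu' e e (Or.inl rfl))
    (fun u hu w hw h h' had => absurd (Or.inr had) (no u hu w hw h h'))).2 (by grind)
  exact hn (.step this (Or.inl rfl))

theorem owns_of_adj (F : Frame G a A B C T O) (hv : G.Adj a v) (hvS : v ∉ PSSVerts a A B C)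
    (hρ : RungParity G A B T ρ) (he : ∀ {i b n S}, Tail G B T v i b n S → Even (n + ρ))
    (hij : j ≠ i) (hj : Hits G B T v j) (hlj : l ≠ i) (hl : ∀ w ∈ strV A B T l, ¬ G.Adj v w)
    {α₀ α₁ : V} (hα₀ : α₀ ∈ A i) (hα₁ : α₁ ∈ A i) (h0 : Owns G T v i α₀)
    (had : G.Adj α₀ α₁) : Owns G T v i α₁ := by
  by_contra h1
  have fv := F.ext_facts hv hvS
  have O1 : ∀ b ∈ B i, Rch G (insert b (T i)) α₀ b → Rch G (insert b (T i)) v b :=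
    fun b hb hr => rch_end_of_owns F hv hvS hρ he hij hj hα₀ h0 hb hr
  have O2 : ∀ b ∈ B i, Rch G (insert b (T i)) α₁ b → ¬ Rch G (insert b (T i)) v b :=
    fun b hb hr h => h1 (owns_of_rch_end F hv hvS hρ he hα₁ hb hr h)
  obtain ⟨b₀, r₀, R₀, hR₀⟩ := F.rungA i α₀ hα₀
  obtain ⟨b₁, r₁, R₁, hR₁⟩ := F.rungA i α₁ hα₁
  have f₀ := hR₀.facts F.st
  have f₁ := hR₁.facts F.st
  have e₀ := hρ hR₀
  have e₁ := hρ hR₁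
  have n1 := O2 b₁ f₁.2.1 (hR₁.rch F.st)
  have y0 := O1 b₀ f₀.2.1 (hR₀.rch F.st)
  have m₀ : ∀ u ∈ R₀, u ≠ α₀ → u ∈ insert b₀ (T i) := fun u hu h =>
    (f₀.2.2.2.2.2.2.2.1 u hu).resolve_left h
  have m₁ : ∀ u ∈ R₁, u ≠ α₁ → u ∈ insert b₁ (T i) := fun u hu h =>
    (f₁.2.2.2.2.2.2.2.1 u hu).resolve_left h
  have no : ∀ u ∈ R₀, ∀ w ∈ R₁, u = w ∨ G.Adj u w →
      (u = α₀ ∧ w = α₁) ∨ (u = b₀ ∧ w = b₁) := by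
    intro u hu w hw huw
    have c1 : w ≠ α₁ → u = b₀ := by
      intro hwα
      by_contra hub
      refine n1 (O1 b₁ f₁.2.1 ?_)
      have h1 := (hR₀.rch_left F.st hu hub).mono (Set.subset_insert b₁ (T i))
      have h2 := hR₁.rch_right F.st hw hwα
      rcases huw with rfl | h
      exacts [h1.trans h2, (h1.trans (.step h (m₁ w hw hwα))).trans h2]
    have c2 : u ≠ α₀ → w = b₁ := by
      intro huα
      by_contra hwb
      refine O2 b₀ f₀.2.1 ?_ y0
      have h1 := (hR₁.rch_left F.st hw hwb).mono (Set.subset_insert b₀ (T i))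
      have h2 := hR₀.rch_right F.st hu huα
      rcases huw with rfl | h
      exacts [h1.trans h2, (h1.trans (.step h.symm (m₀ u hu huα))).trans h2]
    by_cases e : u = α₀
    · refine Or.inl ⟨e, ?_⟩
      by_contra h
      exact f₀.2.2.2.2.2.2.2.2.1 (e.symm.trans (c1 h))
    · refine Or.inr ⟨c1 fun h => ?_, c2 e⟩
      exact f₁.2.2.2.2.2.2.2.2.1 (h.symm.trans (c2 e))
  have hα01 : α₀ ≠ α₁ := fun e => h1 (e ▸ h0)
  have hb01 : b₀ ≠ b₁ := fun e => n1 (e ▸ y0)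
  have disj : ∀ u ∈ R₀, u ∉ R₁ := by
    intro u hu hu'
    rcases no u hu u hu' (Or.inl rfl) with ⟨h, h'⟩ | ⟨h, h'⟩
    exacts [hα01 (h.symm.trans h'), hb01 (h.symm.trans h')]
  have hbb : G.Adj b₀ b₁ := by
    by_contra hbb
    obtain ⟨n, S, hS⟩ := tail_of_rch f₀.2.1 y0
    have fS := F.tail_facts hv hvS hS
    have eS := he hS
    obtain ⟨c, hc⟩ := F.sys.exists_B l
    have hc' := F.st.memB l c hc
    have toV : ∀ u ∈ S, u ≠ b₀ → Rch G (T i) v u := by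
      intro u hu hub
      obtain ⟨e, U, hU, sU, bU, -⟩ := hS.path.initial hu hub
      refine (hU.rch_diff u hU.right_mem).mono fun w hw => ?_
      exact fS.2.2.2.2.1 w (sU hw.1) hw.2 fun e => bU (e ▸ hw.1)
    have far : ∀ u ∈ S, ∀ w ∈ R₁, ¬ (u = w ∨ G.Adj u w) := by
      intro u hu w hw huw
      by_cases hub : u = b₀
      · subst hub
        rcases no u f₀.2.2.2.1 w hw huw with ⟨h, -⟩ | ⟨-, h⟩
        · exact f₀.2.2.2.2.2.2.2.2.1 h.symm
        · subst h
          exact huw.elim hb01 hbb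
      · have h2 := toV u hu hub
        by_cases hwα : w = α₁
        · subst hwα
          rcases huw with rfl | h
          exacts [h1 (h2.mono (Set.subset_insert _ _)),
            h1 ((h2.mono (Set.subset_insert _ _)).trans (.step h (Or.inl rfl)))]
        · have h3 := hR₁.rch_right F.st hw hwα
          have h2 := h2.mono (Set.subset_insert b₁ (T i))
          rcases huw with rfl | h
          exacts [n1 (h2.trans h3), n1 ((h2.trans (.step h (m₁ w hw hwα))).trans h3)]
    have notc : ∀ u ∈ strV A B T i, u ≠ c := fun u hu e =>
      hlj (F.st.index l i c hc' (e ▸ hu))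
    have adjc : ∀ u ∈ strV A B T i, G.Adj c u → u ∈ B i := fun u hu h =>
      ((F.st.cross l i c u hlj hc' hu).1 h).2
    have j1 := hS.path.snoc (F.st.adjB hlj.symm f₀.2.1 hc) (by
      intro h
      by_cases e : c = v
      · exact fv.2.2 l (e ▸ hc')
      · exact notc c (fS.2.2.2.2.2 c h e).1 rfl) (by
      intro w hw h
      by_cases e : w = v
      · exact absurd (e ▸ h).symm (hl c hc')
      · exact fS.2.2.2.1 w hw (adjc w (fS.2.2.2.2.2 w hw e).1 h))
    have j2 := j1.join hR₁.path.symm (F.st.adjB hlj hc f₁.2.1) (by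
      rw [Set.disjoint_left]
      rintro u (rfl | hu) hu'
      exacts [notc u (f₁.2.2.2.2.1 u hu') rfl, far u hu u hu' (Or.inl rfl)]) (by
      rintro u (rfl | hu) w hw h
      · exact ⟨rfl, f₁.2.2.2.2.2.2.1 w hw (adjc w (f₁.2.2.2.2.1 w hw) h)⟩
      · exact absurd (Or.inr h) (far u hu w hw))
    have := F.sys.ehf.odd_of_vertex j2 (v := a) (by
      rintro ((h | h) | h)
      · exact F.st.apex l c hc' h.symm
      · exact (fS.2.2.2.2.2 a h hv.ne).2.1 rfl
      · exact F.st.apex i a (f₁.2.2.2.2.1 a h) rfl) hv (F.st.adjA hα₁) (by omega) (by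
      rintro w ((rfl | h) | h) h'
      · exact absurd h' (F.bt_facts (i := l) (Or.inl hc)).2.2.1
      · left
        by_contra e
        exact (fS.2.2.2.2.2 w h e).2.2.1 h'
      · right
        exact f₁.2.2.2.2.2.1 w h ((F.st.adj_apex i w (f₁.2.2.2.2.1 w h)).1 h'))
    grind
  have := F.sys.ehf.closeup hR₀.path hR₁.path had hbb (Set.disjoint_left.2 disj)
    (by have := f₀.2.2.2.2.2.2.2.2.2; omega) fun u hu w hw h => no u hu w hw (Or.inr h)
  grind

theorem owns_all (F : Frame G a A B C T O) (hv : G.Adj a v) (hvS : v ∉ PSSVerts a A B C)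
    (hρ : RungParity G A B T ρ) (he : ∀ {i b n S}, Tail G B T v i b n S → Even (n + ρ))
    (hij : j ≠ i) (hj : Hits G B T v j) (hlj : l ≠ i) (hl : ∀ w ∈ strV A B T l, ¬ G.Adj v w)
    (hi : ¬ Misses G A T v i) (hα : α ∈ A i) : Owns G T v i α := by
  by_contra hn
  obtain ⟨α', hα', h'⟩ : ∃ α' ∈ A i, Owns G T v i α' := by
    obtain ⟨w, hw | hw, hvw⟩ := Misses.exists_adj hi
    · exact ⟨w, hw, .step hvw (Or.inl rfl)⟩
    · obtain ⟨t, ht, hr, α', hα', had⟩ := F.toA i w hw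
      exact ⟨α', hα', ((Rch.step hvw (Or.inr hw)).trans (hr.mono (Set.subset_insert _ _))).trans
        (.step had (Or.inl rfl))⟩
  obtain ⟨u, u', -, ⟨α₀, hα₀, h0, hu⟩, had, hu', hn'⟩ := (F.conn i α' (Or.inl hα') α
    (Or.inl hα)).exit (D := {u | ∃ α ∈ A i, Owns G T v i α ∧ Rch G (T i) α u ∧ (u = α ∨ u ∈ T i)})
    ⟨α', hα', h', .refl, Or.inl rfl⟩ (by
      rintro ⟨α₀, hα₀, h0, -, rfl | h⟩
      exacts [hn h0, F.st.ac i α hα h])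
  have huA : u' ∈ A i := hu'.resolve_right fun h =>
    hn' ⟨α₀, hα₀, h0, hu.1.trans (.step had h), Or.inr h⟩
  have hno : ¬ Owns G T v i u' := fun h => hn' ⟨u', huA, h, .refl, Or.inl rfl⟩
  rcases hu with ⟨hu, rfl | hT⟩
  · exact hno (owns_of_adj F hv hvS hρ he hij hj hlj hl hα₀ huA h0 had)
  · obtain ⟨t, ht, hr, b, hb, htb⟩ := F.toB i u hT
    have h1 : Rch G (insert b (T i)) u b :=
      (hr.mono (Set.subset_insert _ _)).trans (.step htb (Or.inl rfl))
    have h2 := rch_end_of_owns F hv hvS hρ he hij hj hα₀ h0 hb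
      ((hu.mono (Set.subset_insert _ _)).trans h1)
    exact hno (owns_of_rch_end F hv hvS hρ he huA hb ((Rch.step had.symm (Or.inr hT)).trans h1) h2)

/-- `v` is linked through strip `i` to the end of every rung. -/
theorem rch_end_of_rung (F : Frame G a A B C T O) (hv : G.Adj a v) (hvS : v ∉ PSSVerts a A B C)
    (hρ : RungParity G A B T ρ) (he : ∀ {i b n S}, Tail G B T v i b n S → Even (n + ρ))
    (hij : j ≠ i) (hj : Hits G B T v j) (hlj : l ≠ i) (hl : ∀ w ∈ strV A B T l, ¬ G.Adj v w)
    (hi : ¬ Misses G A T v i) (hR : GRung G A B T i α b r R) : Rch G (insert b (T i)) v b :=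
  rch_end_of_owns F hv hvS hρ he hij hj hR.left
    (F.owns_all hv hvS hρ he hij hj hlj hl hi hR.left) hR.right (hR.rch F.st)

end Frame
end Owning

section Crossed

variable {V : Type*} {G : SimpleGraph V} {a : V} {k : ℕ} {A B C T : Fin k → Set V} {O : Set V}

/-- Two rivals missing different strips `x` and `y`, with a further strip `z`. -/
structure Crossed (G : SimpleGraph V) (a : V) {k : ℕ} (A B C T : Fin k → Set V) (v₁ v₂ : V)
    (x y z : Fin k) : Prop where
  rivals : Rivals G a A B C v₁ v₂
  misses₁ : Misses G A T v₁ x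
  misses₂ : Misses G A T v₂ y
  hxy : x ≠ y
  hxz : x ≠ z
  hyz : y ≠ z

variable {i j l x y z : Fin k} {v v₁ v₂ α b : V} {n m r ρ : ℕ} {S S' Z : Set V}

theorem Crossed.symm (c : Crossed G a A B C T v₁ v₂ x y z) : Crossed G a A B C T v₂ v₁ y x z :=
  ⟨c.rivals.symm, c.misses₂, c.misses₁, c.hxy.symm, c.hyz, c.hxz⟩

namespace Frame

/-- Everything away from the neighbours of the apex and the inner part of strip `z`. -/
def outer (A B T : Fin k → Set V) (O : Set V) (z : Fin k) : Set V :=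
  union A B T {l | l ≠ z} ∪ O

theorem mem_outer {u : V} (hi : i ≠ z) (hu : u ∈ strV A B T i) : u ∈ outer A B T O z :=
  Or.inl ⟨i, hi, hu⟩

theorem far_outer (F : Frame G a A B C T O) (z : Fin k) :
    Far G (A z ∪ T z) (outer A B T O z) := by
  rintro u hu w (hw | hw)
  exacts [F.far_union (J := {l | l ≠ z}) (fun h => h rfl) u hu w hw, F.far_out u hu w hw]

theorem missed_of_complete (F : Frame G a A B C T O) (hl : Misses G A T v l)
    (h : ∀ j, j ≠ i → ∀ x ∈ A j, G.Adj v x) : i = l := by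
  by_contra hil
  obtain ⟨α, hα⟩ := F.sys.exists_A l
  exact hl α (Or.inl hα) (h l (fun e => hil e.symm) α hα)

theorem rch_outer (F : Frame G a A B C T O) (hv : G.Adj a v) (hvS : v ∉ PSSVerts a A B C)
    (hρ : RungParity G A B T ρ) (hl : Misses G A T v l) (hlz : l ≠ z) :
    ∃ i, i ≠ z ∧ ∃ c ∈ B i, Rch G (outer A B T O z ∩ {u | u ≠ a ∧ ¬ G.Adj a u}) v c := by
  have hB : ∀ {i c}, i ≠ z → c ∈ B i → c ∈ outer A B T O z ∩ {u | u ≠ a ∧ ¬ G.Adj a u} :=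
    fun {i c} hi hc => by
      have := F.bt_facts (w := c) (i := i) (Or.inl hc)
      exact ⟨mem_outer hi this.1, this.2.1, this.2.2.1⟩
  rcases F.misses_cases hv hvS hρ hl with ⟨-, -, h⟩ | ⟨-, c, hc, h⟩ | ⟨h, -⟩
  · obtain ⟨j, hjl, hjz⟩ := F.sys.exists_third l z
    obtain ⟨c, n, S, hS⟩ := F.exists_tail (h j hjl)
    have f := F.tail_facts hv hvS hS
    refine ⟨j, hjz, c, hS.right, (hS.path.rch_diff c hS.path.right_mem).mono ?_⟩
    rintro u ⟨hu, huv⟩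
    have := f.2.2.2.2.2 u hu huv
    exact ⟨mem_outer hjz this.1, this.2.1, this.2.2.1⟩
  · exact ⟨l, hlz, c, hc, .step h (hB hlz hc)⟩
  · obtain ⟨q, m, S, hS⟩ := F.exists_quill hv h
    obtain ⟨i, hi, hq⟩ := F.quill_uniform hv hvS hρ h hS
    obtain rfl := F.missed_of_complete hl hi
    have hr : Rch G (outer A B T O z ∩ {u | u ≠ a ∧ ¬ G.Adj a u}) v q := by
      refine (hS.path.rch_diff q hS.path.right_mem).mono ?_
      rintro u ⟨hu, huv⟩
      have hO := (hS.sub hu).resolve_left huv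
      exact ⟨Or.inr hO, (F.out u hO).1, (F.out u hO).2.1⟩
    rcases hq with ⟨hq, -⟩ | ⟨hq, -⟩
    · obtain ⟨j, c, hc, hqc⟩ := hS.ex
      have : j = i := by
        by_contra h
        exact hq j h c hc hqc
      subst this
      exact ⟨j, hlz, c, hc, hr.trans (.step hqc (hB hlz hc))⟩
    · obtain ⟨j, hji, hjz⟩ := F.sys.exists_third i z
      obtain ⟨c, hc⟩ := F.sys.exists_B j
      exact ⟨j, hjz, c, hc, hr.trans (.step (hq j hji c hc) (hB hjz hc))⟩

theorem exists_outer (F : Frame G a A B C T O) (hρ : RungParity G A B T ρ)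
    (c : Crossed G a A B C T v₁ v₂ x y z) :
    ∃ n S, IPath G v₁ v₂ n S ∧ S ⊆ {v₁, v₂} ∪ outer A B T O z ∧ Odd n := by
  have p := c.rivals
  obtain ⟨i, hi, b, hb, h₁⟩ := F.rch_outer p.adj₁ p.notMem₁ hρ c.misses₁ c.hxz
  obtain ⟨j, hj, d, hd, h₂⟩ := F.rch_outer p.adj₂ p.notMem₂ hρ c.misses₂ c.hyz
  set W := outer A B T O z ∩ {u | u ≠ a ∧ ¬ G.Adj a u} with hW
  have hB : ∀ {i c}, i ≠ z → c ∈ B i → c ∈ W :=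
    fun {i c} hi hc => by
      have := F.bt_facts (w := c) (i := i) (Or.inl hc)
      exact ⟨mem_outer hi this.1, this.2.1, this.2.2.1⟩
  have hbd : Rch G W b d := by
    by_cases hij : i = j
    · obtain ⟨l, hli, hlz⟩ := F.sys.exists_third i z
      obtain ⟨e, he⟩ := F.sys.exists_B l
      have hlj : l ≠ j := hij ▸ hli
      exact (Rch.step (F.st.adjB hli.symm hb he) (hB hlz he)).trans
        (.step (F.st.adjB hlj he hd) (hB hj hd))
    · exact .step (F.st.adjB hij hb hd) (hB hj hd)
  have sub := Set.subset_insert v₂ W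
  obtain ⟨n, S, hS, sS⟩ := ((h₁.trans hbd).mono sub).trans
    ((h₂.mono sub).symm (Set.mem_insert _ _)) |>.exists_path
  have e : ∀ u ∈ S, u = v₁ ∨ u = v₂ ∨ u ∈ W := fun u hu => sS hu
  refine ⟨n, S, hS, fun u hu => ?_, F.odd_of_avoids_apex p hS fun u hu => ?_⟩
  · rcases e u hu with h | h | h
    exacts [Or.inl (Or.inl h), Or.inl (Or.inr h), Or.inr h.1]
  · rcases e u hu with h | h | h
    exacts [Or.inl (Or.inl h), Or.inl (Or.inr h), Or.inr h.2]

theorem even_core (F : Frame G a A B C T O) (hρ : RungParity G A B T ρ)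
    (c : Crossed G a A B C T v₁ v₂ x y z) (h : IPath G v₁ v₂ n S)
    (hS : S ⊆ {v₁, v₂} ∪ (A z ∪ T z)) : Even n := by
  obtain ⟨m, S', hS', sS', hm⟩ := F.exists_outer hρ c
  have := F.sys.ehf.odd_of_far h hS' c.rivals.ne c.rivals.na hS sS' (F.far_outer z)
  grind

theorem odd_outer (F : Frame G a A B C T O) (hρ : RungParity G A B T ρ)
    (c : Crossed G a A B C T v₁ v₂ x y z) (h : IPath G v₁ v₂ n S)
    (hS : S ⊆ {v₁, v₂} ∪ outer A B T O z) : Odd n := by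
  obtain ⟨m, S', hS', sS'⟩ := F.exists_inner (i := z)
    (fun h => c.hxz (F.misses_unique c.rivals.adj₁ c.rivals.notMem₁ c.misses₁ h))
    (fun h => c.hyz (F.misses_unique c.rivals.adj₂ c.rivals.notMem₂ c.misses₂ h))
  have h1 := F.even_core hρ c hS' sS'
  have := F.sys.ehf.odd_of_far hS' h c.rivals.ne c.rivals.na sS' hS (F.far_outer z)
  grind

theorem core_link_false (F : Frame G a A B C T O) (hρ : RungParity G A B T ρ)
    (c : Crossed G a A B C T v₁ v₂ x y z) (h : IPath G v₁ v₂ n S)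
    (hS : S ⊆ {v₁, v₂} ∪ T z) : False := by
  have h1 := F.even_core hρ c h (hS.trans (Set.union_subset_union_right _ Set.subset_union_right))
  have h2 := F.odd_of_avoids_apex c.rivals h fun u hu => (hS hu).imp_right fun h => by
    have := F.bt_facts (i := z) (w := u) (Or.inr h)
    exact ⟨this.2.1, this.2.2.1⟩
  grind

theorem core_rch_false (F : Frame G a A B C T O) (hρ : RungParity G A B T ρ)
    (c : Crossed G a A B C T v₁ v₂ x y z) {u : V} (h : Rch G (T z) v₁ u)
    (hu : G.Adj v₂ u) : False := by
  obtain ⟨n, S, hS, sS⟩ := ((h.mono (Set.subset_insert v₂ _)).trans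
    (.step hu.symm (Set.mem_insert _ _))).exists_path
  refine F.core_link_false hρ c hS fun w hw => ?_
  rcases sS hw with h | h | h
  exacts [Or.inl (Or.inl h), Or.inl (Or.inr h), Or.inr h]

end Frame
end Crossed

section CrossedCases

variable {V : Type*} {G : SimpleGraph V} {a : V} {k : ℕ} {A B C T : Fin k → Set V} {O : Set V}
variable {i j l x y z : Fin k} {v v₁ v₂ α b q : V} {n m r ρ : ℕ} {S S' Z : Set V}

theorem Crossed.not_misses₁ (F : Frame G a A B C T O) (c : Crossed G a A B C T v₁ v₂ x y z)
    (hi : x ≠ i) : ¬ Misses G A T v₁ i := fun h =>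
  hi (F.misses_unique c.rivals.adj₁ c.rivals.notMem₁ c.misses₁ h)

namespace Frame

theorem steady_steady_false (F : Frame G a A B C T O) (hρ : RungParity G A B T ρ)
    (c : Crossed G a A B C T v₁ v₂ x y z)
    (he₁ : ∀ {i b n S}, Tail G B T v₁ i b n S → Even (n + ρ))
    (hx : ∀ w ∈ strV A B T x, ¬ G.Adj v₁ w) (h₁ : Hits G B T v₁ y)
    (he₂ : ∀ {i b n S}, Tail G B T v₂ i b n S → Even (n + ρ))
    (hy : ∀ w ∈ strV A B T y, ¬ G.Adj v₂ w) (h₂ : Hits G B T v₂ x) : False := by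
  have p := c.rivals
  obtain ⟨α, hα⟩ := F.sys.exists_A z
  obtain ⟨b, r, R, hR⟩ := F.rungA z α hα
  have r₁ := F.rch_end_of_rung p.adj₁ p.notMem₁ hρ he₁ c.hyz h₁ c.hxz hx
    (c.not_misses₁ F c.hxz) hR
  have r₂ := F.rch_end_of_rung p.adj₂ p.notMem₂ hρ he₂ c.hxz h₂ c.hyz hy
    (c.symm.not_misses₁ F c.hyz) hR
  have hb := hR.right
  have hb2 : v₂ ≠ b := fun e => (F.ext_facts p.adj₂ p.notMem₂).2.2 z (e ▸ F.st.memB z b hb)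
  have hb1 : v₁ ≠ b := fun e => (F.ext_facts p.adj₁ p.notMem₁).2.2 z (e ▸ F.st.memB z b hb)
  have sub := Set.subset_insert v₂ (insert b (T z))
  obtain ⟨n, S, hS, sS⟩ := ((r₁.mono sub).trans
    ((r₂.mono sub).symm (Set.mem_insert _ _))).exists_path
  have e : ∀ u ∈ S, u = v₁ ∨ u = v₂ ∨ u = b ∨ u ∈ T z := fun u hu => sS hu
  by_cases hbS : b ∈ S
  · obtain ⟨d, d', S₁, S₂, hS₁, hS₂, rfl, hU, hI, -⟩ := hS.split hbS
    have h1 : v₁ ∉ S₂ := fun h => hb1 (hI.subset ⟨hS₁.left_mem, h⟩)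
    have h2 : v₂ ∉ S₁ := fun h => hb2 (hI.subset ⟨h, hS₂.right_mem⟩)
    have e1 := he₁ ⟨hb, hS₁, fun u hu => by
      rcases e u (hU.subset (Or.inl hu)) with h | rfl | h | h
      exacts [Or.inl h, absurd hu h2, Or.inr (Or.inl h), Or.inr (Or.inr h)]⟩
    have e2 := he₂ ⟨hb, hS₂.symm, fun u hu => by
      rcases e u (hU.subset (Or.inr hu)) with rfl | h | h | h
      exacts [absurd hu h1, Or.inl h, Or.inr (Or.inl h), Or.inr (Or.inr h)]⟩
    have := F.odd_of_avoids_apex p hS fun u hu => by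
      rcases e u hu with h | h | h
      · exact Or.inl (Or.inl h)
      · exact Or.inl (Or.inr h)
      · have hu : u ∈ B z ∪ T z := by
          rcases h with rfl | h
          exacts [Or.inl hb, Or.inr h]
        exact Or.inr ⟨(F.bt_facts hu).2.1, (F.bt_facts hu).2.2.1⟩
    grind
  · refine F.core_link_false hρ c hS fun u hu => ?_
    rcases e u hu with h | h | rfl | h
    exacts [Or.inl (Or.inl h), Or.inl (Or.inr h), absurd hu hbS, Or.inr h]

theorem steady_quill_false (F : Frame G a A B C T O) (hρ : RungParity G A B T ρ)
    (c : Crossed G a A B C T v₁ v₂ x y z)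
    (he₁ : ∀ {i b n S}, Tail G B T v₁ i b n S → Even (n + ρ))
    (hx : ∀ w ∈ strV A B T x, ¬ G.Adj v₁ w) (h₁ : Hits G B T v₁ y)
    (hH : ∀ i, ¬ Hits G B T v₂ i) (hA : ∀ u ∈ A x, G.Adj v₂ u) : False := by
  have p := c.rivals
  have f₂ := F.ext_facts p.adj₂ p.notMem₂
  obtain ⟨α, hα⟩ := F.sys.exists_A x
  obtain ⟨b, r, R, hR⟩ := F.rungA x α hα
  obtain ⟨d, n, S, hS⟩ := F.exists_tail h₁
  have f := hR.facts F.st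
  have fS := F.tail_facts p.adj₁ p.notMem₁ hS
  have e1 := he₁ hS
  have e2 := hρ hR
  have j1 := hS.path.join hR.path.symm (F.st.adjB c.hxy.symm hS.right f.2.1) (by
    rw [Set.disjoint_left]
    intro u hu hu'
    by_cases e : u = v₁
    · exact (F.ext_facts p.adj₁ p.notMem₁).2.2 x (e ▸ f.2.2.2.2.1 u hu')
    · exact c.hxy (F.st.index x y u (f.2.2.2.2.1 u hu') (fS.2.2.2.2.2 u hu e).1)) (by
    intro u hu w hw had
    by_cases e : u = v₁
    · exact absurd (e ▸ had) (hx w (f.2.2.2.2.1 w hw))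
    · have := (F.st.cross y x u w c.hxy.symm (fS.2.2.2.2.2 u hu e).1 (f.2.2.2.2.1 w hw)).1 had
      exact ⟨fS.2.2.2.1 u hu this.1, f.2.2.2.2.2.2.1 w hw this.2⟩)
  have j2 := j1.snoc (hA α hα).symm (by
    rintro (h | h)
    · exact f₂.2.2 y (fS.2.2.2.2.2 v₂ h p.ne.symm).1
    · exact f₂.2.2 x (f.2.2.2.2.1 v₂ h)) (by
    rintro w (hw | hw) had
    · rcases fS.2.2.1 w hw with rfl | h
      exacts [absurd had.symm p.na, absurd ⟨w, h, had⟩ (hH y)]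
    · exact F.rung_not_adj (hH x) hR w hw had)
  have := F.odd_outer hρ c j2 (by
    rintro u (h | hu | hu)
    · exact Or.inl (Or.inr h)
    · by_cases e : u = v₁
      · exact Or.inl (Or.inl e)
      · exact Or.inr (mem_outer c.hyz (fS.2.2.2.2.2 u hu e).1)
    · exact Or.inr (mem_outer c.hxz (f.2.2.2.2.1 u hu)))
  grind

/-- An even path from a rival to `b`, avoiding the inner part of the strip of `b`, is impossible
when the other rival is adjacent to `b`. -/
theorem even_path_false (F : Frame G a A B C T O) (hρ : RungParity G A B T ρ)
    (c : Crossed G a A B C T v₁ v₂ x y z) (hb : b ∈ B y) (h₂ : G.Adj v₂ b)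
    (h : IPath G v₁ b n S) (hS : S ⊆ {v₁, b} ∪ outer A B T O y) (hn : Even n) : False := by
  have p := c.rivals
  have f₁ := F.ext_facts p.adj₁ p.notMem₁
  have hb' := F.st.memB y b hb
  have hbE : b ∉ A y ∪ T y := by
    rintro (h | h)
    exacts [F.st.ab y b h hb, F.st.bc y b hb h]
  have hv1 : v₁ ≠ b := fun e => f₁.2.2 y (e ▸ hb')
  obtain ⟨t, D, hD, sD⟩ := exists_link (F.conn y)
    (Misses.exists_adj (c.not_misses₁ F c.hxy)) (v₂ := b) (by
      obtain ⟨α, r, R, hR⟩ := F.rungB y b hb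
      have f := hR.facts F.st
      obtain ⟨r, rfl⟩ := Nat.exists_eq_add_of_le' f.2.2.2.2.2.2.2.2.2
      obtain ⟨w, R', had, hR', hbR, rfl, -⟩ := hR.path.symm.uncons
      refine ⟨w, ?_, had⟩
      rcases f.2.2.2.2.2.2.2.1 w (Or.inr hR'.left_mem) with rfl | rfl | h
      exacts [Or.inl f.1, absurd hR'.left_mem hbR, Or.inr h])
  have j := hD.snoc h₂.symm (by
    intro h
    rcases sD h with (h | h) | h
    · exact p.ne h.symm
    · exact (F.ext_facts p.adj₂ p.notMem₂).2.2 y (h ▸ hb')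
    · exact (F.ext_facts p.adj₂ p.notMem₂).2.2 y (F.subset_strV y h)) (by
    intro w hw had
    rcases sD hw with (h | h) | h
    exacts [absurd (h ▸ had).symm p.na, h, absurd had (c.misses₂ w h)])
  have o := F.odd_outer hρ c j (by
    rintro u (h | hu)
    · exact Or.inl (Or.inr h)
    · rcases sD hu with (h | h) | h
      exacts [Or.inl (Or.inl h), Or.inr (mem_outer c.hyz (h ▸ hb')),
        Or.inr (mem_outer c.hyz (F.subset_strV y h))])
  have na : ¬ G.Adj v₁ b := fun h => by
    have := hD.eq_one h
    grind
  have := F.sys.ehf.odd_of_far hD h hv1 na sD hS (F.far_outer y)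
  grind

theorem crossed_adj_false (F : Frame G a A B C T O) (hρ : RungParity G A B T ρ)
    (c : Crossed G a A B C T v₁ v₂ x y z) (hb : b ∈ B y) (h₂ : G.Adj v₂ b)
    (h₁ : (∃ d ∈ B x, G.Adj v₁ d) ∨
      ((∀ i, ¬ Hits G B T v₁ i) ∧ Even ρ)) : False := by
  have p := c.rivals
  have f₁ := F.ext_facts p.adj₁ p.notMem₁
  have hb' := F.st.memB y b hb
  by_cases hv : G.Adj v₁ b
  · have j : IPath G v₁ v₂ 2 (insert v₁ (insert b {v₂})) := by
      refine ((IPath.single v₂).cons h₂.symm (fun h => h₂.ne h.symm) (fun w hw _ => hw)).cons hv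
        ?_ ?_
      · rintro (h | h)
        exacts [hv.ne h, p.ne h]
      · rintro w (h | rfl) had
        exacts [h, absurd had p.na]
    have := F.odd_outer hρ c j (by
      rintro u (h | h | h)
      exacts [Or.inl (Or.inl h), Or.inr (mem_outer c.hyz (h ▸ hb')), Or.inl (Or.inr h)])
    grind
  rcases h₁ with ⟨d, hd, h₁⟩ | ⟨hH, he⟩
  · have hdb := F.st.adjB c.hxy hd hb
    have hv1 : v₁ ≠ b := fun e => f₁.2.2 y (e ▸ hb')
    have j : IPath G v₁ b 2 (insert v₁ (insert d {b})) := by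
      refine ((IPath.single b).cons hdb (fun h => hdb.ne h) (fun w hw _ => hw)).cons h₁ ?_ ?_
      · rintro (h | h)
        exacts [h₁.ne h, hv1 h]
      · rintro w (h | rfl) had
        exacts [h, absurd had hv]
    refine F.even_path_false hρ c hb h₂ j ?_ even_two
    rintro u (h | rfl | h)
    exacts [Or.inl (Or.inl h), Or.inr (mem_outer c.hxy (F.st.memB x u hd)), Or.inl (Or.inr h)]
  · obtain ⟨q, m, S, hS⟩ := F.exists_quill p.adj₁ hH
    obtain ⟨i, hi, hq⟩ := F.quill_uniform p.adj₁ p.notMem₁ hρ hH hS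
    obtain rfl := F.missed_of_complete c.misses₁ hi
    have sS : ∀ u ∈ S, u = v₁ ∨ u ∈ O := fun u hu => hS.sub hu
    rcases hq with ⟨hq, ho⟩ | ⟨hq, ho⟩
    · obtain ⟨j, d, hd, hqd⟩ := hS.ex
      have : j = i := by
        by_contra h
        exact hq j h d hd hqd
      subst this
      refine F.even_path_false hρ c hb h₂ (F.quill_path_cross p.adj₁ p.notMem₁ hS c.hxy hd hqd hb
        (hq y c.hxy.symm b hb)) ?_ (by grind)
      rintro u (h | rfl | h)
      · exact Or.inl (Or.inr h)
      · exact Or.inr (mem_outer c.hxy (F.st.memB j u hd))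
      · exact (sS u h).elim (fun h => Or.inl (Or.inl h)) fun h => Or.inr (Or.inr h)
    · refine F.even_path_false hρ c hb h₂ (F.quill_path p.adj₁ p.notMem₁ hS hb
        (hq y c.hxy.symm b hb)) ?_ (by grind)
      rintro u (h | h)
      · exact Or.inl (Or.inr h)
      · exact (sS u h).elim (fun h => Or.inl (Or.inl h)) fun h => Or.inr (Or.inr h)

theorem steady_adj_false (F : Frame G a A B C T O) (hρ : RungParity G A B T ρ)
    (c : Crossed G a A B C T v₁ v₂ x y z)
    (he : ∀ {i b n S}, Tail G B T v₁ i b n S → Even (n + ρ)) (hz : Hits G B T v₁ z)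
    (hev : Even ρ) (hb : b ∈ B y) (h₂ : G.Adj v₂ b) : False := by
  have p := c.rivals
  have f₂ := F.ext_facts p.adj₂ p.notMem₂
  have hb' := F.st.memB y b hb
  have hv1b : ¬ G.Adj v₁ b := fun h => by
    have := he (tail_of_adj (T := T) hb h)
    grind
  obtain ⟨d, n, S, hS⟩ := F.exists_tail hz
  have fS := F.tail_facts p.adj₁ p.notMem₁ hS
  have eS := he hS
  have hd' := F.st.memB z d hS.right
  have toV : ∀ u ∈ S, u ≠ d → Rch G (T z) v₁ u := by
    intro u hu hub
    obtain ⟨e, U, hU, sU, bU, -⟩ := hS.path.initial hu hub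
    refine (hU.rch_diff u hU.right_mem).mono fun w hw => ?_
    exact fS.2.2.2.2.1 w (sU hw.1) hw.2 fun e => bU (e ▸ hw.1)
  have hna : ∀ u ∈ S, u ≠ d → ¬ G.Adj v₂ u := fun u hu hub h =>
    F.core_rch_false hρ c (toV u hu hub) h
  have notb : ∀ u ∈ strV A B T z, u ≠ b := fun u hu e => c.hyz (F.st.index y z b hb' (e ▸ hu))
  have adjb : ∀ u ∈ strV A B T z, G.Adj b u → u ∈ B z := fun u hu h =>
    ((F.st.cross y z b u c.hyz hb' hu).1 h).2
  have h2d : G.Adj v₂ d := by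
    by_contra h2d
    have j1 := hS.path.snoc (F.st.adjB c.hyz.symm hS.right hb) (by
      intro h
      by_cases e : b = v₁
      · exact (F.ext_facts p.adj₁ p.notMem₁).2.2 y (e ▸ hb')
      · exact notb b (fS.2.2.2.2.2 b h e).1 rfl) (by
      intro w hw h
      by_cases e : w = v₁
      · exact absurd (e ▸ h).symm hv1b
      · exact fS.2.2.2.1 w hw (adjb w (fS.2.2.2.2.2 w hw e).1 h))
    have j2 := j1.snoc h₂.symm (by
      rintro (h | h)
      · exact f₂.2.2 y (h ▸ hb')
      · exact f₂.2.2 z (fS.2.2.2.2.2 v₂ h p.ne.symm).1) (by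
      rintro w (h | hw) had
      · exact h
      · by_cases e : w = d
        · exact absurd (e ▸ had) h2d
        · exact absurd had (hna w hw e))
    have := F.odd_of_avoids_apex p j2 (by
      rintro u (h | rfl | hu)
      · exact Or.inl (Or.inr h)
      · have := F.bt_facts (i := y) (w := u) (Or.inl hb)
        exact Or.inr ⟨this.2.1, this.2.2.1⟩
      · by_cases e : u = v₁
        · exact Or.inl (Or.inl e)
        · exact Or.inr ⟨(fS.2.2.2.2.2 u hu e).2.1, (fS.2.2.2.2.2 u hu e).2.2.1⟩)
    grind
  obtain ⟨n, rfl⟩ := Nat.exists_eq_add_of_le' fS.2.1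
  obtain ⟨t, S', hdt, hS', hdS', rfl, -⟩ := hS.path.symm.uncons
  have htd : t ≠ d := fun e => hdS' (e ▸ hS'.left_mem)
  have htv : t ≠ v₁ := by
    rintro rfl
    have := hS'.zero_iff.2 rfl
    grind
  have htT := fS.2.2.2.2.1 t (Or.inr hS'.left_mem) htv htd
  have hvt := toV t (Or.inr hS'.left_mem) htd
  obtain ⟨t', ht', hr, α, hα, had⟩ := F.toA z t htT
  have hα' := F.st.memA z α hα
  obtain ⟨r, R, hR, sR⟩ : ∃ r R, IPath G d α r R ∧
      R ⊆ insert d (insert α {u | u ∈ T z ∧ Rch G (T z) t u}) := by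
    have key : ∀ u, Rch G (T z) t u → Rch G {u | u ∈ T z ∧ Rch G (T z) t u} t u := by
      intro u hu
      induction hu with
      | refl => exact .refl
      | tail h1 h2 ih => exact ih.trans (.step h2.1 ⟨h2.2, h1.tail h2⟩)
    exact (((Rch.step hdt (Or.inr ⟨htT, .refl⟩)).trans
      ((key t' hr).mono (Set.subset_insert _ _))).trans (.step had (Or.inl rfl))).exists_path
  have hG : GRung G A B T z α d r R := ⟨hα, hS.right, hR.symm, fun u hu => by
    rcases sR hu with h | h | h
    exacts [Or.inr (Or.inl h), Or.inl h, Or.inr (Or.inr h.1)]⟩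
  have fG := hG.facts F.st
  have eR := hρ hG
  have h2R : ∀ w ∈ R, G.Adj v₂ w → w = d ∨ w = α := by
    intro w hw h
    rcases sR hw with h' | h' | h'
    exacts [Or.inl h', Or.inr h', (F.core_rch_false hρ c (hvt.trans h'.2) h).elim]
  by_cases h2α : G.Adj v₂ α
  · have := fG.2.2.2.2.2.2.2.2.2
    have := F.sys.ehf.odd_of_vertex hR (fun h => f₂.2.2 z (fG.2.2.2.2.1 v₂ h)) h2d h2α
      (by grind) h2R
    grind
  · obtain ⟨β, m, Q, hQ⟩ := F.rungB y b hb
    have fQ := hQ.facts F.st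
    refine F.short_pyramid_false p.adj₂ p.notMem₂ c.hyz hQ hG h₂ h2d (fun w hw h => ?_)
      fun w hw h => (h2R w hw h).resolve_right fun e => h2α (e ▸ h)
    rcases fQ.2.2.2.2.2.2.2.1 w hw with rfl | h' | h'
    exacts [absurd h (c.misses₂ w (Or.inl fQ.1)), h', absurd h (c.misses₂ w (Or.inr h'))]

theorem quill_quill_false (F : Frame G a A B C T O) (hρ : RungParity G A B T ρ)
    (c : Crossed G a A B C T v₁ v₂ x y z) (hH₁ : ∀ i, ¬ Hits G B T v₁ i)
    (hA₁ : ∀ j, j ≠ x → ∀ u ∈ A j, G.Adj v₁ u) (hH₂ : ∀ i, ¬ Hits G B T v₂ i) : False := by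
  have p := c.rivals
  have f₁ := F.ext_facts p.adj₁ p.notMem₁
  have f₂ := F.ext_facts p.adj₂ p.notMem₂
  obtain ⟨q, m, S, hS⟩ := F.exists_quill p.adj₂ hH₂
  obtain ⟨i, hi, hq⟩ := F.quill_uniform p.adj₂ p.notMem₂ hρ hH₂ hS
  obtain rfl := F.missed_of_complete c.misses₂ hi
  have sS : ∀ u ∈ S, u = v₂ ∨ u ∈ O := fun u hu => hS.sub hu
  have hanti : (∀ j, j ≠ i → ∀ b ∈ B j, G.Adj q b) → Even (m + 1 + ρ) →
      ∀ b ∈ B i, ¬ G.Adj q b := by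
    intro _ hm b hb hqb
    obtain ⟨α, r, R, hR⟩ := F.rungB i b hb
    have eR := hρ hR
    exact c.misses₂ α (Or.inl hR.left)
      ((F.quill_adj_iff p.adj₂ p.notMem₂ (hH₂ i) hS hR hqb).2 (by grind))
  by_cases h1 : ∃ u ∈ S, G.Adj v₁ u
  · obtain ⟨u, hu, h1u⟩ := h1
    obtain ⟨m, rfl⟩ : ∃ m', m = m' + 1 := Nat.exists_eq_succ_of_ne_zero fun h =>
      hS.ne (hS.path.zero_iff.1 h).symm
    obtain ⟨s, S', -, hS', hvS', rfl, -⟩ := hS.path.uncons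
    have hO : ∀ u ∈ S', u ∈ O := fun u hu => (sS u (Or.inr hu)).resolve_left fun e =>
      hvS' (e ▸ hu)
    obtain ⟨m', P, hP, sP, -⟩ := hS'.attach (x := v₁) (fun h => f₁.2.1 (hO v₁ h)) (by
      rcases hu with rfl | hu
      exacts [absurd h1u p.na, ⟨u, hu, h1u⟩])
    obtain ⟨j, b, hb, hqb⟩ := hS.ex
    obtain ⟨q', m'', P', hP', sP'⟩ := quill_of_path hH₁ hP
      (Set.insert_subset_insert fun u hu => hO u (sP hu)) hP.right_mem hb hqb
    have hqq : q' = q := by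
      obtain ⟨j', b', hb', hqb'⟩ := hP'.ex
      exact hS.only q' (Or.inr (sP ((sP' hP'.path.right_mem).resolve_left hP'.ne))) j' b' hb' hqb'
    subst hqq
    obtain ⟨i', hi', hq'⟩ := F.quill_uniform p.adj₁ p.notMem₁ hρ hH₁ hP'
    obtain rfl := F.missed_of_complete c.misses₁ hi'
    obtain ⟨dy, hby⟩ := F.sys.exists_B i
    obtain ⟨bz, hbz⟩ := F.sys.exists_B z
    rcases hq with ⟨hq, -⟩ | ⟨hq, hm⟩
    · have hji : j = i := by
        by_contra h
        exact hq j h b hb hqb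
      subst hji
      rcases hq' with ⟨hq', -⟩ | ⟨hq', -⟩
      exacts [hq' j c.hxy.symm b hb hqb, hq z c.hyz.symm bz hbz (hq' z c.hxz.symm bz hbz)]
    · rcases hq' with ⟨hq', -⟩ | ⟨hq', -⟩
      exacts [hq' z c.hxz.symm bz hbz (hq z c.hyz.symm bz hbz),
        hanti hq hm dy hby (hq' i c.hxy.symm dy hby)]
  · push Not at h1
    obtain ⟨d, b, D, hb, hD, sD, hd⟩ : ∃ d b D, b ∈ B i ∧ IPath G v₂ b d D ∧
        (∀ u ∈ D, u = b ∨ u ∈ S ∨ u ∈ B x) ∧ Odd (d + ρ) := by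
      rcases hq with ⟨hq, hm⟩ | ⟨hq, hm⟩
      · obtain ⟨j, b, hb, hqb⟩ := hS.ex
        have hji : j = i := by
          by_contra h
          exact hq j h b hb hqb
        subst hji
        refine ⟨_, b, _, hb, F.quill_path p.adj₂ p.notMem₂ hS hb hqb, ?_, hm⟩
        rintro u (h | h)
        exacts [Or.inl h, Or.inr (Or.inl h)]
      · obtain ⟨b, hb⟩ := F.sys.exists_B i
        obtain ⟨w, hw⟩ := F.sys.exists_B x
        refine ⟨_, b, _, hb, F.quill_path_cross p.adj₂ p.notMem₂ hS c.hxy hw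
          (hq x c.hxy w hw) hb (hanti hq hm b hb), ?_, by grind⟩
        rintro u (h | rfl | h)
        exacts [Or.inl h, Or.inr (Or.inr hw), Or.inr (Or.inl h)]
    obtain ⟨α, r, R, hR⟩ := F.rungB i b hb
    have f := hR.facts F.st
    have eR := hρ hR
    have j1 := hR.path.cons (hA₁ i c.hxy.symm α f.1) (fun h => f₁.2.2 i (f.2.2.2.2.1 v₁ h))
      (F.rung_not_adj (hH₁ i) hR)
    have hv1D : ∀ u ∈ D, u ≠ v₁ ∧ ¬ G.Adj v₁ u := by
      intro u hu
      rcases sD u hu with rfl | h | h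
      · exact ⟨fun e => f₁.2.2 i (e ▸ F.st.memB i u hb), fun h => hH₁ i ⟨u, Or.inl hb, h⟩⟩
      · refine ⟨?_, h1 u h⟩
        rintro rfl
        exact (sS _ h).elim p.ne f₁.2.1
      · exact ⟨fun e => f₁.2.2 x (e ▸ F.st.memB x u h), fun h' => hH₁ x ⟨u, Or.inl h, h'⟩⟩
    have hRD : ∀ u ∈ R, ∀ w ∈ D, u ≠ b → w ≠ b → ¬ (u = w ∨ G.Adj u w) := by
      intro u hu w hw hub hwb h
      have huE : u ∈ A i ∪ T i := by
        rcases f.2.2.2.2.2.2.2.1 u hu with rfl | h | h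
        exacts [Or.inl f.1, absurd h hub, Or.inr h]
      rcases sD w hw with h' | h' | h'
      · exact hwb h'
      · rcases sS w h' with rfl | h'
        · rcases h with rfl | h
          exacts [f₂.2.2 i (F.subset_strV i huE), c.misses₂ u huE h.symm]
        · exact h.elim (F.far_out u huE w h').1 (F.far_out u huE w h').2
      · have := F.far_strips c.hxy.symm u huE w (F.st.memB x w h')
        exact h.elim this.1 this.2
    have g := j1.glue hD.symm (by
      rintro u (rfl | hu) hu'
      · exact absurd rfl (hv1D u hu').1
      · by_contra e
        exact hRD u hu u hu' e e (Or.inl rfl)) (by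
      rintro u (rfl | hu) w hw hub hwb had
      · exact (hv1D w hw).2 had
      · exact hRD u hu w hw hub hwb (Or.inr had))
    have := F.odd_outer hρ c g (by
      rintro u ((h | hu) | hu)
      · exact Or.inl (Or.inl h)
      · exact Or.inr (mem_outer c.hyz (f.2.2.2.2.1 u hu))
      · rcases sD u hu with rfl | h | h
        · exact Or.inr (mem_outer c.hyz (F.st.memB i u hb))
        · exact (sS u h).elim (fun h => Or.inl (Or.inr h)) fun h => Or.inr (Or.inr h)
        · exact Or.inr (mem_outer c.hxz (F.st.memB x u h)))
    grind

theorem crossed_false (F : Frame G a A B C T O) (hρ : RungParity G A B T ρ)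
    (c : Crossed G a A B C T v₁ v₂ x y z) : False := by
  have p := c.rivals
  rcases F.misses_cases p.adj₁ p.notMem₁ hρ c.misses₁ with
      ⟨he₁, hl₁, hh₁⟩ | ⟨ev₁, b₁, hb₁, h₁⟩ | ⟨hH₁, hA₁⟩ <;>
    rcases F.misses_cases p.adj₂ p.notMem₂ hρ c.misses₂ with
      ⟨he₂, hl₂, hh₂⟩ | ⟨ev₂, b₂, hb₂, h₂⟩ | ⟨hH₂, hA₂⟩
  · exact F.steady_steady_false hρ c he₁ hl₁ (hh₁ y c.hxy.symm) he₂ hl₂ (hh₂ x c.hxy)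
  · exact F.steady_adj_false hρ c he₁ (hh₁ z c.hxz.symm) ev₂ hb₂ h₂
  · exact F.steady_quill_false hρ c he₁ hl₁ (hh₁ y c.hxy.symm) hH₂ (hA₂ x c.hxy)
  · exact F.steady_adj_false hρ c.symm he₂ (hh₂ z c.hyz.symm) ev₁ hb₁ h₁
  · exact F.crossed_adj_false hρ c hb₂ h₂ (Or.inl ⟨b₁, hb₁, h₁⟩)
  · exact F.crossed_adj_false hρ c.symm hb₁ h₁ (Or.inr ⟨hH₂, ev₁⟩)
  · exact F.steady_quill_false hρ c.symm he₂ hl₂ (hh₂ x c.hxy) hH₁ (hA₁ y c.hxy.symm)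
  · exact F.crossed_adj_false hρ c hb₂ h₂ (Or.inr ⟨hH₁, ev₂⟩)
  · exact F.quill_quill_false hρ c hH₁ hA₁ hH₂

theorem rivals_false (F : Frame G a A B C T O) (p : Rivals G a A B C v₁ v₂) : False := by
  obtain ⟨ρ, hρ⟩ := F.exists_parity
  have h3 := F.st.three
  have key : ∀ {v}, G.Adj a v → v ∉ PSSVerts a A B C → ∃ l, ∀ j, j ≠ l → ¬ Misses G A T v j := by
    intro v hv hvS
    by_cases h : ∃ l, Misses G A T v l
    · obtain ⟨l, hl⟩ := h
      exact ⟨l, fun j hj hm => hj (F.misses_unique hv hvS hm hl)⟩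
    · exact ⟨⟨0, by omega⟩, fun j _ hj => h ⟨j, hj⟩⟩
  obtain ⟨x, hx⟩ := key p.adj₁ p.notMem₁
  obtain ⟨y, hy⟩ := key p.adj₂ p.notMem₂
  by_cases hxy : x = y
  · subst hxy
    obtain ⟨i, hi, -⟩ := F.sys.exists_third x x
    obtain ⟨j, hj, hji⟩ := F.sys.exists_third x i
    exact F.no_common_pair p hji (hx j hj) (hx i hi) (hy j hj) (hy i hi)
  obtain ⟨z, hzx, hzy⟩ := F.sys.exists_third x y
  by_cases mx : Misses G A T v₁ x
  · by_cases my : Misses G A T v₂ y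
    · exact F.crossed_false hρ ⟨p, mx, my, hxy, Ne.symm hzx, Ne.symm hzy⟩
    · exact F.no_common_pair p hzy (hx z hzx) (hx y (Ne.symm hxy)) (hy z hzy) my
  · exact F.no_common_pair p hzx (hx z hzx) mx (hy z hzy) (hy x hxy)

end Frame
end CrossedCases

theorem statement_17 {V : Type*} [Fintype V] (G : SimpleGraph V)
    (hG : EvenHoleFree G)
    (a : V) (hsp : Splendid G a) (hnx : ¬ ExtNearPrismCrossEnd G a)
    (k : ℕ) (A B C : Fin k → Set V)
    (hsys : IsPyramidStripSystem G a A B C)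
    (hidc : ∀ i, ConnectedSubset G (A i ∪ C i))
    (hmax : ∀ (k' : ℕ) (A' B' C' : Fin k' → Set V),
      IsPyramidStripSystem G a A' B' C' →
      (∀ i, ConnectedSubset G (A' i ∪ C' i)) →
      PSSVerts a A B C ⊆ PSSVerts a A' B' C' →
      PSSVerts a A' B' C' = PSSVerts a A B C) :
    G.IsClique (closedNbhd G a \ PSSVerts a A B C) := by
  have h : MaxSys G a A B C := ⟨hG, hsp, hnx, hsys, hidc, hmax⟩
  have key : ∀ {u}, u ∈ closedNbhd G a \ PSSVerts a A B C → G.Adj a u := fun hu =>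
    hu.1.resolve_left fun e => hu.2 (by rw [e]; exact Set.mem_insert a _)
  intro u hu w hw huw
  by_contra hna
  exact h.frame.rivals_false ⟨key hu, hu.2, key hw, hw.2, huw, hna⟩

end EHF
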